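/- arXiv:2102.10360 — 3 statements merged into one kernel-verified Lean document; each statement's English description precedes it below -/
import Mathlib

section
/- Let n ≥ 5 be an integer, Q = (n−4)(n−2)n(n+2)/16, and let c₁ > 0, c₂, c₃ be real constants. Then there is at most one smooth positive radial solution u of Δ²u = Q·u^{(n+4)/(n−4)} on the open unit ball B₁ ⊂ ℝⁿ, smooth up to the boundary, satisfying the three boundary conditions u = c₁, ∂_ν u = c₂, and Δu = c₃ on ∂B₁. -/
open Metric Real

/-- The Euclidean Laplacian of a function on `ℝⁿ`, as the sum of pure second
derivatives in the coordinate directions. -/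
noncomputable def laplacian {n : ℕ} (u : EuclideanSpace ℝ (Fin n) → ℝ)
    (x : EuclideanSpace ℝ (Fin n)) : ℝ :=
  ∑ i : Fin n, iteratedFDeriv ℝ 2 u x ![EuclideanSpace.single i 1, EuclideanSpace.single i 1]

/-- `u` is a smooth positive radial solution of `Δ²u = Q u^{(n+4)/(n-4)}` on the
unit ball with boundary data `u = c₁`, `∂_ν u = c₂`, `Δu = c₃` on the unit sphere. -/
def IsRadialSol (n : ℕ) (Q c₁ c₂ c₃ : ℝ) (u : EuclideanSpace ℝ (Fin n) → ℝ) : Prop :=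
  ContDiff ℝ (⊤ : ℕ∞) u ∧
  (∀ x ∈ closedBall (0 : EuclideanSpace ℝ (Fin n)) 1, 0 < u x) ∧
  (∃ φ : ℝ → ℝ, ContDiff ℝ (⊤ : ℕ∞) φ ∧ ∀ x, u x = φ ‖x‖) ∧
  (∀ x ∈ ball (0 : EuclideanSpace ℝ (Fin n)) 1,
    laplacian (laplacian u) x = Q * u x ^ (((n : ℝ) + 4) / ((n : ℝ) - 4))) ∧
  (∀ x ∈ sphere (0 : EuclideanSpace ℝ (Fin n)) 1, u x = c₁) ∧
  (∀ x ∈ sphere (0 : EuclideanSpace ℝ (Fin n)) 1, fderiv ℝ u x x = c₂) ∧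
  (∀ x ∈ sphere (0 : EuclideanSpace ℝ (Fin n)) 1, laplacian u x = c₃)

/-- The Laplacian on `ℝ^(m+1)` in the radial variable. -/
noncomputable def radialLaplacian (m : ℕ) (φ : ℝ → ℝ) (r : ℝ) : ℝ :=
  deriv (deriv φ) r + m / r * deriv φ r

theorem hasFDerivAt_norm_of_ne_zero {E : Type*} [NormedAddCommGroup E] [InnerProductSpace ℝ E]
    {x : E} (hx : x ≠ 0) : HasFDerivAt (fun y : E => ‖y‖) (‖x‖⁻¹ • innerSL ℝ x) x := by
  have h := (hasStrictFDerivAt_norm_sq x).hasFDerivAt.sqrt (pow_ne_zero 2 (norm_ne_zero_iff.2 hx))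
  simp only [Real.sqrt_sq (norm_nonneg _)] at h
  refine h.congr_fderiv ?_
  ext y
  simp only [smul_apply, smul_eq_mul, nsmul_eq_mul]
  field_simp
  norm_num

theorem hasFDerivAt_comp_norm {E : Type*} [NormedAddCommGroup E] [InnerProductSpace ℝ E]
    {φ : ℝ → ℝ} {x : E} (hx : x ≠ 0) (hφ : DifferentiableAt ℝ φ ‖x‖) :
    HasFDerivAt (fun y : E => φ ‖y‖) ((deriv φ ‖x‖ / ‖x‖) • innerSL ℝ x) x := by
  refine (hφ.hasDerivAt.comp_hasFDerivAt x (hasFDerivAt_norm_of_ne_zero hx)).congr_fderiv ?_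
  rw [smul_smul, div_eq_mul_inv]

theorem laplacian_eq_radialLaplacian {m : ℕ} {f : EuclideanSpace ℝ (Fin (m + 1)) → ℝ} {φ : ℝ → ℝ}
    (hφ : ContDiffOn ℝ (⊤ : ℕ∞) φ (Set.Ioi 0)) (hf : ∀ x, x ≠ 0 → f x = φ ‖x‖)
    {x : EuclideanSpace ℝ (Fin (m + 1))} (hx : x ≠ 0) :
    laplacian f x = radialLaplacian m φ ‖x‖ := by
  have hx0 : 0 < ‖x‖ := norm_pos_iff.2 hx
  have hgrad : ∀ y, y ≠ 0 → fderiv ℝ f y = (deriv φ ‖y‖ / ‖y‖) • innerSL ℝ y := by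
    intro y hy
    have hφy : DifferentiableAt ℝ φ ‖y‖ :=
      (hφ.differentiableOn (by simp)).differentiableAt (Ioi_mem_nhds (norm_pos_iff.2 hy))
    refine ((hasFDerivAt_comp_norm hy hφy).congr_of_eventuallyEq ?_).fderiv
    filter_upwards [isOpen_ne.mem_nhds hy] with z hz using hf z hz
  have hφ' : DifferentiableAt ℝ (deriv φ) ‖x‖ :=
    ((hφ.deriv_of_isOpen (m := (⊤ : ℕ∞)) isOpen_Ioi (by simp)).differentiableOn
      (by simp)).differentiableAt (Ioi_mem_nhds hx0)
  have hquot : HasDerivAt (fun r => deriv φ r / r)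
      ((deriv (deriv φ) ‖x‖ * ‖x‖ - deriv φ ‖x‖ * 1) / ‖x‖ ^ 2) ‖x‖ :=
    hφ'.hasDerivAt.div (hasDerivAt_id _) hx0.ne'
  have hhess := ((hquot.comp_hasFDerivAt x (hasFDerivAt_norm_of_ne_zero hx)).smul
    (innerSL ℝ (E := EuclideanSpace ℝ (Fin (m + 1)))).hasFDerivAt).congr_of_eventuallyEq
      (show fderiv ℝ f =ᶠ[nhds x] _ by
        filter_upwards [isOpen_ne.mem_nhds hx] with z hz using hgrad z hz)
  have hentry : ∀ i : Fin (m + 1),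
      iteratedFDeriv ℝ 2 f x ![EuclideanSpace.single i 1, EuclideanSpace.single i 1] =
        deriv φ ‖x‖ / ‖x‖ +
          (deriv (deriv φ) ‖x‖ * ‖x‖ - deriv φ ‖x‖) / ‖x‖ ^ 3 * x i ^ 2 := by
    intro i
    rw [iteratedFDeriv_two_apply, hhess.fderiv]
    change deriv φ ‖x‖ / ‖x‖ * inner ℝ (EuclideanSpace.single i (1 : ℝ))
        (EuclideanSpace.single i (1 : ℝ)) +
      (deriv (deriv φ) ‖x‖ * ‖x‖ - deriv φ ‖x‖ * 1) / ‖x‖ ^ 2 *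
        (‖x‖⁻¹ * inner ℝ x (EuclideanSpace.single i (1 : ℝ))) *
          inner ℝ x (EuclideanSpace.single i (1 : ℝ)) = _
    simp only [EuclideanSpace.inner_single_right, PiLp.single_apply, if_true, map_one, one_mul,
      conj_trivial]
    field_simp
  simp only [laplacian, hentry, Finset.sum_add_distrib, ← Finset.mul_sum,
    ← EuclideanSpace.real_norm_sq_eq, radialLaplacian]
  simp
  field_simp
  ring

theorem ContDiffOn.radialLaplacian {m : ℕ} {φ : ℝ → ℝ}
    (hφ : ContDiffOn ℝ (⊤ : ℕ∞) φ (Set.Ioi 0)) :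
    ContDiffOn ℝ (⊤ : ℕ∞) (radialLaplacian m φ) (Set.Ioi 0) := by
  have h1 := hφ.deriv_of_isOpen (m := (⊤ : ℕ∞)) isOpen_Ioi (by simp)
  have h2 := h1.deriv_of_isOpen (m := (⊤ : ℕ∞)) isOpen_Ioi (by simp)
  exact h2.add ((contDiffOn_const.div contDiffOn_id fun r hr => (Set.mem_Ioi.1 hr).ne').mul h1)

theorem hasDerivAt_of_contDiffOn_Ioi {φ : ℝ → ℝ} (hφ : ContDiffOn ℝ (⊤ : ℕ∞) φ (Set.Ioi 0))
    {r : ℝ} (hr : 0 < r) : HasDerivAt φ (deriv φ r) r :=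
  ((hφ.differentiableOn (by simp)).differentiableAt (Ioi_mem_nhds hr)).hasDerivAt

theorem hasDerivAt_pow_mul_deriv {m : ℕ} {φ : ℝ → ℝ}
    (hφ : ContDiffOn ℝ (⊤ : ℕ∞) φ (Set.Ioi 0)) {r : ℝ} (hr : 0 < r) :
    HasDerivAt (fun s => s ^ m * deriv φ s) (r ^ m * radialLaplacian m φ r) r := by
  have h1 := hφ.deriv_of_isOpen (m := (⊤ : ℕ∞)) isOpen_Ioi (by simp)
  refine ((hasDerivAt_pow m r).mul (hasDerivAt_of_contDiffOn_Ioi h1 hr)).congr_deriv ?_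
  rcases m with _ | m
  · simp [radialLaplacian]
  · simp only [radialLaplacian, Nat.add_sub_cancel]
    field_simp
    ring

theorem continuousOn_pow_mul_deriv_radialLaplacian {m : ℕ} (hm : 3 ≤ m) {φ : ℝ → ℝ}
    (hφ : ContDiff ℝ (⊤ : ℕ∞) φ) :
    ContinuousOn (fun r => r ^ m * deriv (radialLaplacian m φ) r) (Set.Icc 0 1) := by
  obtain ⟨k, rfl⟩ := Nat.exists_eq_add_of_le' hm
  have h1 : ContDiff ℝ (⊤ : ℕ∞) (deriv φ) := hφ.deriv'
  have h2 : ContDiff ℝ (⊤ : ℕ∞) (deriv (deriv φ)) := h1.deriv'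
  have h3 : ContDiff ℝ (⊤ : ℕ∞) (deriv (deriv (deriv φ))) := h2.deriv'
  have c1 := h1.continuous
  have c2 := h2.continuous
  have c3 := h3.continuous
  have hcont : Continuous fun r => r ^ (k + 3) * deriv (deriv (deriv φ)) r +
      ((k + 3 : ℕ) : ℝ) * (r ^ (k + 2) * deriv (deriv φ) r - r ^ (k + 1) * deriv φ r) := by
    fun_prop
  refine hcont.continuousOn.congr fun r hr => ?_
  rcases hr.1.eq_or_lt with rfl | hr0
  · simp
  · have hd := ((h2.differentiable (by simp) r).hasDerivAt).add
      (((hasDerivAt_const r ((k + 3 : ℕ) : ℝ)).div (hasDerivAt_id r) hr0.ne').mul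
        ((h1.differentiable (by simp) r).hasDerivAt))
    have hd' : deriv (radialLaplacian (k + 3) φ) r = _ := hd.deriv
    simp only [hd', id, Pi.div_apply]
    field_simp
    ring

/-- Backward comparison from `r = 1` for the radial fourth order system
`w' = r⁻ᵐ B`, `B' = rᵐ v`, `v' = r⁻ᵐ A`, `A' = rᵐ g`. -/
theorem flux_nonpos_of_terminal_zero {m : ℕ} {w B v A g : ℝ → ℝ}
    (hw : ∀ r ∈ Set.Ioc (0 : ℝ) 1, HasDerivAt w (B r / r ^ m) r)
    (hB : ∀ r ∈ Set.Ioc (0 : ℝ) 1, HasDerivAt B (r ^ m * v r) r)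
    (hv : ∀ r ∈ Set.Ioc (0 : ℝ) 1, HasDerivAt v (A r / r ^ m) r)
    (hA : ∀ r ∈ Set.Ioc (0 : ℝ) 1, HasDerivAt A (r ^ m * g r) r)
    (hAc : ContinuousOn A (Set.Icc 0 1)) (hA0 : A 0 = 0)
    (hw1 : w 1 = 0) (hB1 : B 1 = 0) (hv1 : v 1 = 0)
    (hg : ∀ r ∈ Set.Ioc (0 : ℝ) 1, w r ≤ 0 → g r ≤ 0) : A 1 ≤ 0 := by
  by_contra! hA1
  have hclosed : IsClosed (Set.Icc (0 : ℝ) 1 ∩ A ⁻¹' Set.Iic 0) :=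
    hAc.preimage_isClosed_of_isClosed isClosed_Icc isClosed_Iic
  obtain ⟨s, ⟨⟨hs0, hs1⟩, hAs⟩, hsmax⟩ :=
    (isCompact_Icc.of_isClosed_subset hclosed Set.inter_subset_left).exists_isGreatest
      ⟨0, by simp, by simp [hA0]⟩
  have hs1' : s < 1 := hs1.lt_of_ne (by rintro rfl; exact absurd hAs (by simpa using hA1))
  have hsub : Set.Ioc s 1 ⊆ Set.Ioc 0 1 := Set.Ioc_subset_Ioc_left hs0
  have hint : interior (Set.Ioc s 1) = Set.Ioo s 1 := interior_Ioc
  have hIoo : Set.Ioo s 1 ⊆ Set.Ioc 0 1 := Set.Ioo_subset_Ioc_self.trans hsub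
  have hone : (1 : ℝ) ∈ Set.Ioc s 1 := ⟨hs1', le_rfl⟩
  have hApos : ∀ r ∈ Set.Ioc s 1, 0 < A r := by
    intro r hr
    by_contra! h
    exact absurd (hsmax ⟨⟨hs0.trans hr.1.le, hr.2⟩, h⟩) (not_le.2 hr.1)
  have hvle : ∀ r ∈ Set.Ioc s 1, v r ≤ 0 := by
    have hmono : MonotoneOn v (Set.Ioc s 1) := by
      refine monotoneOn_of_deriv_nonneg (convex_Ioc s 1)
        (fun r hr => (hv r (hsub hr)).continuousAt.continuousWithinAt) ?_ ?_ <;> rw [hint]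
      · exact fun r hr => (hv r (hIoo hr)).differentiableAt.differentiableWithinAt
      · intro r hr
        rw [(hv r (hIoo hr)).deriv]
        exact div_nonneg (hApos r (Set.Ioo_subset_Ioc_self hr)).le
          (pow_nonneg (hIoo hr).1.le m)
    exact fun r hr => hv1 ▸ hmono hr hone hr.2
  have hBnonneg : ∀ r ∈ Set.Ioc s 1, 0 ≤ B r := by
    have hanti : AntitoneOn B (Set.Ioc s 1) := by
      refine antitoneOn_of_deriv_nonpos (convex_Ioc s 1)
        (fun r hr => (hB r (hsub hr)).continuousAt.continuousWithinAt) ?_ ?_ <;> rw [hint]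
      · exact fun r hr => (hB r (hIoo hr)).differentiableAt.differentiableWithinAt
      · intro r hr
        rw [(hB r (hIoo hr)).deriv]
        exact mul_nonpos_of_nonneg_of_nonpos (pow_nonneg (hIoo hr).1.le m)
          (hvle r (Set.Ioo_subset_Ioc_self hr))
    exact fun r hr => hB1 ▸ hanti hr hone hr.2
  have hwle : ∀ r ∈ Set.Ioc s 1, w r ≤ 0 := by
    have hmono : MonotoneOn w (Set.Ioc s 1) := by
      refine monotoneOn_of_deriv_nonneg (convex_Ioc s 1)
        (fun r hr => (hw r (hsub hr)).continuousAt.continuousWithinAt) ?_ ?_ <;> rw [hint]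
      · exact fun r hr => (hw r (hIoo hr)).differentiableAt.differentiableWithinAt
      · intro r hr
        rw [(hw r (hIoo hr)).deriv]
        exact div_nonneg (hBnonneg r (Set.Ioo_subset_Ioc_self hr))
          (pow_nonneg (hIoo hr).1.le m)
    exact fun r hr => hw1 ▸ hmono hr hone hr.2
  have hAanti : AntitoneOn A (Set.Icc s 1) := by
    refine antitoneOn_of_deriv_nonpos (convex_Icc s 1)
      (hAc.mono (Set.Icc_subset_Icc_left hs0)) ?_ ?_ <;> rw [interior_Icc]
    · exact fun r hr => (hA r (hIoo hr)).differentiableAt.differentiableWithinAt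
    · intro r hr
      rw [(hA r (hIoo hr)).deriv]
      exact mul_nonpos_of_nonneg_of_nonpos (pow_nonneg (hIoo hr).1.le m)
        (hg r (hIoo hr) (hwle r (Set.Ioo_subset_Ioc_self hr)))
  have := hAanti (Set.left_mem_Icc.2 hs1) (Set.right_mem_Icc.2 hs1) hs1
  exact absurd (this.trans hAs) (not_le.2 hA1)

theorem eq_zero_of_terminal_zero {m : ℕ} {w B v A g : ℝ → ℝ} {L : ℝ}
    (hw : ∀ r ∈ Set.Ioc (0 : ℝ) 1, HasDerivAt w (B r / r ^ m) r)
    (hB : ∀ r ∈ Set.Ioc (0 : ℝ) 1, HasDerivAt B (r ^ m * v r) r)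
    (hv : ∀ r ∈ Set.Ioc (0 : ℝ) 1, HasDerivAt v (A r / r ^ m) r)
    (hA : ∀ r ∈ Set.Ioc (0 : ℝ) 1, HasDerivAt A (r ^ m * g r) r)
    (hw1 : w 1 = 0) (hB1 : B 1 = 0) (hv1 : v 1 = 0) (hA1 : A 1 = 0)
    (hg : ∀ r ∈ Set.Ioc (0 : ℝ) 1, |g r| ≤ L * |w r|) {r : ℝ} (hr : r ∈ Set.Ioc (0 : ℝ) 1) :
    w r = 0 := by
  have hmem : ∀ t ∈ Set.Icc 0 (1 - r), 1 - t ∈ Set.Ioc (0 : ℝ) 1 := fun t ht =>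
    ⟨by linarith [ht.2, hr.1], by linarith [ht.1]⟩
  have hsub : ∀ t, HasDerivAt (fun s : ℝ => 1 - s) (-1) t := fun t => by
    simpa using (hasDerivAt_id t).const_sub 1
  have hderiv : ∀ t ∈ Set.Icc 0 (1 - r),
      HasDerivAt (fun t => (w (1 - t), B (1 - t), v (1 - t), A (1 - t)))
        (B (1 - t) / (1 - t) ^ m * -1, (1 - t) ^ m * v (1 - t) * -1,
          A (1 - t) / (1 - t) ^ m * -1, (1 - t) ^ m * g (1 - t) * -1) t := fun t ht =>
    ((hw _ (hmem t ht)).comp t (hsub t)).prodMk <| ((hB _ (hmem t ht)).comp t (hsub t)).prodMk <|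
      ((hv _ (hmem t ht)).comp t (hsub t)).prodMk ((hA _ (hmem t ht)).comp t (hsub t))
  have hbound := norm_le_gronwallBound_of_norm_deriv_right_le
    (δ := 0) (K := (r ^ m)⁻¹ + 1 + |L|) (ε := 0)
    (fun t ht => (hderiv t ht).continuousAt.continuousWithinAt)
    (fun t ht => (hderiv t (Set.Ico_subset_Icc_self ht)).hasDerivWithinAt)
    (by simp [hw1, hB1, hv1, hA1]) ?_ (1 - r) ⟨by linarith [hr.2], le_rfl⟩
  · rw [gronwallBound_ε0_δ0] at hbound
    have := (norm_fst_le _).trans hbound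
    simpa using this
  · intro t ht
    have ht' := hmem t (Set.Ico_subset_Icc_self ht)
    have hrt : r ≤ 1 - t := by linarith [ht.2]
    generalize 1 - t = s at ht' hrt ⊢
    have hs0 := ht'.1
    have hpow : s ^ m ≤ 1 := pow_le_one₀ hs0.le ht'.2
    have hinv : (s ^ m)⁻¹ ≤ (r ^ m)⁻¹ :=
      inv_anti₀ (pow_pos hr.1 m) (pow_le_pow_left₀ hr.1.le hrt m)
    have hpos : 0 < (r ^ m)⁻¹ := inv_pos.2 (pow_pos hr.1 m)
    set N := ‖(w s, B s, v s, A s)‖ with hN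
    have hN0 : 0 ≤ N := norm_nonneg _
    have hwN : |w s| ≤ N := norm_fst_le (w s, B s, v s, A s)
    have h2N := norm_snd_le (w s, B s, v s, A s)
    have hBN : |B s| ≤ N := (norm_fst_le (B s, v s, A s)).trans h2N
    have h3N := (norm_snd_le (B s, v s, A s)).trans h2N
    have hvN : |v s| ≤ N := (norm_fst_le (v s, A s)).trans h3N
    have hAN : |A s| ≤ N := (norm_snd_le (v s, A s)).trans h3N
    have hgN : |g s| ≤ |L| * N := (hg s ht').trans
      (mul_le_mul (le_abs_self L) hwN (abs_nonneg _) (abs_nonneg L))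
    have hdiv : ∀ a, |a| ≤ N → |a / s ^ m| ≤ ((r ^ m)⁻¹ + 1 + |L|) * N := fun a ha => by
      rw [div_eq_mul_inv, abs_mul, abs_of_pos (inv_pos.2 (pow_pos hs0 m)), mul_comm]
      exact mul_le_mul (by linarith [abs_nonneg L]) ha (abs_nonneg _)
        (by linarith [abs_nonneg L])
    have hmul : ∀ a, |a| ≤ (1 + |L|) * N → |s ^ m * a| ≤ ((r ^ m)⁻¹ + 1 + |L|) * N := fun a ha => by
      rw [abs_mul, abs_of_pos (pow_pos hs0 m)]
      nlinarith [mul_le_mul_of_nonneg_right hpow (abs_nonneg a), mul_nonneg hpos.le hN0]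
    have hLN : 0 ≤ |L| * N := mul_nonneg (abs_nonneg L) hN0
    simp only [mul_neg, mul_one, Prod.norm_mk, norm_neg, Real.norm_eq_abs, add_zero, sup_le_iff]
    exact ⟨hdiv _ hBN, hmul _ (by linarith), hdiv _ hAN, hmul _ (by linarith)⟩

/-- The one-dimensional boundary value problem solved by the radial profile of a solution. -/
structure IsRadialProfile (m : ℕ) (Q p c₁ c₂ c₃ : ℝ) (φ : ℝ → ℝ) : Prop where
  contDiff : ContDiff ℝ (⊤ : ℕ∞) φ
  pos : ∀ r ∈ Set.Icc (0 : ℝ) 1, 0 < φ r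
  eq : ∀ r ∈ Set.Ioc (0 : ℝ) 1, radialLaplacian m (radialLaplacian m φ) r = Q * φ r ^ p
  value : φ 1 = c₁
  slope : deriv φ 1 = c₂
  radialLaplacian_one : radialLaplacian m φ 1 = c₃

theorem IsRadialSol.exists_profile {m : ℕ} {Q c₁ c₂ c₃ : ℝ}
    {u : EuclideanSpace ℝ (Fin (m + 1)) → ℝ} (h : IsRadialSol (m + 1) Q c₁ c₂ c₃ u) :
    ∃ φ, IsRadialProfile m Q ((((m + 1 : ℕ) : ℝ) + 4) / (((m + 1 : ℕ) : ℝ) - 4)) c₁ c₂ c₃ φ ∧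
      ∀ x, u x = φ ‖x‖ := by
  obtain ⟨-, hpos, ⟨φ, hφ, hu⟩, hpde, hval, hslope, hlap⟩ := h
  have hφ0 : ContDiffOn ℝ (⊤ : ℕ∞) φ (Set.Ioi 0) := hφ.contDiffOn
  have hlapu : ∀ x, x ≠ 0 → laplacian u x = radialLaplacian m φ ‖x‖ := fun x hx =>
    laplacian_eq_radialLaplacian hφ0 (fun y _ => hu y) hx
  set e : EuclideanSpace ℝ (Fin (m + 1)) := EuclideanSpace.single 0 1
  have he : ‖e‖ = 1 := by simp [e]
  have he0 : e ≠ 0 := norm_ne_zero_iff.1 (by simp [he])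
  have hes : e ∈ sphere (0 : EuclideanSpace ℝ (Fin (m + 1))) 1 := by simp [he]
  have hnorm : ∀ r : ℝ, 0 ≤ r → ‖r • e‖ = r := fun r hr => by
    simp [norm_smul, he, abs_of_nonneg hr]
  have hpos' : ∀ r ∈ Set.Icc (0 : ℝ) 1, 0 < φ r := fun r hr => by
    have := hpos (r • e) (by simpa [hnorm r hr.1] using hr.2)
    rwa [hu, hnorm r hr.1] at this
  refine ⟨φ, ⟨hφ, hpos', ?_, ?_, ?_, ?_⟩, hu⟩
  · have hcont := (hφ0.radialLaplacian (m := m)).radialLaplacian (m := m) |>.continuousOn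
    refine Set.EqOn.of_subset_closure (s := Set.Ioo 0 1) ?_
      (hcont.mono Set.Ioc_subset_Ioi_self) ?_ Set.Ioo_subset_Ioc_self ?_
    · intro r hr
      have hre := hnorm r hr.1.le
      have hre0 : r • e ≠ 0 := norm_ne_zero_iff.1 (by rw [hre]; exact hr.1.ne')
      have := hpde (r • e) (by simpa [hre] using hr.2)
      rwa [laplacian_eq_radialLaplacian hφ0.radialLaplacian hlapu hre0, hu, hre] at this
    · exact continuousOn_const.mul (hφ.continuous.continuousOn.rpow_const fun r hr =>
        Or.inl (hpos' r (Set.Ioc_subset_Icc_self hr)).ne')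
    · rw [closure_Ioo zero_ne_one]
      exact Set.Ioc_subset_Icc_self
  · rw [← hval e hes, hu, he]
  · have hd := hasFDerivAt_comp_norm he0 (hφ.differentiable (by simp) ‖e‖)
    rw [← hslope e hes, show u = fun y => φ ‖y‖ from funext hu, hd.fderiv]
    simp [he]
  · rw [← hlap e hes, hlapu e he0, he]

theorem IsRadialProfile.eqOn {m : ℕ} (hm : 3 ≤ m) {Q p c₁ c₂ c₃ : ℝ} (hQ : 0 ≤ Q) (hp : 0 ≤ p)
    {φ₁ φ₂ : ℝ → ℝ} (h₁ : IsRadialProfile m Q p c₁ c₂ c₃ φ₁)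
    (h₂ : IsRadialProfile m Q p c₁ c₂ c₃ φ₂) : Set.EqOn φ₁ φ₂ (Set.Icc 0 1) := by
  have d₁ : ContDiffOn ℝ (⊤ : ℕ∞) φ₁ (Set.Ioi 0) := h₁.contDiff.contDiffOn
  have d₂ : ContDiffOn ℝ (⊤ : ℕ∞) φ₂ (Set.Ioi 0) := h₂.contDiff.contDiffOn
  have l₁ := d₁.radialLaplacian (m := m)
  have l₂ := d₂.radialLaplacian (m := m)
  let w := fun r => φ₁ r - φ₂ r
  let B := fun r => r ^ m * deriv φ₁ r - r ^ m * deriv φ₂ r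
  let v := fun r => radialLaplacian m φ₁ r - radialLaplacian m φ₂ r
  let A := fun r =>
    r ^ m * deriv (radialLaplacian m φ₁) r - r ^ m * deriv (radialLaplacian m φ₂) r
  let g := fun r => Q * φ₁ r ^ p - Q * φ₂ r ^ p
  have hw : ∀ r ∈ Set.Ioc (0 : ℝ) 1, HasDerivAt w (B r / r ^ m) r := fun r hr =>
    ((hasDerivAt_of_contDiffOn_Ioi d₁ hr.1).sub (hasDerivAt_of_contDiffOn_Ioi d₂ hr.1)).congr_deriv
      (by simp only [B, ← mul_sub]; rw [mul_div_cancel_left₀ _ (pow_pos hr.1 m).ne'])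
  have hB : ∀ r ∈ Set.Ioc (0 : ℝ) 1, HasDerivAt B (r ^ m * v r) r := fun r hr =>
    ((hasDerivAt_pow_mul_deriv d₁ hr.1).sub (hasDerivAt_pow_mul_deriv d₂ hr.1)).congr_deriv
      (mul_sub _ _ _).symm
  have hv : ∀ r ∈ Set.Ioc (0 : ℝ) 1, HasDerivAt v (A r / r ^ m) r := fun r hr =>
    ((hasDerivAt_of_contDiffOn_Ioi l₁ hr.1).sub (hasDerivAt_of_contDiffOn_Ioi l₂ hr.1)).congr_deriv
      (by simp only [A, ← mul_sub]; rw [mul_div_cancel_left₀ _ (pow_pos hr.1 m).ne'])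
  have hA : ∀ r ∈ Set.Ioc (0 : ℝ) 1, HasDerivAt A (r ^ m * g r) r := fun r hr =>
    ((hasDerivAt_pow_mul_deriv l₁ hr.1).sub (hasDerivAt_pow_mul_deriv l₂ hr.1)).congr_deriv
      (by rw [h₁.eq r hr, h₂.eq r hr, ← mul_sub])
  have hAc : ContinuousOn A (Set.Icc 0 1) :=
    (continuousOn_pow_mul_deriv_radialLaplacian hm h₁.contDiff).sub
      (continuousOn_pow_mul_deriv_radialLaplacian hm h₂.contDiff)
  have hA0 : A 0 = 0 := by simp [A, show m ≠ 0 by omega]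
  have hw1 : w 1 = 0 := by simp [w, h₁.value, h₂.value]
  have hB1 : B 1 = 0 := by simp [B, h₁.slope, h₂.slope]
  have hv1 : v 1 = 0 := by simp [v, h₁.radialLaplacian_one, h₂.radialLaplacian_one]
  have hIcc : ∀ {r : ℝ}, r ∈ Set.Ioc (0 : ℝ) 1 → r ∈ Set.Icc (0 : ℝ) 1 :=
    fun hr => Set.Ioc_subset_Icc_self hr
  have hA1 : A 1 = 0 := by
    refine le_antisymm (flux_nonpos_of_terminal_zero hw hB hv hA hAc hA0 hw1 hB1 hv1 ?_) ?_
    · intro r hr hwr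
      exact sub_nonpos.2 (mul_le_mul_of_nonneg_left
        (Real.rpow_le_rpow (h₁.pos r (hIcc hr)).le (sub_nonpos.1 hwr) hp) hQ)
    · have := flux_nonpos_of_terminal_zero (m := m) (w := -w) (B := -B) (v := -v) (A := -A)
        (g := -g) (fun r hr => (hw r hr).neg.congr_deriv (neg_div _ _).symm)
        (fun r hr => (hB r hr).neg.congr_deriv (mul_neg _ _).symm)
        (fun r hr => (hv r hr).neg.congr_deriv (neg_div _ _).symm)
        (fun r hr => (hA r hr).neg.congr_deriv (mul_neg _ _).symm)
        hAc.neg (by simp [hA0]) (by simp [hw1]) (by simp [hB1]) (by simp [hv1]) ?_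
      · simpa using this
      · intro r hr hwr
        have hle : φ₂ r ≤ φ₁ r := by simpa [w] using hwr
        exact neg_nonpos.2 (sub_nonneg.2 (mul_le_mul_of_nonneg_left
          (Real.rpow_le_rpow (h₂.pos r (hIcc hr)).le hle hp) hQ))
  obtain ⟨L, hL⟩ : ∃ L, ∀ r ∈ Set.Ioc (0 : ℝ) 1, |g r| ≤ L * |w r| := by
    have hcompact : IsCompact (φ₁ '' Set.Icc 0 1 ∪ φ₂ '' Set.Icc 0 1) :=
      (isCompact_Icc.image h₁.contDiff.continuous).union
        (isCompact_Icc.image h₂.contDiff.continuous)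
    obtain ⟨a, ha, hamin⟩ := hcompact.exists_isLeast ⟨φ₁ 0, Or.inl ⟨0, by simp, rfl⟩⟩
    obtain ⟨b, -, hbmax⟩ := hcompact.exists_isGreatest ⟨φ₁ 0, Or.inl ⟨0, by simp, rfl⟩⟩
    have ha0 : 0 < a := by
      rcases ha with ⟨r, hr, rfl⟩ | ⟨r, hr, rfl⟩
      exacts [h₁.pos r hr, h₂.pos r hr]
    have hsmooth : ContDiffOn ℝ 1 (fun t : ℝ => t ^ p) (Set.Icc a b) :=
      contDiffOn_id.rpow_const_of_ne fun t ht => (ha0.trans_le ht.1).ne'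
    obtain ⟨K, hK⟩ := hsmooth.exists_lipschitzOnWith one_ne_zero (convex_Icc a b) isCompact_Icc
    refine ⟨Q * K, fun r hr => ?_⟩
    have m₁ : φ₁ r ∈ φ₁ '' Set.Icc 0 1 ∪ φ₂ '' Set.Icc 0 1 := Or.inl ⟨r, hIcc hr, rfl⟩
    have m₂ : φ₂ r ∈ φ₁ '' Set.Icc 0 1 ∪ φ₂ '' Set.Icc 0 1 := Or.inr ⟨r, hIcc hr, rfl⟩
    have := hK.dist_le_mul _ ⟨hamin m₁, hbmax m₁⟩ _ ⟨hamin m₂, hbmax m₂⟩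
    rw [Real.dist_eq, Real.dist_eq] at this
    simp only [g, ← mul_sub, abs_mul, abs_of_nonneg hQ, mul_assoc]
    exact mul_le_mul_of_nonneg_left this hQ
  have heq : Set.EqOn φ₁ φ₂ (Set.Ioc 0 1) := fun r hr =>
    sub_eq_zero.1 (eq_zero_of_terminal_zero hw hB hv hA hw1 hB1 hv1 hA1 hL hr)
  refine heq.of_subset_closure h₁.contDiff.continuous.continuousOn
    h₂.contDiff.continuous.continuousOn Set.Ioc_subset_Icc_self ?_
  rw [closure_Ioc zero_ne_one]

/-- The uniqueness lemma in the proof of Proposition 3.2 of the paper: a radial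
solution with prescribed `u`, `∂_ν u` and `Δu` on the boundary is unique. -/
theorem stmt_13 (n : ℕ) (hn : 5 ≤ n) (Q : ℝ)
    (hQ : Q = ((n : ℝ) - 4) * ((n : ℝ) - 2) * n * ((n : ℝ) + 2) / 16)
    (c₁ c₂ c₃ : ℝ) (hc₁ : 0 < c₁)
    (u₁ u₂ : EuclideanSpace ℝ (Fin n) → ℝ)
    (h₁ : IsRadialSol n Q c₁ c₂ c₃ u₁) (h₂ : IsRadialSol n Q c₁ c₂ c₃ u₂) :
    ∀ x ∈ closedBall (0 : EuclideanSpace ℝ (Fin n)) 1, u₁ x = u₂ x := by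
  obtain ⟨m, rfl⟩ : ∃ m, n = m + 1 := ⟨n - 1, by omega⟩
  have hn' : (5 : ℝ) ≤ ((m + 1 : ℕ) : ℝ) := by exact_mod_cast hn
  obtain ⟨φ₁, hφ₁, hu₁⟩ := h₁.exists_profile
  obtain ⟨φ₂, hφ₂, hu₂⟩ := h₂.exists_profile
  intro x hx
  rw [hu₁, hu₂]
  refine hφ₁.eqOn (by omega) ?_ ?_ hφ₂ ⟨norm_nonneg x, by simpa using hx⟩
  · rw [hQ]
    have h4 : 0 ≤ ((m + 1 : ℕ) : ℝ) - 4 := by linarith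
    have h2 : 0 ≤ ((m + 1 : ℕ) : ℝ) - 2 := by linarith
    positivity
  · exact div_nonneg (by linarith) (by linarith)
end

section
/- Let n ≥ 5 be an integer and Q = (n−4)(n−2)n(n+2)/16. Consider smooth positive solutions of Δ²u = Q·u^{(n+4)/(n−4)} on the open unit ball B₁ ⊂ ℝⁿ, smooth up to the boundary, with u = 1 and ∂_ν u = −(n−4)/2 on ∂B₁. Then: (i) there are at most two such solutions; (ii) u_s(x) = (2/(1+|x|²))^{(n−4)/2} is the minimal solution, i.e. u_s is a solution and every solution u satisfies u ≥ u_s on B₁. -/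
open Metric Real

/-- `u` is a smooth positive solution of `Δ²u = Q u^{(n+4)/(n-4)}` on the unit
ball with `u = 1` and `∂_ν u = -(n-4)/2` on the unit sphere. -/
def IsSol (n : ℕ) (Q : ℝ) (u : EuclideanSpace ℝ (Fin n) → ℝ) : Prop :=
  ContDiff ℝ (⊤ : ℕ∞) u ∧
  (∀ x ∈ closedBall (0 : EuclideanSpace ℝ (Fin n)) 1, 0 < u x) ∧
  (∀ x ∈ ball (0 : EuclideanSpace ℝ (Fin n)) 1,
    laplacian (laplacian u) x = Q * u x ^ (((n : ℝ) + 4) / ((n : ℝ) - 4))) ∧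
  (∀ x ∈ sphere (0 : EuclideanSpace ℝ (Fin n)) 1, u x = 1) ∧
  (∀ x ∈ sphere (0 : EuclideanSpace ℝ (Fin n)) 1,
    fderiv ℝ u x x = -(((n : ℝ) - 4) / 2))

namespace Biharmonic

open Set Filter Topology MeasureTheory
open scoped ContDiff

variable {n : ℕ}

local notation "𝔼" => EuclideanSpace ℝ (Fin n)

/-- The `i`-th partial derivative. -/
noncomputable def pd (i : Fin n) (f : 𝔼 → ℝ) (x : 𝔼) : ℝ :=
  fderiv ℝ f x (EuclideanSpace.single i 1)

lemma contDiff_pd {f : 𝔼 → ℝ} (hf : ContDiff ℝ ∞ f) (i : Fin n) : ContDiff ℝ ∞ (pd i f) :=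
  (hf.fderiv_right (m := ∞) (by simp)).clm_apply contDiff_const

lemma laplacian_eq_sum_pd {f : 𝔼 → ℝ} (hf : ContDiff ℝ ∞ f) (x : 𝔼) :
    laplacian f x = ∑ i, pd i (pd i f) x := by
  refine Finset.sum_congr rfl fun i _ => ?_
  have hd : DifferentiableAt ℝ (fderiv ℝ f) x :=
    ((hf.fderiv_right (m := ∞) (by simp)).differentiable (by simp)) x
  rw [iteratedFDeriv_two_apply]
  have h := (hd.hasFDerivAt.clm_apply
    (hasFDerivAt_const (EuclideanSpace.single i (1 : ℝ)) x)).fderiv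
  unfold pd
  rw [h]
  simp

lemma contDiff_laplacian {f : 𝔼 → ℝ} (hf : ContDiff ℝ ∞ f) : ContDiff ℝ ∞ (laplacian f) := by
  rw [funext (laplacian_eq_sum_pd hf)]
  exact ContDiff.sum fun i _ => contDiff_pd (contDiff_pd hf i) i

lemma pd_add {f g : 𝔼 → ℝ} (hf : ContDiff ℝ ∞ f) (hg : ContDiff ℝ ∞ g) (i : Fin n) (x : 𝔼) :
    pd i (fun y => f y + g y) x = pd i f x + pd i g x := by
  have h := ((hf.differentiable (by simp) x).hasFDerivAt.add
    (hg.differentiable (by simp) x).hasFDerivAt).fderiv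
  change fderiv ℝ (f + g) x _ = _
  rw [h]; rfl

lemma pd_const_mul {f : 𝔼 → ℝ} (hf : ContDiff ℝ ∞ f) (c : ℝ) (i : Fin n) (x : 𝔼) :
    pd i (fun y => c * f y) x = c * pd i f x := by
  have h := ((hf.differentiable (by simp) x).hasFDerivAt.const_mul c).fderiv
  unfold pd
  rw [h]; rfl

lemma pd_mul {f g : 𝔼 → ℝ} (hf : ContDiff ℝ ∞ f) (hg : ContDiff ℝ ∞ g) (i : Fin n) (x : 𝔼) :
    pd i (fun y => f y * g y) x = f x * pd i g x + g x * pd i f x := by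
  have h := ((hf.differentiable (by simp) x).hasFDerivAt.mul
    (hg.differentiable (by simp) x).hasFDerivAt).fderiv
  change fderiv ℝ (f * g) x _ = _
  rw [h]; rfl

lemma laplacian_add {f g : 𝔼 → ℝ} (hf : ContDiff ℝ ∞ f) (hg : ContDiff ℝ ∞ g) (x : 𝔼) :
    laplacian (fun y => f y + g y) x = laplacian f x + laplacian g x := by
  rw [laplacian_eq_sum_pd (hf.add hg), laplacian_eq_sum_pd hf, laplacian_eq_sum_pd hg,
    ← Finset.sum_add_distrib]
  refine Finset.sum_congr rfl fun i _ => ?_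
  rw [funext (pd_add hf hg i), pd_add (contDiff_pd hf i) (contDiff_pd hg i)]

lemma laplacian_const_mul {f : 𝔼 → ℝ} (hf : ContDiff ℝ ∞ f) (c : ℝ) (x : 𝔼) :
    laplacian (fun y => c * f y) x = c * laplacian f x := by
  rw [laplacian_eq_sum_pd (contDiff_const.mul hf), laplacian_eq_sum_pd hf, Finset.mul_sum]
  refine Finset.sum_congr rfl fun i _ => ?_
  rw [funext (pd_const_mul hf c i), pd_const_mul (contDiff_pd hf i)]

lemma laplacian_sub {f g : 𝔼 → ℝ} (hf : ContDiff ℝ ∞ f) (hg : ContDiff ℝ ∞ g) (x : 𝔼) :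
    laplacian (fun y => f y - g y) x = laplacian f x - laplacian g x := by
  have h := laplacian_add hf (contDiff_const (c := (-1 : ℝ)).mul hg) x
  rw [laplacian_const_mul hg] at h
  simpa [sub_eq_add_neg] using h

lemma laplacian_mul {f g : 𝔼 → ℝ} (hf : ContDiff ℝ ∞ f) (hg : ContDiff ℝ ∞ g) (x : 𝔼) :
    laplacian (fun y => f y * g y) x =
      f x * laplacian g x + 2 * ∑ i, pd i f x * pd i g x + g x * laplacian f x := by
  rw [laplacian_eq_sum_pd (hf.mul hg), laplacian_eq_sum_pd hf, laplacian_eq_sum_pd hg,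
    Finset.mul_sum, Finset.mul_sum, Finset.mul_sum, ← Finset.sum_add_distrib,
    ← Finset.sum_add_distrib]
  refine Finset.sum_congr rfl fun i _ => ?_
  rw [funext (pd_mul hf hg i), pd_add (hf.mul (contDiff_pd hg i)) (hg.mul (contDiff_pd hf i)),
    pd_mul hf (contDiff_pd hg i), pd_mul hg (contDiff_pd hf i)]
  ring

lemma laplacian_congr {f g : 𝔼 → ℝ} {x : 𝔼} (h : f =ᶠ[𝓝 x] g) :
    laplacian f x = laplacian g x := by
  unfold laplacian
  rw [(h.iteratedFDeriv ℝ 2).eq_of_nhds]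

/-- Chain rule for the outer composition with a real function. -/
lemma laplacian_comp {F F' : ℝ → ℝ} {F'' : ℝ} {g : 𝔼 → ℝ} {x : 𝔼} (hg : ContDiff ℝ ∞ g)
    (hF : ∀ᶠ z in 𝓝 (g x), HasDerivAt F (F' z) z) (hF' : HasDerivAt F' F'' (g x)) :
    laplacian (fun y => F (g y)) x =
      F'' * ∑ i, pd i g x ^ 2 + F' (g x) * laplacian g x := by
  have hgd : Differentiable ℝ g := hg.differentiable (by simp)
  have hgd' : DifferentiableAt ℝ (fderiv ℝ g) x :=
    (hg.fderiv_right (m := ∞) (by simp)).differentiable (by simp) x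
  have h1 : fderiv ℝ (fun y => F (g y)) =ᶠ[𝓝 x] fun y => F' (g y) • fderiv ℝ g y := by
    filter_upwards [hgd.continuous.continuousAt.eventually hF] with y hy
    exact (hy.comp_hasFDerivAt y (hgd y).hasFDerivAt).fderiv
  have h2 : HasFDerivAt (fun y => F' (g y) • fderiv ℝ g y)
      (F' (g x) • fderiv ℝ (fderiv ℝ g) x +
        (F'' • fderiv ℝ g x).smulRight (fderiv ℝ g x)) x :=
    (hF'.comp_hasFDerivAt x (hgd x).hasFDerivAt).smul hgd'.hasFDerivAt
  unfold laplacian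
  simp_rw [iteratedFDeriv_two_apply]
  rw [h1.fderiv_eq, h2.fderiv, Finset.mul_sum, Finset.mul_sum, ← Finset.sum_add_distrib]
  refine Finset.sum_congr rfl fun i _ => ?_
  simp [pd]
  ring

lemma pd_comp {F : ℝ → ℝ} {F' : ℝ} {g : 𝔼 → ℝ} {x : 𝔼} (hg : ContDiff ℝ ∞ g)
    (hF : HasDerivAt F F' (g x)) (i : Fin n) :
    pd i (fun y => F (g y)) x = F' * pd i g x := by
  have h := (hF.comp_hasFDerivAt x (hg.differentiable (by simp) x).hasFDerivAt).fderiv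
  change fderiv ℝ (F ∘ g) x _ = _
  rw [h]; rfl

/-- The quadratic function `y ↦ a - 2⟨x, y⟩ + c‖y‖²`. -/
noncomputable def quad (a : ℝ) (x : 𝔼) (c : ℝ) (y : 𝔼) : ℝ :=
  a - 2 * inner ℝ x y + c * ‖y‖ ^ 2

lemma contDiff_quad (a : ℝ) (x : 𝔼) (c : ℝ) : ContDiff ℝ ∞ (quad a x c) :=
  (contDiff_const.sub (contDiff_const.mul (contDiff_const.inner ℝ contDiff_id))).add
    (contDiff_const.mul (contDiff_norm_sq ℝ))

lemma pd_quad (a : ℝ) (x : 𝔼) (c : ℝ) (i : Fin n) (y : 𝔼) :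
    pd i (quad a x c) y = 2 * (c * y i - x i) := by
  have h1 : HasFDerivAt (fun y : 𝔼 => inner ℝ x y) (innerSL ℝ x) y :=
    (innerSL ℝ x).hasFDerivAt
  have h2 : HasFDerivAt (fun y : 𝔼 => ‖y‖ ^ 2) (2 • innerSL ℝ y) y :=
    (hasStrictFDerivAt_norm_sq y).hasFDerivAt
  have h := (((hasFDerivAt_const a y).sub (h1.const_mul 2)).add (h2.const_mul c)).fderiv
  unfold pd
  change fderiv ℝ (quad a x c) y = _ at h
  rw [h]
  simp [EuclideanSpace.inner_single_right]
  ring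

lemma laplacian_quad (a : ℝ) (x : 𝔼) (c : ℝ) (y : 𝔼) :
    laplacian (quad a x c) y = 2 * n * c := by
  rw [laplacian_eq_sum_pd (contDiff_quad a x c)]
  have : ∀ i, pd i (pd i (quad a x c)) y = 2 * c := by
    intro i
    have h0 : HasFDerivAt (fun y : 𝔼 => y i) (EuclideanSpace.proj i : 𝔼 →L[ℝ] ℝ) y :=
      (EuclideanSpace.proj i : 𝔼 →L[ℝ] ℝ).hasFDerivAt
    have h := (((h0.const_mul c).sub_const (x i)).const_mul 2).fderiv
    rw [funext (pd_quad a x c i)]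
    unfold pd
    rw [h]
    simp
  simp [this]
  ring

lemma sum_pd_quad_mul_pd_quad (a b : ℝ) (x z : 𝔼) (c d : ℝ) (y : 𝔼) :
    ∑ i, pd i (quad a x c) y * pd i (quad b z d) y =
      4 * (c * d * ‖y‖ ^ 2 - c * inner ℝ z y - d * inner ℝ x y + inner ℝ x z) := by
  simp only [pd_quad, EuclideanSpace.real_norm_sq_eq, PiLp.inner_apply, RCLike.inner_apply,
    conj_trivial, Finset.mul_sum, ← Finset.sum_sub_distrib, ← Finset.sum_add_distrib]
  exact Finset.sum_congr rfl fun i _ => by ring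

lemma contDiff_rpow_comp {q : 𝔼 → ℝ} (hq : ContDiff ℝ ∞ q) (hpos : ∀ y, 0 < q y) (γ : ℝ) :
    ContDiff ℝ ∞ (fun y => q y ^ γ) :=
  hq.rpow_const_of_ne fun y => (hpos y).ne'

lemma pd_rpow_comp {q : 𝔼 → ℝ} (hq : ContDiff ℝ ∞ q) (hpos : ∀ y, 0 < q y) (γ : ℝ) (i : Fin n)
    (y : 𝔼) : pd i (fun y => q y ^ γ) y = γ * q y ^ (γ - 1) * pd i q y :=
  pd_comp hq (Real.hasDerivAt_rpow_const (Or.inl (hpos y).ne')) i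

lemma laplacian_quad_rpow {a c δ : ℝ} {x : 𝔼} (hpos : ∀ y, 0 < quad a x c y)
    (h : a * c = ‖x‖ ^ 2 + δ * c) (γ : ℝ) (y : 𝔼) :
    laplacian (fun y => quad a x c y ^ γ) y =
      c * γ * (2 * n + 4 * γ - 4) * quad a x c y ^ (γ - 1)
        - 4 * c * γ * (γ - 1) * δ * quad a x c y ^ (γ - 2) := by
  have hq := hpos y
  have h1 : ∀ᶠ z in 𝓝 (quad a x c y), HasDerivAt (fun t : ℝ => t ^ γ) (γ * z ^ (γ - 1)) z := by
    filter_upwards [lt_mem_nhds hq] with z hz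
    exact Real.hasDerivAt_rpow_const (Or.inl hz.ne')
  have h2 : HasDerivAt (fun t : ℝ => γ * t ^ (γ - 1))
      (γ * ((γ - 1) * quad a x c y ^ (γ - 1 - 1))) (quad a x c y) :=
    (Real.hasDerivAt_rpow_const (Or.inl hq.ne')).const_mul γ
  have h3 : ∑ i, pd i (quad a x c) y ^ 2 = 4 * c * (quad a x c y - δ) := by
    have := sum_pd_quad_mul_pd_quad a a x x c c y
    simp only [← pow_two] at this
    rw [this, real_inner_self_eq_norm_sq]
    unfold quad
    linear_combination (-4) * h
  have h4 : quad a x c y ^ (γ - 1) = quad a x c y ^ (γ - 2) * quad a x c y := by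
    rw [show γ - 1 = γ - 2 + 1 by ring, Real.rpow_add_one hq.ne']
  have h5 : γ - 1 - 1 = γ - 2 := by ring
  rw [laplacian_comp (contDiff_quad a x c) h1 h2, h3, laplacian_quad, h5, h4]
  ring

/-- The regularised squared distance to the pole `x`. -/
noncomputable def sq (δ : ℝ) (x : 𝔼) : 𝔼 → ℝ := quad (δ + ‖x‖ ^ 2) x 1

/-- The regularised squared distance to the inverted pole, scaled by `‖x‖²`. -/
noncomputable def sqInv (δ : ℝ) (x : 𝔼) : 𝔼 → ℝ := quad (1 + δ) x (‖x‖ ^ 2)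

lemma sq_eq (δ : ℝ) (x y : 𝔼) : sq δ x y = δ + ‖x - y‖ ^ 2 := by
  unfold sq quad
  rw [norm_sub_sq_real]
  ring

lemma sqInv_eq (δ : ℝ) (x y : 𝔼) :
    sqInv δ x y = sq δ x y + (1 - ‖x‖ ^ 2) * (1 - ‖y‖ ^ 2) := by
  unfold sq sqInv quad
  ring

lemma sq_pos {δ : ℝ} (hδ : 0 < δ) (x y : 𝔼) : 0 < sq δ x y := by
  rw [sq_eq]; positivity

lemma le_sqInv {δ : ℝ} (x y : 𝔼) : δ + (1 - ‖x‖ * ‖y‖) ^ 2 ≤ sqInv δ x y := by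
  have h := real_inner_le_norm x y
  unfold sqInv quad
  nlinarith

lemma sqInv_pos {δ : ℝ} (hδ : 0 < δ) (x y : 𝔼) : 0 < sqInv δ x y := by
  have := le_sqInv (δ := δ) x y
  nlinarith [sq_nonneg (1 - ‖x‖ * ‖y‖)]

lemma contDiff_sq (δ : ℝ) (x : 𝔼) : ContDiff ℝ ∞ (sq δ x) := contDiff_quad _ _ _

lemma contDiff_sqInv (δ : ℝ) (x : 𝔼) : ContDiff ℝ ∞ (sqInv δ x) := contDiff_quad _ _ _

lemma laplacian_sqInv_rpow {δ : ℝ} (hδ : 0 < δ) (x : 𝔼) (γ : ℝ) (y : 𝔼) :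
    laplacian (fun y => sqInv δ x y ^ γ) y =
      ‖x‖ ^ 2 * γ * (2 * n + 4 * γ - 4) * sqInv δ x y ^ (γ - 1)
        - 4 * ‖x‖ ^ 2 * γ * (γ - 1) * δ * sqInv δ x y ^ (γ - 2) :=
  laplacian_quad_rpow (δ := δ) (fun y => sqInv_pos hδ x y) (by ring) γ y

lemma laplacian_sq_mul_sqInv_rpow {δ : ℝ} (hδ : 0 < δ) (x : 𝔼) (γ : ℝ) (y : 𝔼) :
    laplacian (fun y => sq δ x y * sqInv δ x y ^ γ) y =
      (2 * n + 4 * γ) * sqInv δ x y ^ γ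
        - 4 * γ * (δ * (1 + ‖x‖ ^ 2) + (1 - ‖x‖ ^ 2) ^ 2) * sqInv δ x y ^ (γ - 1)
        + ‖x‖ ^ 2 * γ * (2 * n + 4 * γ) * (sq δ x y * sqInv δ x y ^ (γ - 1))
        - 4 * ‖x‖ ^ 2 * γ * (γ - 1) * δ * (sq δ x y * sqInv δ x y ^ (γ - 2)) := by
  have hq := sqInv_pos hδ x y
  have h1 : ∑ i, pd i (sq δ x) y * pd i (fun y => sqInv δ x y ^ γ) y =
      2 * γ * sqInv δ x y ^ (γ - 1) * ((sqInv δ x y - δ) + ‖x‖ ^ 2 * (sq δ x y - δ)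
        - (1 - ‖x‖ ^ 2) ^ 2) := by
    simp_rw [pd_rpow_comp (contDiff_sqInv δ x) (sqInv_pos hδ x)]
    have h := sum_pd_quad_mul_pd_quad (δ + ‖x‖ ^ 2) (1 + δ) x x 1 (‖x‖ ^ 2) y
    have h' : ∑ i, pd i (sq δ x) y * (γ * sqInv δ x y ^ (γ - 1) * pd i (sqInv δ x) y) =
        γ * sqInv δ x y ^ (γ - 1) * ∑ i, pd i (sq δ x) y * pd i (sqInv δ x) y := by
      rw [Finset.mul_sum]
      exact Finset.sum_congr rfl fun i _ => by ring
    rw [h']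
    unfold sq sqInv at *
    rw [h, real_inner_self_eq_norm_sq]
    unfold quad
    ring
  rw [laplacian_mul (contDiff_sq δ x) (contDiff_rpow_comp (contDiff_sqInv δ x) (sqInv_pos hδ x) γ),
    laplacian_sqInv_rpow hδ, h1]
  have h2 : laplacian (sq δ x) y = 2 * n := by unfold sq; rw [laplacian_quad]; ring
  have h3 : sqInv δ x y ^ γ = sqInv δ x y ^ (γ - 1) * sqInv δ x y := by
    rw [← Real.rpow_add_one hq.ne']; congr 1; ring
  rw [h2, h3]
  ring

/-- `Δ²` of the conformally invariant power of a quadratic function. -/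
lemma bilaplacian_quad_rpow {a c δ : ℝ} {x : 𝔼} (hpos : ∀ y, 0 < quad a x c y)
    (h : a * c = ‖x‖ ^ 2 + δ * c) (y : 𝔼) :
    laplacian (laplacian (fun y => quad a x c y ^ (2 - (n : ℝ) / 2))) y =
      ((n : ℝ) - 4) * (n - 2) * n * (n + 2) * c ^ 2 * δ ^ 2 *
        quad a x c y ^ (-((n : ℝ) / 2) - 2) := by
  have hs : ∀ γ : ℝ, ContDiff ℝ ∞ (fun y => quad a x c y ^ γ) :=
    contDiff_rpow_comp (contDiff_quad a x c) hpos
  set k : ℝ := (n : ℝ) / 2 with hk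
  have hn : (n : ℝ) = 2 * k := by rw [hk]; ring
  have h1 : laplacian (fun y => quad a x c y ^ (2 - k)) = fun y =>
      (4 * c * (2 - k)) * quad a x c y ^ (1 - k) +
        (-(4 * c * (2 - k) * (1 - k) * δ)) * quad a x c y ^ (-k) := by
    funext z
    rw [laplacian_quad_rpow hpos h, hn, show 2 - k - 1 = 1 - k by ring,
      show 2 - k - 2 = -k by ring]
    ring
  rw [h1, laplacian_add (contDiff_const.mul (hs _)) (contDiff_const.mul (hs _)),
    laplacian_const_mul (hs _), laplacian_const_mul (hs _), laplacian_quad_rpow hpos h,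
    laplacian_quad_rpow hpos h, hn, show 1 - k - 2 = -k - 1 by ring]
  ring

lemma bilaplacian_sq_mul_sqInv_rpow {δ : ℝ} (hδ : 0 < δ) (x y : 𝔼) :
    laplacian (laplacian (fun y => sq δ x y * sqInv δ x y ^ (1 - (n : ℝ) / 2))) y =
      δ * (4 * n * (1 - (n : ℝ) / 2) * (n + 2) * ‖x‖ ^ 2 *
        (2 * (δ * (1 + ‖x‖ ^ 2) + (1 - ‖x‖ ^ 2) ^ 2) * sqInv δ x y ^ (-((n : ℝ) / 2) - 2)
          - ‖x‖ ^ 2 * ((n : ℝ) / 2 + 2) * δ * (sq δ x y * sqInv δ x y ^ (-((n : ℝ) / 2) - 3)))) := by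
  have hs : ∀ γ : ℝ, ContDiff ℝ ∞ (fun y => sqInv δ x y ^ γ) :=
    contDiff_rpow_comp (contDiff_sqInv δ x) (sqInv_pos hδ x)
  have hp : ∀ γ : ℝ, ContDiff ℝ ∞ (fun y => sq δ x y * sqInv δ x y ^ γ) :=
    fun γ => (contDiff_sq δ x).mul (hs γ)
  set k : ℝ := (n : ℝ) / 2 with hk
  have hn : (n : ℝ) = 2 * k := by rw [hk]; ring
  set D : ℝ := δ * (1 + ‖x‖ ^ 2) + (1 - ‖x‖ ^ 2) ^ 2 with hD
  have h1 : laplacian (fun y => sq δ x y * sqInv δ x y ^ (1 - k)) = fun y =>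
      (4 * sqInv δ x y ^ (1 - k) + (-(4 * (1 - k) * D)) * sqInv δ x y ^ (-k)) +
        ((4 * ‖x‖ ^ 2 * (1 - k)) * (sq δ x y * sqInv δ x y ^ (-k)) +
        (4 * ‖x‖ ^ 2 * (1 - k) * k * δ) * (sq δ x y * sqInv δ x y ^ (-k - 1))) := by
    funext z
    rw [laplacian_sq_mul_sqInv_rpow hδ, hn, show 1 - k - 1 = -k by ring,
      show 1 - k - 2 = -k - 1 by ring]
    ring
  rw [h1, laplacian_add ((contDiff_const.mul (hs _)).add (contDiff_const.mul (hs _)))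
      ((contDiff_const.mul (hp _)).add (contDiff_const.mul (hp _))),
    laplacian_add (contDiff_const.mul (hs _)) (contDiff_const.mul (hs _)),
    laplacian_add (contDiff_const.mul (hp _)) (contDiff_const.mul (hp _)),
    laplacian_const_mul (hs _), laplacian_const_mul (hs _),
    laplacian_const_mul (hp _), laplacian_const_mul (hp _),
    laplacian_sqInv_rpow hδ, laplacian_sqInv_rpow hδ, laplacian_sq_mul_sqInv_rpow hδ,
    laplacian_sq_mul_sqInv_rpow hδ, ← hD, hn, show 1 - k - 2 = -k - 1 by ring,
    show -k - 1 - 1 = -k - 2 by ring, show -k - 1 - 2 = -k - 3 by ring]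
  ring

/-- A regularisation of (a multiple of) Boggio's Green function of `Δ²` on the unit ball with
Dirichlet boundary conditions, which still vanishes to second order on the unit sphere. -/
noncomputable def green (δ : ℝ) (x y : 𝔼) : ℝ :=
  (2 - (n : ℝ) / 2)⁻¹ * sqInv δ x y ^ (2 - (n : ℝ) / 2) +
    (((n : ℝ) / 2 - 1)⁻¹ * (sq δ x y * sqInv δ x y ^ (1 - (n : ℝ) / 2)) +
    (((n : ℝ) / 2 - 1) * ((n : ℝ) / 2 - 2))⁻¹ * sq δ x y ^ (2 - (n : ℝ) / 2))

/-- The error made by `green` compared to an exact Green function, divided by `δ`. -/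
noncomputable def greenError (δ : ℝ) (x y : 𝔼) : ℝ :=
  2 * n * (2 - n) * (n + 2) * ‖x‖ ^ 4 * δ * sqInv δ x y ^ (-((n : ℝ) / 2) - 2) -
    4 * n * (n + 2) * ‖x‖ ^ 2 *
      (2 * (δ * (1 + ‖x‖ ^ 2) + (1 - ‖x‖ ^ 2) ^ 2) * sqInv δ x y ^ (-((n : ℝ) / 2) - 2)
        - ‖x‖ ^ 2 * ((n : ℝ) / 2 + 2) * δ * (sq δ x y * sqInv δ x y ^ (-((n : ℝ) / 2) - 3)))

lemma contDiff_green {δ : ℝ} (hδ : 0 < δ) (x : 𝔼) : ContDiff ℝ ∞ (green δ x) :=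
  (contDiff_const.mul (contDiff_rpow_comp (contDiff_sqInv δ x) (sqInv_pos hδ x) _)).add
    ((contDiff_const.mul ((contDiff_sq δ x).mul
      (contDiff_rpow_comp (contDiff_sqInv δ x) (sqInv_pos hδ x) _))).add
    (contDiff_const.mul (contDiff_rpow_comp (contDiff_sq δ x) (sq_pos hδ x) _)))

lemma bilaplacian_green (hn : 5 ≤ n) {δ : ℝ} (hδ : 0 < δ) (x y : 𝔼) :
    laplacian (laplacian (green δ x)) y =
      4 * n * (n + 2) * (δ ^ 2 * sq δ x y ^ (-((n : ℝ) / 2) - 2)) + δ * greenError δ x y := by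
  have hn' : (5 : ℝ) ≤ n := by exact_mod_cast hn
  have hq : ContDiff ℝ ∞ (fun y => sqInv δ x y ^ (2 - (n : ℝ) / 2)) :=
    contDiff_rpow_comp (contDiff_sqInv δ x) (sqInv_pos hδ x) _
  have hp : ContDiff ℝ ∞ (fun y => sq δ x y * sqInv δ x y ^ (1 - (n : ℝ) / 2)) :=
    (contDiff_sq δ x).mul (contDiff_rpow_comp (contDiff_sqInv δ x) (sqInv_pos hδ x) _)
  have hs : ContDiff ℝ ∞ (fun y => sq δ x y ^ (2 - (n : ℝ) / 2)) :=
    contDiff_rpow_comp (contDiff_sq δ x) (sq_pos hδ x) _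
  have h1 : ∀ (A B C : ℝ) (f g h : 𝔼 → ℝ), ContDiff ℝ ∞ f → ContDiff ℝ ∞ g → ContDiff ℝ ∞ h →
      laplacian (fun y => A * f y + (B * g y + C * h y)) =
        fun y => A * laplacian f y + (B * laplacian g y + C * laplacian h y) := by
    intro A B C f g h hf hg hh
    funext z
    rw [laplacian_add (contDiff_const.mul hf) ((contDiff_const.mul hg).add (contDiff_const.mul hh)),
      laplacian_add (contDiff_const.mul hg) (contDiff_const.mul hh), laplacian_const_mul hf,
      laplacian_const_mul hg, laplacian_const_mul hh]
  have e1 := bilaplacian_quad_rpow (δ := δ) (fun y => sqInv_pos hδ x y) (by ring) y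
  have e2 := bilaplacian_sq_mul_sqInv_rpow hδ x y
  have e3 := bilaplacian_quad_rpow (δ := δ) (fun y => sq_pos hδ x y) (by ring) y
  change laplacian (laplacian (fun y => sqInv δ x y ^ (2 - (n : ℝ) / 2))) y =
    _ * sqInv δ x y ^ (-((n : ℝ) / 2) - 2) at e1
  change laplacian (laplacian (fun y => sq δ x y ^ (2 - (n : ℝ) / 2))) y =
    _ * sq δ x y ^ (-((n : ℝ) / 2) - 2) at e3
  unfold green
  rw [h1 _ _ _ _ _ _ hq hp hs, h1 _ _ _ _ _ _ (contDiff_laplacian hq) (contDiff_laplacian hp)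
    (contDiff_laplacian hs)]
  beta_reduce
  rw [e1, e2, e3]
  unfold greenError
  have n1 : 2 - (n : ℝ) / 2 ≠ 0 := by linarith
  have n2 : (n : ℝ) / 2 - 1 ≠ 0 := by linarith
  have n3 : (n : ℝ) / 2 - 2 ≠ 0 := by linarith
  have i1 : (2 - (n : ℝ) / 2)⁻¹ * (n - 4) = -2 := by
    rw [inv_mul_eq_iff_eq_mul₀ n1]; ring
  have i2 : ((n : ℝ) / 2 - 1)⁻¹ * (1 - (n : ℝ) / 2) = -1 := by
    rw [inv_mul_eq_iff_eq_mul₀ n2]; ring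
  have i3 : (((n : ℝ) / 2 - 1) * ((n : ℝ) / 2 - 2))⁻¹ * ((n - 4) * (n - 2)) = 4 := by
    rw [inv_mul_eq_iff_eq_mul₀ (mul_ne_zero n2 n3)]; ring
  generalize sqInv δ x y ^ (-((n : ℝ) / 2) - 2) = a1
  generalize sqInv δ x y ^ (-((n : ℝ) / 2) - 3) = a2
  generalize sq δ x y ^ (-((n : ℝ) / 2) - 2) = a3
  linear_combination ((n - 2) * n * (n + 2) * (‖x‖ ^ 2) ^ 2 * δ ^ 2 * a1) * i1 +
    (δ * (4 * n * (n + 2) * ‖x‖ ^ 2 *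
      (2 * (δ * (1 + ‖x‖ ^ 2) + (1 - ‖x‖ ^ 2) ^ 2) * a1 -
        ‖x‖ ^ 2 * ((n : ℝ) / 2 + 2) * δ * (sq δ x y * a2)))) * i2 +
    (n * (n + 2) * δ ^ 2 * a3) * i3

lemma green_eq_zero_of_norm_eq_one (hn : 5 ≤ n) {δ : ℝ} (hδ : 0 < δ) (x : 𝔼) {y : 𝔼}
    (hy : ‖y‖ = 1) : green δ x y = 0 := by
  have hn' : (5 : ℝ) ≤ n := by exact_mod_cast hn
  have n1 : 2 - (n : ℝ) / 2 ≠ 0 := by linarith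
  have n2 : (n : ℝ) / 2 - 1 ≠ 0 := by linarith
  have n3 : (n : ℝ) / 2 - 2 ≠ 0 := by linarith
  have h := sqInv_eq δ x y
  rw [hy] at h
  have h1 : sqInv δ x y = sq δ x y := by rw [h]; ring
  have hs := sq_pos hδ x y
  have h2 : sq δ x y * sq δ x y ^ (1 - (n : ℝ) / 2) = sq δ x y ^ (2 - (n : ℝ) / 2) := by
    rw [mul_comm, ← Real.rpow_add_one hs.ne']; congr 1; ring
  unfold green
  rw [h1, h2]
  have : (2 - (n : ℝ) / 2)⁻¹ + (((n : ℝ) / 2 - 1)⁻¹ +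
      (((n : ℝ) / 2 - 1) * ((n : ℝ) / 2 - 2))⁻¹) = 0 := by
    generalize (n : ℝ) / 2 = k at n1 n2 n3
    field_simp
    ring
  linear_combination sq δ x y ^ (2 - (n : ℝ) / 2) * this

lemma pd_green_eq_zero_of_norm_eq_one (hn : 5 ≤ n) {δ : ℝ} (hδ : 0 < δ) (x : 𝔼) {y : 𝔼}
    (hy : ‖y‖ = 1) (i : Fin n) : pd i (green δ x) y = 0 := by
  have hn' : (5 : ℝ) ≤ n := by exact_mod_cast hn
  have n1 : 2 - (n : ℝ) / 2 ≠ 0 := by linarith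
  have n2 : (n : ℝ) / 2 - 1 ≠ 0 := by linarith
  have n3 : (n : ℝ) / 2 - 2 ≠ 0 := by linarith
  have h := sqInv_eq δ x y
  rw [hy] at h
  have h1 : sqInv δ x y = sq δ x y := by rw [h]; ring
  have hs := sq_pos hδ x y
  have hq : ∀ γ : ℝ, ContDiff ℝ ∞ (fun y => sqInv δ x y ^ γ) :=
    contDiff_rpow_comp (contDiff_sqInv δ x) (sqInv_pos hδ x)
  have hp : ContDiff ℝ ∞ (fun y => sq δ x y * sqInv δ x y ^ (1 - (n : ℝ) / 2)) :=
    (contDiff_sq δ x).mul (hq _)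
  have hss : ContDiff ℝ ∞ (fun y => sq δ x y ^ (2 - (n : ℝ) / 2)) :=
    contDiff_rpow_comp (contDiff_sq δ x) (sq_pos hδ x) _
  unfold green
  rw [pd_add (contDiff_const.mul (hq _)) ((contDiff_const.mul hp).add (contDiff_const.mul hss)),
    pd_add (contDiff_const.mul hp) (contDiff_const.mul hss), pd_const_mul (hq _),
    pd_const_mul hp, pd_const_mul hss, pd_mul (contDiff_sq δ x) (hq _),
    pd_rpow_comp (contDiff_sqInv δ x) (sqInv_pos hδ x),
    pd_rpow_comp (contDiff_sqInv δ x) (sqInv_pos hδ x),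
    pd_rpow_comp (contDiff_sq δ x) (sq_pos hδ x), h1,
    show 2 - (n : ℝ) / 2 - 1 = 1 - (n : ℝ) / 2 by ring]
  have h2 : sq δ x y ^ (1 - (n : ℝ) / 2) = sq δ x y * sq δ x y ^ (1 - (n : ℝ) / 2 - 1) := by
    rw [mul_comm, ← Real.rpow_add_one hs.ne']; congr 1; ring
  rw [h2]
  generalize sq δ x y ^ (1 - (n : ℝ) / 2 - 1) = a
  generalize (n : ℝ) / 2 = k at n1 n2 n3
  field_simp
  ring

lemma exists_lipschitzWith_indicator_closedBall {P : 𝔼 → ℝ} (hP : ContDiff ℝ ∞ P)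
    (h0 : ∀ x : 𝔼, ‖x‖ = 1 → P x = 0) :
    ∃ C, LipschitzWith C ((closedBall (0 : 𝔼) 1).indicator P) := by
  obtain ⟨C, hC⟩ := (hP.of_le (m := 1) (by simp)).contDiffOn.exists_lipschitzOnWith
    (s := closedBall (0 : 𝔼) 1) one_ne_zero (convex_closedBall 0 1) (isCompact_closedBall 0 1)
  refine ⟨C, ?_⟩
  have key : ∀ x y : 𝔼, ‖x‖ ≤ 1 → 1 < ‖y‖ → |P x| ≤ C * dist x y := by
    intro x y hx hy
    obtain ⟨z, hz, hz1⟩ : ∃ z ∈ segment ℝ x y, ‖z‖ = 1 :=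
      (convex_segment x y).isPreconnected.intermediate_value (left_mem_segment ℝ x y)
        (right_mem_segment ℝ x y) continuous_norm.continuousOn ⟨hx, hy.le⟩
    have h1 := hC.dist_le_mul x (by simpa using hx) z (by simpa using hz1.le)
    rw [h0 z hz1, Real.dist_eq, sub_zero] at h1
    refine h1.trans (mul_le_mul_of_nonneg_left ?_ C.2)
    have := dist_add_dist_of_mem_segment hz
    linarith [dist_nonneg (x := z) (y := y)]
  refine LipschitzWith.of_dist_le_mul fun x y => ?_
  by_cases hx : ‖x‖ ≤ 1 <;> by_cases hy : ‖y‖ ≤ 1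
  · rw [indicator_of_mem (by simpa using hx), indicator_of_mem (by simpa using hy)]
    exact hC.dist_le_mul x (by simpa using hx) y (by simpa using hy)
  · rw [indicator_of_mem (by simpa using hx), indicator_of_notMem (by simpa using hy),
      Real.dist_eq, sub_zero]
    exact key x y hx (not_le.1 hy)
  · rw [indicator_of_notMem (by simpa using hx), indicator_of_mem (by simpa using hy),
      Real.dist_eq, zero_sub, abs_neg, dist_comm]
    exact key y x hy (not_le.1 hx)
  · rw [indicator_of_notMem (by simpa using hx), indicator_of_notMem (by simpa using hy), dist_self]
    positivity

lemma integral_ball_pd_eq_zero {P : 𝔼 → ℝ} (hP : ContDiff ℝ ∞ P)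
    (h0 : ∀ x : 𝔼, ‖x‖ = 1 → P x = 0) (i : Fin n) : ∫ y in ball (0 : 𝔼) 1, pd i P y = 0 := by
  obtain ⟨C, hC⟩ := exists_lipschitzWith_indicator_closedBall hP h0
  have hcs : HasCompactSupport ((closedBall (0 : 𝔼) 1).indicator P) :=
    HasCompactSupport.intro (isCompact_closedBall 0 1) fun x hx => indicator_of_notMem hx _
  have h := LipschitzWith.integral_lineDeriv_mul_eq (μ := volume)
    (LipschitzWith.const (1 : ℝ)) hC hcs (EuclideanSpace.single i (1 : ℝ))
  simp only [lineDeriv_neg, mul_one] at h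
  have hz : ∀ x : 𝔼,
      lineDeriv ℝ (fun _ : 𝔼 => (1 : ℝ)) x (EuclideanSpace.single i (1 : ℝ)) = 0 := by
    intro x; simp [lineDeriv]
  simp only [hz, zero_mul, integral_zero, integral_neg] at h
  rw [← integral_indicator measurableSet_ball]
  rw [zero_eq_neg] at h
  rw [← h]
  refine integral_congr_ae ?_
  have hsph : ∀ᵐ x : 𝔼, x ∉ sphere (0 : 𝔼) 1 :=
    measure_eq_zero_iff_ae_notMem.1 (Measure.addHaar_sphere_of_ne_zero volume 0 one_ne_zero)
  filter_upwards [hsph] with x hx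
  rcases lt_trichotomy ‖x‖ 1 with hlt | heq | hgt
  · have hb : x ∈ ball (0 : 𝔼) 1 := by simpa using hlt
    rw [indicator_of_mem hb]
    have : (closedBall (0 : 𝔼) 1).indicator P =ᶠ[𝓝 x] P := by
      filter_upwards [isOpen_ball.mem_nhds hb] with y hy
      exact indicator_of_mem (ball_subset_closedBall hy) _
    rw [this.lineDeriv_eq, (hP.differentiable (by simp) x).lineDeriv_eq_fderiv]
    rfl
  · exact absurd (by simpa using heq) hx
  · rw [indicator_of_notMem (by simpa using hgt.le)]
    have : (closedBall (0 : 𝔼) 1).indicator P =ᶠ[𝓝 x] fun _ => 0 := by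
      filter_upwards [isClosed_closedBall.isOpen_compl.mem_nhds
        (show x ∈ (closedBall (0 : 𝔼) 1)ᶜ by simpa using hgt)] with y hy
      exact indicator_of_notMem hy _
    rw [this.lineDeriv_eq]
    simp [lineDeriv]

lemma integrableOn_ball {f : 𝔼 → ℝ} (hf : Continuous f) : IntegrableOn f (ball (0 : 𝔼) 1) :=
  (hf.continuousOn.integrableOn_compact (isCompact_closedBall 0 1)).mono_set
    ball_subset_closedBall

lemma integral_ball_mul_pd {f g : 𝔼 → ℝ} (hf : ContDiff ℝ ∞ f) (hg : ContDiff ℝ ∞ g)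
    (h0 : ∀ x : 𝔼, ‖x‖ = 1 → f x = 0) (i : Fin n) :
    ∫ y in ball (0 : 𝔼) 1, f y * pd i g y = -∫ y in ball (0 : 𝔼) 1, g y * pd i f y := by
  have h := integral_ball_pd_eq_zero (hf.mul hg) (fun x hx => by rw [h0 x hx, zero_mul]) i
  simp_rw [pd_mul hf hg] at h
  rw [integral_add (integrableOn_ball (hf.mul (contDiff_pd hg i)).continuous)
    (integrableOn_ball (hg.mul (contDiff_pd hf i)).continuous)] at h
  linarith

lemma integral_ball_mul_laplacian {f g : 𝔼 → ℝ} (hf : ContDiff ℝ ∞ f) (hg : ContDiff ℝ ∞ g)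
    (h0 : ∀ x : 𝔼, ‖x‖ = 1 → f x = 0) (h1 : ∀ x : 𝔼, ‖x‖ = 1 → ∀ i, pd i f x = 0) :
    ∫ y in ball (0 : 𝔼) 1, f y * laplacian g y = ∫ y in ball (0 : 𝔼) 1, g y * laplacian f y := by
  simp_rw [laplacian_eq_sum_pd hf, laplacian_eq_sum_pd hg, Finset.mul_sum]
  have hi : ∀ i, ContDiff ℝ ∞ (pd i (pd i f)) := fun i => contDiff_pd (contDiff_pd hf i) i
  have hj : ∀ i, ContDiff ℝ ∞ (pd i (pd i g)) := fun i => contDiff_pd (contDiff_pd hg i) i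
  rw [integral_finsetSum _ fun i _ => integrableOn_ball (hf.mul (hj i)).continuous,
    integral_finsetSum _ fun i _ => integrableOn_ball (hg.mul (hi i)).continuous]
  refine Finset.sum_congr rfl fun i _ => ?_
  rw [integral_ball_mul_pd hf (contDiff_pd hg i) h0]
  simp_rw [mul_comm (pd i g _)]
  rw [integral_ball_mul_pd (contDiff_pd hf i) hg fun x hx => h1 x hx i, neg_neg]

/-- Symmetry of `Δ²` under Dirichlet boundary conditions. -/
lemma integral_ball_mul_bilaplacian {f g : 𝔼 → ℝ} (hf : ContDiff ℝ ∞ f) (hg : ContDiff ℝ ∞ g)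
    (hf0 : ∀ x : 𝔼, ‖x‖ = 1 → f x = 0) (hf1 : ∀ x : 𝔼, ‖x‖ = 1 → ∀ i, pd i f x = 0)
    (hg0 : ∀ x : 𝔼, ‖x‖ = 1 → g x = 0) (hg1 : ∀ x : 𝔼, ‖x‖ = 1 → ∀ i, pd i g x = 0) :
    ∫ y in ball (0 : 𝔼) 1, f y * laplacian (laplacian g) y =
      ∫ y in ball (0 : 𝔼) 1, g y * laplacian (laplacian f) y := by
  rw [integral_ball_mul_laplacian hf (contDiff_laplacian hg) hf0 hf1,
    integral_ball_mul_laplacian hg (contDiff_laplacian hf) hg0 hg1]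
  simp_rw [mul_comm (laplacian g _)]

lemma integrable_bubble : Integrable (fun z : 𝔼 => (1 + ‖z‖ ^ 2) ^ (-((n : ℝ) / 2) - 2)) := by
  have h := integrable_rpow_neg_one_add_norm_sq (E := 𝔼) (μ := volume) (r := (n : ℝ) + 4)
    (by simp)
  refine h.congr (Eventually.of_forall fun z => ?_)
  simp only
  congr 1
  ring

lemma integral_bubble_pos : 0 < ∫ z : 𝔼, (1 + ‖z‖ ^ 2) ^ (-((n : ℝ) / 2) - 2) := by
  have hpos : ∀ z : 𝔼, 0 < (1 + ‖z‖ ^ 2) ^ (-((n : ℝ) / 2) - 2) := fun z => by positivity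
  rw [integral_pos_iff_support_of_nonneg (fun z => (hpos z).le) integrable_bubble]
  have : Function.support (fun z : 𝔼 => (1 + ‖z‖ ^ 2) ^ (-((n : ℝ) / 2) - 2)) = univ :=
    eq_univ_of_forall fun z => (hpos z).ne'
  rw [this]
  exact isOpen_univ.measure_pos _ univ_nonempty

lemma tendsto_norm_pow_mul_bubble :
    Tendsto (fun z : 𝔼 => ‖z‖ ^ n * (1 + ‖z‖ ^ 2) ^ (-((n : ℝ) / 2) - 2))
      (Bornology.cobounded 𝔼) (𝓝 0) := by
  have h1 : Tendsto (fun z : 𝔼 => (1 + ‖z‖ ^ 2)⁻¹) (Bornology.cobounded 𝔼) (𝓝 0) := by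
    refine tendsto_inv_atTop_zero.comp ?_
    refine tendsto_atTop_add_const_left _ _ ?_
    exact (tendsto_pow_atTop two_ne_zero).comp tendsto_norm_cobounded_atTop
  refine squeeze_zero (fun z => by positivity) (fun z => ?_) h1
  have hb : (1 : ℝ) ≤ 1 + ‖z‖ ^ 2 := by nlinarith [sq_nonneg ‖z‖]
  have hb0 : (0 : ℝ) < 1 + ‖z‖ ^ 2 := by linarith
  have h2 : ‖z‖ ^ n ≤ (1 + ‖z‖ ^ 2) ^ ((n : ℝ) / 2) := by
    rw [← Real.rpow_natCast]
    calc ‖z‖ ^ (n : ℝ) = (‖z‖ ^ 2) ^ ((n : ℝ) / 2) := by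
          rw [← Real.rpow_natCast ‖z‖ 2, ← Real.rpow_mul (norm_nonneg z)]
          congr 1
          push_cast
          ring
      _ ≤ _ := Real.rpow_le_rpow (by positivity) (by linarith) (by positivity)
  calc ‖z‖ ^ n * (1 + ‖z‖ ^ 2) ^ (-((n : ℝ) / 2) - 2)
      ≤ (1 + ‖z‖ ^ 2) ^ ((n : ℝ) / 2) * (1 + ‖z‖ ^ 2) ^ (-((n : ℝ) / 2) - 2) := by gcongr
    _ = (1 + ‖z‖ ^ 2) ^ (-2 : ℝ) := by rw [← Real.rpow_add hb0]; congr 1; ring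
    _ ≤ (1 + ‖z‖ ^ 2) ^ (-1 : ℝ) := Real.rpow_le_rpow_of_exponent_le hb (by norm_num)
    _ = _ := Real.rpow_neg_one _

/-- The rescaled bubbles concentrate at their centre. -/
lemma tendsto_integral_ball_bubble {w : 𝔼 → ℝ} (hw : Continuous w) {x : 𝔼} (hx : ‖x‖ < 1) :
    Tendsto (fun δ : ℝ => ∫ y in ball (0 : 𝔼) 1, w y * (δ ^ 2 * sq δ x y ^ (-((n : ℝ) / 2) - 2)))
      (𝓝[>] 0) (𝓝 ((∫ z : 𝔼, (1 + ‖z‖ ^ 2) ^ (-((n : ℝ) / 2) - 2)) * w x)) := by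
  set c := ∫ z : 𝔼, (1 + ‖z‖ ^ 2) ^ (-((n : ℝ) / 2) - 2) with hc
  have hcpos : 0 < c := integral_bubble_pos
  set φ : 𝔼 → ℝ := fun z => c⁻¹ * (1 + ‖z‖ ^ 2) ^ (-((n : ℝ) / 2) - 2) with hφ
  have hfr : Module.finrank ℝ 𝔼 = n := by simp
  have hxb : x ∈ ball (0 : 𝔼) 1 := by simpa using hx
  have hpeak := tendsto_integral_comp_smul_smul_of_integrable' (μ := (volume : Measure 𝔼))
    (φ := φ) (fun z => by positivity)
    (by rw [hφ, integral_const_mul, ← hc, inv_mul_cancel₀ hcpos.ne'])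
    (by
      rw [hfr]
      have := tendsto_norm_pow_mul_bubble (n := n) |>.const_mul c⁻¹
      rw [mul_zero] at this
      exact this.congr fun z => by simp only [hφ]; ring)
    (g := (ball (0 : 𝔼) 1).indicator w) (x₀ := x)
    ((integrable_indicator_iff measurableSet_ball).2 (integrableOn_ball hw))
    (by
      refine hw.continuousAt.congr ?_
      filter_upwards [isOpen_ball.mem_nhds hxb] with y hy
      rw [indicator_of_mem hy])
  rw [hfr, indicator_of_mem hxb] at hpeak
  have hC : Tendsto (fun δ : ℝ => (√δ)⁻¹) (𝓝[>] 0) atTop := by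
    refine tendsto_inv_nhdsGT_zero.comp ?_
    refine tendsto_nhdsWithin_iff.2 ⟨?_, ?_⟩
    · have := (Real.continuous_sqrt.tendsto 0).mono_left (nhdsWithin_le_nhds (s := Ioi 0))
      simpa using this
    · filter_upwards [self_mem_nhdsWithin] with δ hδ
      exact Real.sqrt_pos.2 hδ
  have h := (hpeak.comp hC).const_mul c
  refine h.congr' ?_
  filter_upwards [self_mem_nhdsWithin] with δ hδ
  have hδ : 0 < δ := hδ
  simp only [Function.comp]
  rw [← integral_const_mul, ← integral_indicator measurableSet_ball]
  congr 1
  funext y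
  by_cases hy : y ∈ ball (0 : 𝔼) 1
  · rw [indicator_of_mem hy, indicator_of_mem hy]
    have hs := sq_pos hδ x y
    have e1 : 1 + ‖(√δ)⁻¹ • (x - y)‖ ^ 2 = δ⁻¹ * sq δ x y := by
      rw [norm_smul, mul_pow, norm_inv, inv_pow, Real.norm_eq_abs, sq_abs, Real.sq_sqrt hδ.le,
        sq_eq]
      field_simp
    have e2 : (√δ)⁻¹ ^ n = δ ^ (-((n : ℝ) / 2)) := by
      rw [Real.sqrt_eq_rpow, ← Real.rpow_neg hδ.le, ← Real.rpow_natCast, ← Real.rpow_mul hδ.le]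
      congr 1
      ring
    have e3 : δ ^ (-((n : ℝ) / 2)) * (δ⁻¹) ^ (-((n : ℝ) / 2) - 2) = δ ^ 2 := by
      rw [← Real.rpow_neg_one, ← Real.rpow_mul hδ.le, ← Real.rpow_add hδ, ← Real.rpow_natCast]
      congr 1
      push_cast
      ring
    simp only [hφ, smul_eq_mul]
    rw [e1, e2, Real.mul_rpow (by positivity) hs.le, ← e3]
    field_simp
  · simp [indicator_of_notMem hy]

lemma exists_bound_greenError {x : 𝔼} (hx : ‖x‖ < 1) :
    ∃ M, ∀ δ ∈ Icc (0 : ℝ) 1, ∀ y ∈ closedBall (0 : 𝔼) 1, |greenError δ x y| ≤ M := by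
  have hK : IsCompact (Icc (0 : ℝ) 1 ×ˢ closedBall (0 : 𝔼) 1) :=
    isCompact_Icc.prod (isCompact_closedBall 0 1)
  have hs : Continuous fun p : ℝ × 𝔼 => sq p.1 x p.2 := by
    unfold sq quad; fun_prop
  have hq : Continuous fun p : ℝ × 𝔼 => sqInv p.1 x p.2 := by
    unfold sqInv quad; fun_prop
  have hpos : ∀ p ∈ Icc (0 : ℝ) 1 ×ˢ closedBall (0 : 𝔼) 1, sqInv p.1 x p.2 ≠ 0 := by
    rintro ⟨δ, y⟩ ⟨hδ, hy⟩
    have h := le_sqInv (δ := δ) x y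
    have hy' : ‖y‖ ≤ 1 := by simpa using hy
    have : 0 < 1 - ‖x‖ * ‖y‖ := by nlinarith [norm_nonneg x, norm_nonneg y]
    have h2 : 0 < (1 - ‖x‖ * ‖y‖) ^ 2 := by positivity
    have := hδ.1
    simp only at this ⊢
    linarith
  have hr : ∀ γ : ℝ, ContinuousOn (fun p : ℝ × 𝔼 => sqInv p.1 x p.2 ^ γ)
      (Icc (0 : ℝ) 1 ×ˢ closedBall (0 : 𝔼) 1) :=
    fun γ => hq.continuousOn.rpow_const fun p hp => Or.inl (hpos p hp)
  have hc : ContinuousOn (fun p : ℝ × 𝔼 => greenError p.1 x p.2)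
      (Icc (0 : ℝ) 1 ×ˢ closedBall (0 : 𝔼) 1) := by
    unfold greenError
    have h2 := hr (-((n : ℝ) / 2) - 2)
    have h3 := hr (-((n : ℝ) / 2) - 3)
    have hs' := hs.continuousOn (s := Icc (0 : ℝ) 1 ×ˢ closedBall (0 : 𝔼) 1)
    fun_prop
  obtain ⟨M, hM⟩ := hK.exists_bound_of_continuousOn hc
  exact ⟨M, fun δ hδ y hy => hM (δ, y) ⟨hδ, hy⟩⟩

/-- The normalising constant of `green`. -/
noncomputable def greenConst (n : ℕ) : ℝ :=
  4 * n * (n + 2) * ∫ z : EuclideanSpace ℝ (Fin n), (1 + ‖z‖ ^ 2) ^ (-((n : ℝ) / 2) - 2)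

lemma greenConst_pos (hn : 5 ≤ n) : 0 < greenConst n := by
  have := integral_bubble_pos (n := n)
  have hn' : (5 : ℝ) ≤ n := by exact_mod_cast hn
  unfold greenConst
  positivity

lemma continuous_greenError {δ : ℝ} (hδ : 0 < δ) (x : 𝔼) : Continuous (greenError δ x) := by
  have h2 := (contDiff_rpow_comp (contDiff_sqInv δ x) (sqInv_pos hδ x)
    (-((n : ℝ) / 2) - 2)).continuous
  have h3 := (contDiff_rpow_comp (contDiff_sqInv δ x) (sqInv_pos hδ x)
    (-((n : ℝ) / 2) - 3)).continuous
  have hs := (contDiff_sq δ x).continuous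
  unfold greenError
  fun_prop

/-- Green's representation formula for `Δ²` with Dirichlet boundary conditions. -/
lemma tendsto_integral_green (hn : 5 ≤ n) {w : 𝔼 → ℝ} (hw : ContDiff ℝ ∞ w)
    (h0 : ∀ x : 𝔼, ‖x‖ = 1 → w x = 0) (h1 : ∀ x : 𝔼, ‖x‖ = 1 → ∀ i, pd i w x = 0)
    {x : 𝔼} (hx : ‖x‖ < 1) :
    Tendsto (fun δ : ℝ => ∫ y in ball (0 : 𝔼) 1, green δ x y * laplacian (laplacian w) y)
      (𝓝[>] 0) (𝓝 (greenConst n * w x)) := by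
  obtain ⟨M, hM⟩ := exists_bound_greenError hx
  obtain ⟨W, hW⟩ := (isCompact_closedBall (0 : 𝔼) 1).exists_bound_of_continuousOn
    hw.continuous.continuousOn
  have herr : Tendsto (fun δ : ℝ => δ * ∫ y in ball (0 : 𝔼) 1, w y * greenError δ x y)
      (𝓝[>] 0) (𝓝 0) := by
    have hid : Tendsto (fun δ : ℝ => δ) (𝓝[>] 0) (𝓝 0) :=
      tendsto_id.mono_left nhdsWithin_le_nhds
    refine hid.zero_mul_isBoundedUnder_le ?_
    refine ⟨W * M * volume.real (ball (0 : 𝔼) 1), ?_⟩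
    simp only [eventually_map]
    filter_upwards [Ioo_mem_nhdsGT one_pos] with δ hδ
    refine norm_setIntegral_le_of_norm_le_const measure_ball_lt_top fun y hy => ?_
    rw [norm_mul]
    have hy' := ball_subset_closedBall hy
    exact mul_le_mul (hW y hy') (hM δ ⟨hδ.1.le, hδ.2.le⟩ y hy') (norm_nonneg _)
      ((norm_nonneg _).trans (hW y hy'))
  have hmain := ((tendsto_integral_ball_bubble hw.continuous hx).const_mul
    (4 * n * (n + 2) : ℝ)).add herr
  rw [add_zero, ← mul_assoc] at hmain
  refine hmain.congr' ?_
  filter_upwards [self_mem_nhdsWithin] with δ hδ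
  have hδ : 0 < δ := hδ
  rw [integral_ball_mul_bilaplacian (contDiff_green hδ x) hw
    (fun y hy => green_eq_zero_of_norm_eq_one hn hδ x hy)
    (fun y hy => pd_green_eq_zero_of_norm_eq_one hn hδ x hy) h0 h1]
  simp_rw [bilaplacian_green hn hδ x]
  have hs := (contDiff_rpow_comp (contDiff_sq δ x) (sq_pos hδ x) (-((n : ℝ) / 2) - 2)).continuous
  have he := continuous_greenError hδ x
  have hwc := hw.continuous
  rw [← integral_const_mul, ← integral_const_mul, ← integral_add]
  · refine integral_congr_ae (Eventually.of_forall fun y => ?_)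
    simp only
    ring
  · exact integrableOn_ball (by fun_prop)
  · exact integrableOn_ball (by fun_prop)

/-- Boggio's profile: the Green function of the unit ball as a function of the squared distance
`s` and of the product `t` of the boundary weights. -/
noncomputable def boggio (n : ℕ) (s t : ℝ) : ℝ :=
  ∫ τ in (0 : ℝ)..t, τ * (s + τ) ^ (-((n : ℝ) / 2))

lemma intervalIntegrable_boggio {s a b : ℝ} (hs : 0 < s) (ha : 0 ≤ a) (hb : 0 ≤ b) :
    IntervalIntegrable (fun τ => τ * (s + τ) ^ (-((n : ℝ) / 2))) volume a b := by
  refine ContinuousOn.intervalIntegrable ?_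
  refine continuousOn_id.mul ((continuousOn_const.add continuousOn_id).rpow_const ?_)
  intro τ hτ
  have : 0 ≤ τ := le_trans (le_min ha hb) hτ.1
  exact Or.inl (by change s + τ ≠ 0; linarith)

lemma boggio_sub {s a b : ℝ} (hs : 0 < s) (ha : 0 ≤ a) (hb : 0 ≤ b) :
    boggio n s b - boggio n s a = ∫ τ in a..b, τ * (s + τ) ^ (-((n : ℝ) / 2)) :=
  intervalIntegral.integral_interval_sub_left (intervalIntegrable_boggio hs le_rfl hb)
    (intervalIntegrable_boggio hs le_rfl ha)

lemma boggio_mono {s a b : ℝ} (hs : 0 < s) (ha : 0 ≤ a) (hab : a ≤ b) :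
    boggio n s a ≤ boggio n s b := by
  rw [← sub_nonneg, boggio_sub hs ha (ha.trans hab)]
  refine intervalIntegral.integral_nonneg hab fun τ hτ => ?_
  have : 0 ≤ τ := ha.trans hτ.1
  positivity

lemma boggio_sub_antitone {s₁ s₂ a b : ℝ} (hs : 0 < s₁) (hs' : s₁ ≤ s₂) (ha : 0 ≤ a)
    (hab : a ≤ b) : boggio n s₂ b - boggio n s₂ a ≤ boggio n s₁ b - boggio n s₁ a := by
  rw [boggio_sub hs ha (ha.trans hab), boggio_sub (hs.trans_le hs') ha (ha.trans hab)]
  refine intervalIntegral.integral_mono_on hab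
    (intervalIntegrable_boggio (hs.trans_le hs') ha (ha.trans hab))
    (intervalIntegrable_boggio hs ha (ha.trans hab)) fun τ hτ => ?_
  have h0 : 0 ≤ τ := ha.trans hτ.1
  refine mul_le_mul_of_nonneg_left ?_ h0
  exact Real.rpow_le_rpow_of_nonpos (by linarith) (by linarith)
    (neg_nonpos.2 (by positivity))

lemma boggio_zero (s : ℝ) : boggio n s 0 = 0 := intervalIntegral.integral_same

lemma boggio_antitone {s₁ s₂ t : ℝ} (hs : 0 < s₁) (hs' : s₁ ≤ s₂) (ht : 0 ≤ t) :
    boggio n s₂ t ≤ boggio n s₁ t := by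
  simpa [boggio_zero] using boggio_sub_antitone (n := n) hs hs' le_rfl ht

lemma green_eq_boggio (hn : 5 ≤ n) {δ : ℝ} (hδ : 0 < δ) {x y : 𝔼} (hx : ‖x‖ < 1) (hy : ‖y‖ < 1) :
    green δ x y = boggio n (δ + ‖x - y‖ ^ 2) ((1 - ‖x‖ ^ 2) * (1 - ‖y‖ ^ 2)) := by
  have hn' : (5 : ℝ) ≤ n := by exact_mod_cast hn
  have hs := sq_pos hδ x y
  have ht : 0 ≤ (1 - ‖x‖ ^ 2) * (1 - ‖y‖ ^ 2) := by
    have := norm_nonneg x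
    have := norm_nonneg y
    apply mul_nonneg <;> nlinarith
  unfold green boggio
  rw [sqInv_eq, ← sq_eq]
  set s := sq δ x y
  set t := (1 - ‖x‖ ^ 2) * (1 - ‖y‖ ^ 2)
  set k : ℝ := (n : ℝ) / 2 with hk
  have hk' : (5 / 2 : ℝ) ≤ k := by rw [hk]; linarith
  have n1 : 2 - k ≠ 0 := by linarith
  have n2 : k - 1 ≠ 0 := by linarith
  have n3 : k - 2 ≠ 0 := by linarith
  have hd : ∀ τ ∈ uIcc 0 t, HasDerivAt
      (fun τ => (2 - k)⁻¹ * (s + τ) ^ (2 - k) + (k - 1)⁻¹ * (s * (s + τ) ^ (1 - k)))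
      (τ * (s + τ) ^ (-k)) τ := by
    intro τ hτ
    rw [uIcc_of_le ht] at hτ
    have hp : 0 < s + τ := by linarith [hτ.1]
    have h0 : HasDerivAt (fun τ => s + τ) 1 τ := (hasDerivAt_id τ).const_add s
    have h1 := ((h0.rpow_const (p := 2 - k) (Or.inl hp.ne')).const_mul (2 - k)⁻¹).add
      (((h0.rpow_const (p := 1 - k) (Or.inl hp.ne')).const_mul s).const_mul (k - 1)⁻¹)
    refine h1.congr_deriv ?_
    rw [show 2 - k - 1 = 1 + -k by ring, show 1 - k - 1 = -k by ring, Real.rpow_add hp,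
      Real.rpow_one]
    field_simp
    ring
  rw [intervalIntegral.integral_eq_sub_of_hasDerivAt hd
    (intervalIntegrable_boggio hs le_rfl ht), add_zero]
  have e : s ^ (2 - k) = s * s ^ (1 - k) := by
    rw [show 2 - k = 1 + (1 - k) by ring, Real.rpow_add hs, Real.rpow_one]
  rw [e]
  have e2 : ((k - 1) * (k - 2))⁻¹ = -((2 - k)⁻¹ + (k - 1)⁻¹) := by
    field_simp
    ring
  rw [e2]
  ring

/-- Positivity preserving property of the Dirichlet bilaplacian on the unit ball. -/
theorem nonneg_of_bilaplacian_nonneg (hn : 5 ≤ n) {w : 𝔼 → ℝ} (hw : ContDiff ℝ ∞ w)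
    (h0 : ∀ x, ‖x‖ = 1 → w x = 0) (h1 : ∀ x, ‖x‖ = 1 → ∀ i, pd i w x = 0)
    (h : ∀ x, ‖x‖ < 1 → 0 ≤ laplacian (laplacian w) x) {x : 𝔼} (hx : ‖x‖ < 1) : 0 ≤ w x := by
  have ht := tendsto_integral_green hn hw h0 h1 hx
  refine nonneg_of_mul_nonneg_right (a := greenConst n) ?_ (greenConst_pos hn)
  refine ge_of_tendsto ht ?_
  filter_upwards [self_mem_nhdsWithin] with δ hδ
  refine setIntegral_nonneg measurableSet_ball fun y hy => ?_
  have hy' : ‖y‖ < 1 := by simpa using hy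
  refine mul_nonneg ?_ (h y hy')
  rw [green_eq_boggio hn hδ hx hy', ← boggio_zero (n := n)]
  have hδ' : 0 < δ := hδ
  refine boggio_mono (by positivity) le_rfl ?_
  have := norm_nonneg x
  have := norm_nonneg y
  apply mul_nonneg <;> nlinarith

/-- Reflection across the hyperplane `⟪e, x⟫ = lam`. -/
noncomputable def mirror (e : 𝔼) (lam : ℝ) (x : 𝔼) : 𝔼 := x + (2 * (lam - inner ℝ e x)) • e

lemma inner_mirror {e : 𝔼} (he : ‖e‖ = 1) (lam : ℝ) (x : 𝔼) :
    inner ℝ e (mirror e lam x) = 2 * lam - inner ℝ e x := by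
  unfold mirror
  rw [inner_add_right, inner_smul_right, real_inner_self_eq_norm_sq, he]
  ring

lemma mirror_mirror {e : 𝔼} (he : ‖e‖ = 1) (lam : ℝ) (x : 𝔼) :
    mirror e lam (mirror e lam x) = x := by
  have h : mirror e lam (mirror e lam x) =
      mirror e lam x + (2 * (lam - inner ℝ e (mirror e lam x))) • e := rfl
  rw [h, inner_mirror he, mirror, add_assoc, ← add_smul,
    show 2 * (lam - inner ℝ e x) + 2 * (lam - (2 * lam - inner ℝ e x)) = 0 by ring, zero_smul,
    add_zero]

lemma norm_mirror_sq {e : 𝔼} (he : ‖e‖ = 1) (lam : ℝ) (x : 𝔼) :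
    ‖mirror e lam x‖ ^ 2 = ‖x‖ ^ 2 - 4 * lam * (inner ℝ e x - lam) := by
  unfold mirror
  rw [norm_add_sq_real, inner_smul_right, norm_smul, he, real_inner_comm, mul_one,
    Real.norm_eq_abs, sq_abs]
  ring

lemma norm_mirror_sub_mirror {e : 𝔼} (he : ‖e‖ = 1) (lam : ℝ) (x y : 𝔼) :
    ‖mirror e lam x - mirror e lam y‖ ^ 2 = ‖x - y‖ ^ 2 := by
  have h : mirror e lam x - mirror e lam y = (x - y) + (-(2 * inner ℝ e (x - y))) • e := by
    unfold mirror
    rw [inner_sub_right]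
    module
  rw [h, norm_add_sq_real, inner_smul_right, norm_smul, he, real_inner_comm, mul_one,
    Real.norm_eq_abs, sq_abs]
  ring

lemma norm_sub_mirror {e : 𝔼} (he : ‖e‖ = 1) (lam : ℝ) (x y : 𝔼) :
    ‖x - mirror e lam y‖ ^ 2 =
      ‖x - y‖ ^ 2 + 4 * (inner ℝ e x - lam) * (inner ℝ e y - lam) := by
  have h : x - mirror e lam y = (x - y) + (2 * (inner ℝ e y - lam)) • e := by
    unfold mirror
    module
  rw [h, norm_add_sq_real, inner_smul_right, norm_smul, he, real_inner_comm e (x - y), mul_one,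
    Real.norm_eq_abs, sq_abs, inner_sub_right]
  ring

lemma norm_mirror_sub {e : 𝔼} (he : ‖e‖ = 1) (lam : ℝ) (x y : 𝔼) :
    ‖mirror e lam x - y‖ ^ 2 =
      ‖x - y‖ ^ 2 + 4 * (inner ℝ e x - lam) * (inner ℝ e y - lam) := by
  rw [norm_sub_rev, norm_sub_mirror he, norm_sub_rev]
  ring

lemma continuous_mirror (e : 𝔼) (lam : ℝ) : Continuous (mirror e lam) := by
  unfold mirror
  fun_prop

lemma measurePreserving_mirror {e : 𝔼} (he : ‖e‖ = 1) (lam : ℝ) :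
    MeasurePreserving (mirror e lam) (volume : Measure 𝔼) volume := by
  have h := (measurePreserving_add_right (volume : Measure 𝔼) ((2 * lam) • e)).comp
    ((ℝ ∙ e)ᗮ.reflection.measurePreserving)
  have hfun : mirror e lam = (fun x => x + (2 * lam) • e) ∘ (ℝ ∙ e)ᗮ.reflection := by
    funext x
    rw [Function.comp_apply, Submodule.reflection_orthogonal_apply,
      Submodule.reflection_singleton_apply, he]
    unfold mirror
    simp only [RCLike.ofReal_real_eq_id, id_eq]
    module
  rw [hfun]
  exact h

lemma integral_nonneg_of_add_mirror_nonneg {e : 𝔼} (he : ‖e‖ = 1) (lam : ℝ) {g : 𝔼 → ℝ}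
    (hg : Integrable g)
    (h : ∀ y, lam ≤ inner ℝ e y → 0 ≤ g y + g (mirror e lam y)) : 0 ≤ ∫ y, g y := by
  have hm := measurePreserving_mirror he lam
  have hemb : MeasurableEmbedding (mirror e lam) :=
    (MeasurableEquiv.mk ⟨mirror e lam, mirror e lam, mirror_mirror he lam, mirror_mirror he lam⟩
      (continuous_mirror e lam).measurable (continuous_mirror e lam).measurable).measurableEmbedding
  have h1 : ∫ y, g (mirror e lam y) = ∫ y, g y := hm.integral_comp hemb g
  have h2 : Integrable (fun y => g (mirror e lam y)) := (hm.integrable_comp_emb hemb).2 hg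
  have h3 : 0 ≤ ∫ y, (g y + g (mirror e lam y)) := by
    refine integral_nonneg fun y => ?_
    rcases le_or_gt lam (inner ℝ e y) with hy | hy
    · exact h y hy
    · have := h (mirror e lam y) (by rw [inner_mirror he]; linarith)
      rw [mirror_mirror he] at this
      change 0 ≤ g y + _
      linarith
  rw [integral_add hg h2, h1] at h3
  linarith

lemma norm_mirror_lt_one {e : 𝔼} (he : ‖e‖ = 1) {lam : ℝ} (hl : 0 ≤ lam) {x : 𝔼} (hx : ‖x‖ < 1)
    (hx' : lam ≤ inner ℝ e x) : ‖mirror e lam x‖ < 1 := by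
  have := norm_mirror_sq he lam x
  have h2 : 0 ≤ lam * (inner ℝ e x - lam) := mul_nonneg hl (by linarith)
  have := norm_nonneg x
  have : ‖mirror e lam x‖ ^ 2 < 1 := by nlinarith
  nlinarith [norm_nonneg (mirror e lam x)]

/-- Reflection principle: if `Δ²w ≥ 0` increases under reflection, so does `w`. -/
theorem le_mirror_of_bilaplacian_le_mirror (hn : 5 ≤ n) {w : 𝔼 → ℝ} (hw : ContDiff ℝ ∞ w)
    (h0 : ∀ x, ‖x‖ = 1 → w x = 0) (h1 : ∀ x, ‖x‖ = 1 → ∀ i, pd i w x = 0)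
    {e : 𝔼} (he : ‖e‖ = 1) {lam : ℝ} (hl : 0 ≤ lam)
    (h : ∀ x, ‖x‖ < 1 → 0 ≤ laplacian (laplacian w) x)
    (h' : ∀ x, ‖x‖ < 1 → lam ≤ inner ℝ e x →
      laplacian (laplacian w) x ≤ laplacian (laplacian w) (mirror e lam x))
    {x : 𝔼} (hx : ‖x‖ < 1) (hx' : lam ≤ inner ℝ e x) : w x ≤ w (mirror e lam x) := by
  set f := laplacian (laplacian w) with hf
  have hfc : Continuous f := (contDiff_laplacian (contDiff_laplacian hw)).continuous
  have hσx := norm_mirror_lt_one he hl hx hx'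
  have ht := (tendsto_integral_green hn hw h0 h1 hσx).sub (tendsto_integral_green hn hw h0 h1 hx)
  rw [← mul_sub] at ht
  rw [← sub_nonneg]
  refine nonneg_of_mul_nonneg_right (a := greenConst n) ?_ (greenConst_pos hn)
  refine ge_of_tendsto ht ?_
  filter_upwards [self_mem_nhdsWithin] with δ hδ
  replace hδ : 0 < δ := hδ
  have hc1 : Continuous fun y => green δ (mirror e lam x) y * f y :=
    (contDiff_green hδ _).continuous.mul hfc
  have hc2 : Continuous fun y => green δ x y * f y := (contDiff_green hδ _).continuous.mul hfc
  rw [← hf, ← integral_sub (integrableOn_ball hc1) (integrableOn_ball hc2),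
    ← integral_indicator measurableSet_ball]
  refine integral_nonneg_of_add_mirror_nonneg he lam
    ((integrableOn_ball (hc1.sub hc2)).integrable_indicator measurableSet_ball) fun y hy => ?_
  have hpos : ∀ z : 𝔼, ‖z‖ < 1 → 0 < 1 - ‖z‖ ^ 2 := fun z hz => by
    nlinarith [norm_nonneg z]
  have hmem : ∀ z : 𝔼, z ∈ ball (0 : 𝔼) 1 ↔ ‖z‖ < 1 := by simp
  set a := 1 - ‖x‖ ^ 2 with ha
  set A := 1 - ‖mirror e lam x‖ ^ 2 with hA
  set B := 1 - ‖mirror e lam y‖ ^ 2 with hB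
  set b := 1 - ‖y‖ ^ 2 with hb
  have haA : a ≤ A := by
    rw [ha, hA, norm_mirror_sq he]
    nlinarith
  have hbB : b ≤ B := by
    rw [hb, hB, norm_mirror_sq he]
    nlinarith
  have ha0 : 0 < a := hpos x hx
  have hs1 : 0 < δ + ‖x - y‖ ^ 2 := by positivity
  have hs12 : δ + ‖x - y‖ ^ 2 ≤
      δ + (‖x - y‖ ^ 2 + 4 * (inner ℝ e x - lam) * (inner ℝ e y - lam)) := by
    have : 0 ≤ (inner ℝ e x - lam) * (inner ℝ e y - lam) :=
      mul_nonneg (by linarith) (by linarith)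
    linarith
  have key : ‖mirror e lam y‖ < 1 →
      0 ≤ green δ (mirror e lam x) (mirror e lam y) - green δ x (mirror e lam y) := by
    intro hσy
    have hB0 : 0 < B := hpos _ hσy
    rw [green_eq_boggio hn hδ hσx hσy, green_eq_boggio hn hδ hx hσy, ← ha, ← hA, ← hB,
      norm_mirror_sub_mirror he, norm_sub_mirror he]
    have := boggio_antitone (n := n) hs1 hs12 (mul_pos ha0 hB0).le
    have := boggio_mono (n := n) hs1 (mul_pos ha0 hB0).le (mul_le_mul_of_nonneg_right haA hB0.le)
    linarith
  by_cases hyB : ‖y‖ < 1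
  · have hσy := norm_mirror_lt_one he hl hyB hy
    have hk := key hσy
    rw [indicator_of_mem ((hmem _).2 hyB), indicator_of_mem ((hmem _).2 hσy)]
    have hb0 : 0 < b := hpos y hyB
    have hsum : 0 ≤ (green δ (mirror e lam x) y - green δ x y) +
        (green δ (mirror e lam x) (mirror e lam y) - green δ x (mirror e lam y)) := by
      rw [green_eq_boggio hn hδ hσx hyB, green_eq_boggio hn hδ hx hyB,
        green_eq_boggio hn hδ hσx hσy, green_eq_boggio hn hδ hx hσy, ← ha, ← hA, ← hB, ← hb,
        norm_mirror_sub_mirror he, norm_sub_mirror he, norm_mirror_sub he]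
      have hab : a * b ≤ A * B := mul_le_mul haA hbB hb0.le (ha0.le.trans haA)
      have m1 := boggio_sub_antitone (n := n) hs1 hs12 (mul_pos ha0 hb0).le hab
      have m2 := boggio_mono (n := n) (hs1.trans_le hs12) (mul_pos ha0 hb0).le
        (mul_le_mul_of_nonneg_right haA hb0.le)
      have m3 := boggio_mono (n := n) (hs1.trans_le hs12) (mul_pos ha0 (hb0.trans_le hbB)).le
        (mul_le_mul_of_nonneg_right haA (hb0.trans_le hbB).le)
      linarith
    have hf1 := h y hyB
    have hf2 := h' y hyB hy
    have p1 := mul_nonneg hk (sub_nonneg.2 hf2)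
    have p2 := mul_nonneg hsum hf1
    linarith
  · rw [indicator_of_notMem (fun hh => hyB ((hmem _).1 hh)), zero_add]
    by_cases hσy : ‖mirror e lam y‖ < 1
    · rw [indicator_of_mem ((hmem _).2 hσy)]
      have := mul_nonneg (key hσy) (h _ hσy)
      linarith
    · rw [indicator_of_notMem (fun hh => hσy ((hmem _).1 hh))]

/-- A function that is constant on the unit sphere has radial gradient there. -/
lemma fderiv_eq_mul_inner {u : 𝔼 → ℝ} (hu : ContDiff ℝ ∞ u) {a b : ℝ}
    (ha : ∀ x, ‖x‖ = 1 → u x = a) (hb : ∀ x, ‖x‖ = 1 → fderiv ℝ u x x = b) {x : 𝔼}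
    (hx : ‖x‖ = 1) (v : 𝔼) : fderiv ℝ u x v = b * inner ℝ x v := by
  have hperp : ∀ z : 𝔼, inner ℝ x z = 0 → fderiv ℝ u x z = 0 := by
    intro z hz
    have hpos : ∀ t : ℝ, 0 < 1 + t ^ 2 * ‖z‖ ^ 2 := fun t => by positivity
    set s : ℝ → ℝ := fun t => (√(1 + t ^ 2 * ‖z‖ ^ 2))⁻¹ with hs
    have hs0 : s 0 = 1 := by simp [hs]
    have hnorm : ∀ t, ‖s t • (x + t • z)‖ = 1 := by
      intro t
      have h1 : ‖x + t • z‖ ^ 2 = 1 + t ^ 2 * ‖z‖ ^ 2 := by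
        rw [norm_add_sq_real, inner_smul_right, hz, hx, norm_smul, Real.norm_eq_abs, mul_pow,
          sq_abs]
        ring
      have h2 : ‖x + t • z‖ = √(1 + t ^ 2 * ‖z‖ ^ 2) := by
        rw [← h1, Real.sqrt_sq (norm_nonneg _)]
      have h3 := Real.sqrt_pos.2 (hpos t)
      rw [norm_smul, h2, Real.norm_eq_abs, abs_of_pos (inv_pos.2 h3), inv_mul_cancel₀ h3.ne']
    have hsd : HasDerivAt s 0 0 := by
      have h1 : HasDerivAt (fun t : ℝ => 1 + t ^ 2 * ‖z‖ ^ 2) 0 0 := by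
        have := (((hasDerivAt_id (0 : ℝ)).pow 2).mul_const (‖z‖ ^ 2)).const_add 1
        simpa using this
      have h2 := (h1.sqrt (hpos 0).ne').inv (Real.sqrt_pos.2 (hpos 0)).ne'
      refine (h2.congr_deriv (by simp)).congr_of_eventuallyEq (Eventually.of_forall fun t => ?_)
      simp [hs]
    have hγ : HasDerivAt (fun t : ℝ => s t • (x + t • z)) z 0 := by
      have h1 : HasDerivAt (fun t : ℝ => x + t • z) z 0 := by
        simpa using ((hasDerivAt_id (0 : ℝ)).smul_const z).const_add x
      refine (hsd.smul h1).congr_deriv ?_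
      simp [hs0]
    have hux : HasFDerivAt u (fderiv ℝ u x) (s 0 • (x + (0 : ℝ) • z)) := by
      rw [hs0, zero_smul, add_zero, one_smul]
      exact (hu.differentiable (by simp) x).hasFDerivAt
    have h1 := hux.comp_hasDerivAt (0 : ℝ) hγ
    have h2 : (u ∘ fun t : ℝ => s t • (x + t • z)) = fun _ => a := by
      funext t
      exact ha _ (hnorm t)
    rw [h2] at h1
    exact h1.unique (hasDerivAt_const _ _)
  have h := hperp (v - inner ℝ x v • x) (by
    rw [inner_sub_right, inner_smul_right, real_inner_self_eq_norm_sq, hx]; ring)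
  rw [map_sub, map_smul, hb x hx, sub_eq_zero, smul_eq_mul] at h
  rw [h, mul_comm]

section dirichlet

variable {a b : ℝ}

lemma bilaplacian_sub_quad {u : 𝔼 → ℝ} (hu : ContDiff ℝ ∞ u) (x : 𝔼) :
    laplacian (laplacian fun y => u y - quad (a - b / 2) 0 (b / 2) y) x =
      laplacian (laplacian u) x := by
  have h1 : laplacian (fun y => u y - quad (a - b / 2) 0 (b / 2) y) =
      fun y => laplacian u y - laplacian (quad (a - b / 2) 0 (b / 2)) y :=
    funext fun y => laplacian_sub hu (contDiff_quad _ _ _) y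
  have h2 : laplacian (quad (a - b / 2) (0 : 𝔼) (b / 2)) = quad (2 * n * (b / 2)) 0 0 := by
    funext y
    rw [laplacian_quad]
    simp [quad]
  rw [h1, laplacian_sub (contDiff_laplacian hu) (contDiff_laplacian (contDiff_quad _ _ _)), h2,
    laplacian_quad]
  ring

lemma sub_quad_eq_zero {u : 𝔼 → ℝ} (ha : ∀ x, ‖x‖ = 1 → u x = a) (x : 𝔼) (hx : ‖x‖ = 1) :
    u x - quad (a - b / 2) 0 (b / 2) x = 0 := by
  rw [ha x hx, quad, hx, inner_zero_left]
  ring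

lemma pd_sub_quad_eq_zero {u : 𝔼 → ℝ} (hu : ContDiff ℝ ∞ u)
    (ha : ∀ x, ‖x‖ = 1 → u x = a) (hb : ∀ x, ‖x‖ = 1 → fderiv ℝ u x x = b) (x : 𝔼)
    (hx : ‖x‖ = 1) (i : Fin n) : pd i (fun y => u y - quad (a - b / 2) 0 (b / 2) y) x = 0 := by
  have h1 : pd i (quad (a - b / 2) (0 : 𝔼) (b / 2)) x = b * x i := by
    rw [pd_quad]
    simp
    ring
  have h2 : pd i u x = b * x i := by
    have := fderiv_eq_mul_inner hu ha hb hx (EuclideanSpace.single i 1)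
    rw [real_inner_comm, EuclideanSpace.inner_single_left] at this
    simpa [pd] using this
  unfold pd at h1 h2 ⊢
  rw [fderiv_fun_sub (hu.differentiable (by simp) x)
    ((contDiff_quad _ _ _).differentiable (by simp) x), _root_.sub_apply, h1, h2,
    sub_self]

/-- Comparison principle with constant Dirichlet data. -/
theorem le_of_bilaplacian_nonneg (hn : 5 ≤ n) {u : 𝔼 → ℝ} (hu : ContDiff ℝ ∞ u)
    (ha : ∀ x, ‖x‖ = 1 → u x = a) (hb : ∀ x, ‖x‖ = 1 → fderiv ℝ u x x = b)
    (h : ∀ x, ‖x‖ < 1 → 0 ≤ laplacian (laplacian u) x) {x : 𝔼} (hx : ‖x‖ < 1) :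
    a - b / 2 * (1 - ‖x‖ ^ 2) ≤ u x := by
  have := nonneg_of_bilaplacian_nonneg hn (hu.sub (contDiff_quad (a - b / 2) 0 (b / 2)))
    (sub_quad_eq_zero ha) (pd_sub_quad_eq_zero hu ha hb)
    (fun y hy => by rw [bilaplacian_sub_quad hu]; exact h y hy) hx
  rw [quad, inner_zero_left] at this
  linarith

lemma mirror_lower_bound (hn : 5 ≤ n) {u : 𝔼 → ℝ} (hu : ContDiff ℝ ∞ u)
    (ha : ∀ x, ‖x‖ = 1 → u x = a) (hb : ∀ x, ‖x‖ = 1 → fderiv ℝ u x x = b)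
    {e : 𝔼} (he : ‖e‖ = 1) {lam : ℝ} (hl : 0 ≤ lam)
    (h : ∀ x, ‖x‖ < 1 → 0 ≤ laplacian (laplacian u) x)
    (h' : ∀ x, ‖x‖ < 1 → lam ≤ inner ℝ e x →
      laplacian (laplacian u) x ≤ laplacian (laplacian u) (mirror e lam x))
    {x : 𝔼} (hx : ‖x‖ < 1) (hx' : lam ≤ inner ℝ e x) :
    u x + -2 * b * lam * (inner ℝ e x - lam) ≤ u (mirror e lam x) := by
  have := le_mirror_of_bilaplacian_le_mirror hn (hu.sub (contDiff_quad (a - b / 2) 0 (b / 2)))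
    (sub_quad_eq_zero ha) (pd_sub_quad_eq_zero hu ha hb) he hl
    (fun y hy => by rw [bilaplacian_sub_quad hu]; exact h y hy)
    (fun y hy hy' => by
      rw [bilaplacian_sub_quad hu, bilaplacian_sub_quad hu]; exact h' y hy hy') hx hx'
  rw [quad, quad, inner_zero_left, inner_zero_left, norm_mirror_sq he] at this
  linarith

end dirichlet

/-- Downward continuous induction on the real line. -/
lemma of_forall_gt_of_eventually {P : ℝ → Prop} {l₀ M : ℝ} (hM : ∀ l, M < l → P l)
    (h : ∀ L, l₀ ≤ L → (∀ l, L < l → P l) → ∀ᶠ l in 𝓝 L, P l) : P l₀ := by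
  by_contra hbad
  set S : Set ℝ := {l | l₀ ≤ l ∧ ¬ P l} with hS
  have hSbdd : BddAbove S := ⟨M, fun l hl => not_lt.1 fun h' => hl.2 (hM l h')⟩
  have hl₀ : l₀ ∈ S := ⟨le_rfl, hbad⟩
  have hL : l₀ ≤ sSup S := le_csSup hSbdd hl₀
  obtain ⟨ε, hε, hball⟩ := Metric.eventually_nhds_iff_ball.1 (h (sSup S) hL fun l hl => by
    by_contra hne
    exact absurd (le_csSup hSbdd ⟨hL.trans hl.le, hne⟩) (not_le.2 hl))
  obtain ⟨l, hlS, hl⟩ := exists_lt_of_lt_csSup ⟨l₀, hl₀⟩ (show sSup S - ε < sSup S by linarith)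
  have := le_csSup hSbdd hlS
  refine hlS.2 (hball l ?_)
  rw [Real.ball_eq_Ioo]
  exact ⟨hl, by linarith⟩

lemma continuous_mirror_uncurry (e : 𝔼) :
    Continuous fun z : ℝ × 𝔼 => mirror e z.1 z.2 := by
  unfold mirror
  fun_prop

/-- The method of moving planes in a fixed direction. -/
lemma le_mirror_of_moving_planes {u : 𝔼 → ℝ} (hu : ContDiff ℝ ∞ u) {e : 𝔼} (he : ‖e‖ = 1)
    {c : ℝ} (hc : 0 < c)
    (H : ∀ lam : ℝ, 0 < lam →
      (∀ x, ‖x‖ < 1 → lam ≤ inner ℝ e x → u x ≤ u (mirror e lam x)) →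
      ∀ x, ‖x‖ < 1 → lam ≤ inner ℝ e x →
        u x + c * lam * (inner ℝ e x - lam) ≤ u (mirror e lam x))
    (G : ∀ x, ‖x‖ = 1 → 0 < inner ℝ e x → fderiv ℝ u x e < 0)
    {lam : ℝ} (hl : 0 < lam) {x : 𝔼} (hx : ‖x‖ < 1) (hx' : lam ≤ inner ℝ e x) :
    u x ≤ u (mirror e lam x) := by
  set P : ℝ → Prop := fun l => ∀ x, ‖x‖ < 1 → l ≤ inner ℝ e x → u x ≤ u (mirror e l x) with hP
  suffices P lam from this x hx hx'
  clear hx hx' x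
  have huc := hu.continuous
  refine of_forall_gt_of_eventually (M := 1) ?_ ?_
  · intro l hl1 x hx hx'
    have := real_inner_le_norm e x
    rw [he] at this
    linarith
  intro L hLlam hgt
  have hL0 : 0 < L := hl.trans_le hLlam
  have hPL : P L := by
    intro x hx hx'
    rcases hx'.eq_or_lt with h | h
    · have : mirror e L x = x := by
        unfold mirror
        rw [h]
        simp
      rw [this]
    · have ht : Tendsto (fun l => u (mirror e l x)) (𝓝[>] L) (𝓝 (u (mirror e L x))) :=
        ((huc.comp ((continuous_mirror_uncurry e).comp
          (Continuous.prodMk_left x))).tendsto L).mono_left nhdsWithin_le_nhds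
      refine ge_of_tendsto ht ?_
      filter_upwards [Ioo_mem_nhdsGT h] with l hl'
      exact hgt l hl'.1 x hx hl'.2.le
  have hSL := H L hL0 hPL
  have hSL' : ∀ x, ‖x‖ ≤ 1 → L < inner ℝ e x → u x < u (mirror e L x) := by
    intro x hx hx'
    have hcl : u x + c * L * (inner ℝ e x - L) ≤ u (mirror e L x) := by
      have ht : Tendsto (fun t : ℝ => t • x) (𝓝[<] 1) (𝓝 x) := by
        have : Continuous fun t : ℝ => t • x := by fun_prop
        simpa using (this.tendsto 1).mono_left nhdsWithin_le_nhds
      have h1 : Continuous fun y => u y + c * L * (inner ℝ e y - L) := by fun_prop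
      have h2 : Continuous fun y => u (mirror e L y) := huc.comp (continuous_mirror e L)
      refine le_of_tendsto_of_tendsto ((h1.tendsto x).comp ht) ((h2.tendsto x).comp ht) ?_
      have h3 : ∀ᶠ y in 𝓝 x, L < inner ℝ e y :=
        (show Continuous fun y => inner ℝ e y by fun_prop).continuousAt.eventually_const_lt hx'
      filter_upwards [ht.eventually h3, Ioo_mem_nhdsLT (zero_lt_one' ℝ)] with t ht1 ht2
      refine hSL _ ?_ ht1.le
      rw [norm_smul, Real.norm_eq_abs, abs_of_pos ht2.1]
      nlinarith [ht2.1, ht2.2, norm_nonneg x]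
    have : 0 < c * L * (inner ℝ e x - L) := mul_pos (mul_pos hc hL0) (by linarith)
    linarith
  have hG : ∀ x, ‖x‖ ≤ 1 → inner ℝ e x = L → fderiv ℝ u x e < 0 := by
    intro x hx hxL
    rcases hx.eq_or_lt with h | h
    · exact G x h (hxL ▸ hL0)
    · have hd : HasDerivAt (fun t : ℝ => u (x - t • e) - u (x + t • e))
          (-2 * fderiv ℝ u x e) 0 := by
        have hux : ∀ y, y = x → HasFDerivAt u (fderiv ℝ u x) y := fun y hy => by
          rw [hy]; exact (hu.differentiable (by simp) x).hasFDerivAt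
        have h1 : HasDerivAt (fun t : ℝ => x - t • e) (-e) 0 := by
          simpa using ((hasDerivAt_id (0 : ℝ)).smul_const e).const_sub x
        have h2 : HasDerivAt (fun t : ℝ => x + t • e) e 0 := by
          simpa using ((hasDerivAt_id (0 : ℝ)).smul_const e).const_add x
        have := ((hux _ (by simp)).comp_hasDerivAt (0 : ℝ) h1).sub
          ((hux _ (by simp)).comp_hasDerivAt (0 : ℝ) h2)
        refine this.congr_deriv ?_
        rw [map_neg]
        ring
      have hslope := hd.tendsto_slope_zero_right
      have hge : c * L ≤ -2 * fderiv ℝ u x e := by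
        refine ge_of_tendsto hslope ?_
        have hcont : Continuous fun t : ℝ => ‖x + t • e‖ := by fun_prop
        have hev : ∀ᶠ t in 𝓝[>] (0 : ℝ), ‖x + t • e‖ < 1 :=
          (hcont.continuousAt.eventually_lt_const (by simpa using h)).filter_mono
            nhdsWithin_le_nhds
        filter_upwards [hev, self_mem_nhdsWithin] with t ht ht0
        replace ht0 : 0 < t := ht0
        have hin : inner ℝ e (x + t • e) = L + t := by
          rw [inner_add_right, inner_smul_right, real_inner_self_eq_norm_sq, he, hxL]
          ring
        have := hSL (x + t • e) ht (by rw [hin]; linarith)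
        have hm : mirror e L (x + t • e) = x - t • e := by
          unfold mirror
          rw [hin]
          module
        rw [hm, hin] at this
        simp only [zero_add, zero_smul, sub_zero, add_zero, sub_self, smul_eq_mul]
        rw [inv_mul_eq_div, le_div_iff₀ ht0]
        linarith
      have := mul_pos hc hL0
      linarith
  have hev : ∀ᶠ l in 𝓝 L, ∀ x ∈ closedBall (0 : 𝔼) 1, l ≤ inner ℝ e x → u x ≤ u (mirror e l x) := by
    refine (isCompact_closedBall (0 : 𝔼) 1).eventually_forall_of_forall_eventually fun x hx => ?_
    have hx1 : ‖x‖ ≤ 1 := by simpa using hx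
    have hci : Continuous fun z : ℝ × 𝔼 => inner ℝ e z.2 := by fun_prop
    have hc2 : Continuous fun z : ℝ × 𝔼 => z.1 := by fun_prop
    have hcm := continuous_mirror_uncurry e
    rcases lt_trichotomy (inner ℝ e x) L with h | h | h
    · filter_upwards [hci.continuousAt.eventually_lt (x₀ := (L, x)) hc2.continuousAt h]
        with z hz hz'
      exact absurd hz' (not_le.2 hz)
    · have hf : Continuous fun y => fderiv ℝ u y e :=
        (hu.continuous_fderiv (by simp)).clm_apply continuous_const
      obtain ⟨ε, hε, hball⟩ := Metric.eventually_nhds_iff_ball.1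
        (hf.continuousAt.eventually_lt_const (hG x hx1 h))
      have hm : mirror e L x = x := by
        unfold mirror
        rw [h]
        simp
      have e1 : ∀ᶠ z : ℝ × 𝔼 in 𝓝 (L, x), z.2 ∈ ball x ε :=
        (continuous_snd.tendsto (L, x)).eventually (ball_mem_nhds x hε)
      have e2 : ∀ᶠ z : ℝ × 𝔼 in 𝓝 (L, x), mirror e z.1 z.2 ∈ ball x ε := by
        refine (hcm.tendsto (L, x)).eventually ?_
        change ball x ε ∈ 𝓝 (mirror e L x)
        rw [hm]
        exact ball_mem_nhds x hε
      filter_upwards [e1, e2] with z hz1 hz2 hz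
      obtain ⟨y, hy, hmv⟩ := domain_mvt (f := u) (f' := fderiv ℝ u) (s := ball x ε)
        (fun y _ => (hu.differentiable (by simp) y).hasFDerivAt.hasFDerivWithinAt)
        (convex_ball x ε) hz1 hz2
      have hneg := hball y ((convex_ball x ε).segment_subset hz1 hz2 hy)
      have hsub : mirror e z.1 z.2 - z.2 = (2 * (z.1 - inner ℝ e z.2)) • e := by
        unfold mirror
        rw [add_sub_cancel_left]
      rw [hsub, map_smul, smul_eq_mul] at hmv
      nlinarith
    · have h1 : Continuous fun z : ℝ × 𝔼 => u z.2 := huc.comp continuous_snd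
      have h2 : Continuous fun z : ℝ × 𝔼 => u (mirror e z.1 z.2) := huc.comp hcm
      filter_upwards [h1.continuousAt.eventually_lt (x₀ := (L, x)) h2.continuousAt
        (hSL' x hx1 h)] with z hz _
      exact hz.le
  filter_upwards [hev] with l hl' x hx hx'
  exact hl' x (by simpa using hx.le) hx'

/-- Moving planes in every direction give radial symmetry. -/
lemma eq_of_norm_eq {u : 𝔼 → ℝ} (hu : Continuous u)
    (h : ∀ e : 𝔼, ‖e‖ = 1 → ∀ lam : ℝ, 0 < lam → ∀ x, ‖x‖ < 1 → lam ≤ inner ℝ e x →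
      u x ≤ u (mirror e lam x)) {x y : 𝔼} (hx : ‖x‖ < 1) (hxy : ‖x‖ = ‖y‖) : u x = u y := by
  have key : ∀ x y : 𝔼, ‖x‖ < 1 → ‖x‖ = ‖y‖ → u x ≤ u y := by
    intro x y hx hxy
    by_cases hne : x = y
    · rw [hne]
    have hd : 0 < ‖x - y‖ := norm_pos_iff.2 (sub_ne_zero.2 hne)
    set e : 𝔼 := ‖x - y‖⁻¹ • (x - y) with he
    have he1 : ‖e‖ = 1 := by
      rw [he, norm_smul, norm_inv, norm_norm, inv_mul_cancel₀ hd.ne']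
    have hex : inner ℝ e x = ‖x - y‖ / 2 := by
      have h1 := norm_sub_sq_real x y
      rw [← hxy] at h1
      have h2 : inner ℝ (x - y) x = ‖x - y‖ ^ 2 / 2 := by
        rw [inner_sub_left, real_inner_self_eq_norm_sq, real_inner_comm]
        linarith
      rw [he, real_inner_smul_left, h2]
      field_simp
    have hm : mirror e 0 x = y := by
      unfold mirror
      rw [hex, he, smul_smul]
      have : 2 * (0 - ‖x - y‖ / 2) * ‖x - y‖⁻¹ = -1 := by
        field_simp
        ring
      rw [this]
      module
    have ht : Tendsto (fun l => u (mirror e l x)) (𝓝[>] 0) (𝓝 (u (mirror e 0 x))) :=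
      ((hu.comp ((continuous_mirror_uncurry e).comp
        (Continuous.prodMk_left x))).tendsto 0).mono_left nhdsWithin_le_nhds
    rw [hm] at ht
    refine ge_of_tendsto ht ?_
    filter_upwards [Ioo_mem_nhdsGT (show 0 < ‖x - y‖ / 2 by linarith)] with l hl
    exact h e he1 l hl.1 x hx (by rw [hex]; exact hl.2.le)
  exact le_antisymm (key x y hx hxy) (key y x (hxy ▸ hx) hxy.symm)

/-- Positive solutions of the Dirichlet problem are radially symmetric. -/
theorem IsSol.radial (hn : 5 ≤ n) {Q : ℝ} (hQ : 0 ≤ Q) {u : 𝔼 → ℝ} (h : IsSol n Q u) {x y : 𝔼}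
    (hx : ‖x‖ ≤ 1) (hxy : ‖x‖ = ‖y‖) : u x = u y := by
  obtain ⟨hu, hpos, heq, h1, h2⟩ := h
  have hn' : (5 : ℝ) ≤ n := by exact_mod_cast hn
  replace h1 : ∀ x : 𝔼, ‖x‖ = 1 → u x = 1 := fun x hx => h1 x (by simpa using hx)
  replace h2 : ∀ x : 𝔼, ‖x‖ = 1 → fderiv ℝ u x x = -(((n : ℝ) - 4) / 2) :=
    fun x hx => h2 x (by simpa using hx)
  replace hpos : ∀ x : 𝔼, ‖x‖ ≤ 1 → 0 < u x := fun x hx => hpos x (by simpa using hx)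
  replace heq : ∀ x : 𝔼, ‖x‖ < 1 → laplacian (laplacian u) x =
      Q * u x ^ (((n : ℝ) + 4) / ((n : ℝ) - 4)) := fun x hx => heq x (by simpa using hx)
  have hp : 0 ≤ ((n : ℝ) + 4) / ((n : ℝ) - 4) := div_nonneg (by linarith) (by linarith)
  rcases hx.eq_or_lt with hx | hx
  · rw [h1 x hx, h1 y (hxy ▸ hx)]
  refine eq_of_norm_eq hu.continuous (fun e he lam hl z hz hz' => ?_) hx hxy
  refine le_mirror_of_moving_planes hu he (c := (n : ℝ) - 4) (by linarith) ?_ ?_ hl hz hz'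
  · intro l hl hP x hx hx'
    have := mirror_lower_bound hn hu h1 h2 he hl.le
      (fun y hy => by
        rw [heq y hy]
        exact mul_nonneg hQ (Real.rpow_nonneg (hpos y hy.le).le _))
      (fun y hy hy' => by
        rw [heq y hy, heq _ (norm_mirror_lt_one he hl.le hy hy')]
        exact mul_le_mul_of_nonneg_left
          (Real.rpow_le_rpow (hpos y hy.le).le (hP y hy hy') hp) hQ) hx hx'
    calc _ = _ := by ring
      _ ≤ _ := this
  · intro x hx hex
    rw [fderiv_eq_mul_inner hu h1 h2 hx, real_inner_comm]
    nlinarith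

/-- The spherical solution concentrated at scale `lam`. -/
noncomputable def spherical (lam : ℝ) (x : 𝔼) : ℝ :=
  (2 * lam / (lam ^ 2 + ‖x‖ ^ 2)) ^ (((n : ℝ) - 4) / 2)

lemma quad_zero_pos {lam : ℝ} (hl : 0 < lam) (x : 𝔼) : 0 < quad (lam ^ 2) 0 1 x := by
  rw [quad, inner_zero_left]
  have : 0 ≤ 1 * ‖x‖ ^ 2 := by positivity
  nlinarith

lemma spherical_eq {lam : ℝ} (hl : 0 < lam) (x : 𝔼) :
    spherical lam x =
      (2 * lam) ^ (((n : ℝ) - 4) / 2) * quad (lam ^ 2) 0 1 x ^ (2 - (n : ℝ) / 2) := by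
  have hq := quad_zero_pos hl x
  have : lam ^ 2 + ‖x‖ ^ 2 = quad (lam ^ 2) 0 1 x := by
    rw [quad, inner_zero_left]
    ring
  rw [spherical, this, Real.div_rpow (by positivity) hq.le, div_eq_mul_inv, ← Real.rpow_neg hq.le]
  congr 2
  ring

lemma contDiff_spherical {lam : ℝ} (hl : 0 < lam) : ContDiff ℝ ∞ (spherical lam : 𝔼 → ℝ) := by
  rw [show (spherical lam : 𝔼 → ℝ) = _ from funext (spherical_eq hl)]
  exact contDiff_const.mul (contDiff_rpow_comp (contDiff_quad _ _ _) (quad_zero_pos hl) _)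

lemma spherical_pos {lam : ℝ} (hl : 0 < lam) (x : 𝔼) : 0 < spherical lam x := by
  unfold spherical
  positivity

lemma bilaplacian_spherical (hn : 5 ≤ n) {lam : ℝ} (hl : 0 < lam) (x : 𝔼) :
    laplacian (laplacian (spherical lam)) x =
      ((n : ℝ) - 4) * ((n : ℝ) - 2) * n * ((n : ℝ) + 2) / 16 *
        spherical lam x ^ (((n : ℝ) + 4) / ((n : ℝ) - 4)) := by
  have hn' : (5 : ℝ) ≤ n := by exact_mod_cast hn
  have hq := quad_zero_pos hl x
  have hs : ContDiff ℝ ∞ (fun y : 𝔼 => quad (lam ^ 2) 0 1 y ^ (2 - (n : ℝ) / 2)) :=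
    contDiff_rpow_comp (contDiff_quad _ _ _) (quad_zero_pos hl) _
  have h1 : laplacian (spherical lam : 𝔼 → ℝ) = fun y =>
      (2 * lam) ^ (((n : ℝ) - 4) / 2) *
        laplacian (fun y => quad (lam ^ 2) 0 1 y ^ (2 - (n : ℝ) / 2)) y := by
    funext y
    rw [show (spherical lam : 𝔼 → ℝ) = _ from funext (spherical_eq hl), laplacian_const_mul hs]
  rw [h1, laplacian_const_mul (contDiff_laplacian hs),
    bilaplacian_quad_rpow (δ := lam ^ 2) (quad_zero_pos hl) (by simp), spherical_eq hl,
    Real.mul_rpow (x := (2 * lam) ^ (((n : ℝ) - 4) / 2)) (by positivity) (by positivity),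
    ← Real.rpow_mul (by positivity), ← Real.rpow_mul hq.le]
  have h4 : (n : ℝ) - 4 ≠ 0 := by linarith
  rw [show ((n : ℝ) - 4) / 2 * ((n + 4) / (n - 4)) = ((n : ℝ) - 4) / 2 + 4 by field_simp; ring,
    show (2 - (n : ℝ) / 2) * ((n + 4) / (n - 4)) = -((n : ℝ) / 2) - 2 by field_simp; ring,
    Real.rpow_add (by positivity), show (2 * lam) ^ (4 : ℝ) = 16 * lam ^ 4 by
      rw [show (4 : ℝ) = (4 : ℕ) by norm_num, Real.rpow_natCast]; ring]
  ring

lemma spherical_of_norm_eq_one {lam : ℝ} {x : 𝔼} (hx : ‖x‖ = 1) :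
    spherical lam x = (2 * lam / (lam ^ 2 + 1)) ^ (((n : ℝ) - 4) / 2) := by
  rw [spherical, hx, one_pow]

lemma fderiv_spherical_of_norm_eq_one {lam : ℝ} (hl : 0 < lam) {x : 𝔼} (hx : ‖x‖ = 1) :
    fderiv ℝ (spherical lam) x x =
      -(((n : ℝ) - 4) / (lam ^ 2 + 1) * (2 * lam / (lam ^ 2 + 1)) ^ (((n : ℝ) - 4) / 2)) := by
  have hp : ∀ y : 𝔼, 0 < lam ^ 2 + ‖y‖ ^ 2 := fun y => by positivity
  have h1 : HasFDerivAt (fun y : 𝔼 => lam ^ 2 + ‖y‖ ^ 2) (2 • innerSL ℝ x) x :=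
    (hasStrictFDerivAt_norm_sq x).hasFDerivAt.const_add _
  have h2 := (h1.rpow_const (p := 2 - (n : ℝ) / 2) (Or.inl (hp x).ne')).const_mul
    ((2 * lam) ^ (((n : ℝ) - 4) / 2))
  have h3 : (spherical lam : 𝔼 → ℝ) = fun y =>
      (2 * lam) ^ (((n : ℝ) - 4) / 2) * (lam ^ 2 + ‖y‖ ^ 2) ^ (2 - (n : ℝ) / 2) := by
    funext y
    rw [spherical_eq hl, quad, inner_zero_left]
    congr 2
    ring
  rw [← spherical_of_norm_eq_one hx, h3, h2.fderiv]
  simp only [_root_.smul_apply, innerSL_apply_apply, real_inner_self_eq_norm_sq, hx, smul_eq_mul,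
    nsmul_eq_mul, one_pow]
  rw [Real.rpow_sub_one (by positivity)]
  field_simp
  ring

/-- The spherical solution at scale one solves the Dirichlet problem. -/
lemma isSol_spherical (hn : 5 ≤ n) :
    IsSol n (((n : ℝ) - 4) * ((n : ℝ) - 2) * n * ((n : ℝ) + 2) / 16) (spherical 1) := by
  refine ⟨contDiff_spherical one_pos, fun x _ => spherical_pos one_pos x,
    fun x _ => bilaplacian_spherical hn one_pos x, fun x hx => ?_, fun x hx => ?_⟩
  · rw [spherical_of_norm_eq_one (by simpa using hx)]
    norm_num
  · rw [fderiv_spherical_of_norm_eq_one one_pos (by simpa using hx)]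
    norm_num

lemma tendsto_spherical_bound (hn : 5 ≤ n) :
    Tendsto (fun l : ℝ => (2 / l) ^ (((n : ℝ) - 4) / 2)) atTop (𝓝 0) := by
  have hn' : (5 : ℝ) ≤ n := by exact_mod_cast hn
  have h1 : Tendsto (fun l : ℝ => 2 / l) atTop (𝓝 0) := tendsto_const_nhds.div_atTop tendsto_id
  have := h1.rpow_const (p := ((n : ℝ) - 4) / 2) (Or.inr (by linarith))
  rwa [Real.zero_rpow (by linarith)] at this

lemma continuousAt_spherical {L : ℝ} (hL : 0 < L) (hn : 5 ≤ n) (x : 𝔼) :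
    ContinuousAt (fun z : ℝ × 𝔼 => spherical z.1 z.2) (L, x) := by
  have hn' : (5 : ℝ) ≤ n := by exact_mod_cast hn
  unfold spherical
  refine ContinuousAt.rpow_const (ContinuousAt.div ?_ ?_ ?_) (Or.inr (by linarith))
  · exact (continuous_const.mul continuous_fst).continuousAt
  · exact ((continuous_fst.pow 2).add (continuous_snd.norm.pow 2)).continuousAt
  · change L ^ 2 + ‖x‖ ^ 2 ≠ 0
    positivity

/-- Every solution lies above the spherical solution at scale one. -/
theorem IsSol.spherical_le (hn : 5 ≤ n) {u : 𝔼 → ℝ}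
    (h : IsSol n (((n : ℝ) - 4) * ((n : ℝ) - 2) * n * ((n : ℝ) + 2) / 16) u) {x : 𝔼}
    (hx : ‖x‖ ≤ 1) : spherical 1 x ≤ u x := by
  obtain ⟨hu, hpos, heq, h1, h2⟩ := h
  have hn' : (5 : ℝ) ≤ n := by exact_mod_cast hn
  set m : ℝ := ((n : ℝ) - 4) / 2 with hm
  have hm0 : 0 < m := by rw [hm]; linarith
  have hQ : 0 ≤ ((n : ℝ) - 4) * ((n : ℝ) - 2) * n * ((n : ℝ) + 2) / 16 := by
    have : 0 ≤ ((n : ℝ) - 4) * ((n : ℝ) - 2) := mul_nonneg (by linarith) (by linarith)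
    positivity
  have hp : 0 ≤ ((n : ℝ) + 4) / ((n : ℝ) - 4) := div_nonneg (by linarith) (by linarith)
  have hmem : ∀ y : 𝔼, y ∈ closedBall (0 : 𝔼) 1 ↔ ‖y‖ ≤ 1 := by simp
  have main : ∀ lam : ℝ, 1 < lam → ∀ y : 𝔼, ‖y‖ ≤ 1 → spherical lam y ≤ u y := by
    intro lam hlam
    obtain ⟨y₀, hy₀, hmin⟩ := (isCompact_closedBall (0 : 𝔼) 1).exists_isMinOn
      ⟨0, by simp⟩ hu.continuous.continuousOn
    obtain ⟨M, hM⟩ := eventually_atTop.1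
      ((tendsto_order.1 (tendsto_spherical_bound hn)).2 _ (hpos y₀ hy₀))
    refine of_forall_gt_of_eventually (M := max M 1)
      (P := fun lam => ∀ y : 𝔼, ‖y‖ ≤ 1 → spherical lam y ≤ u y) ?_ ?_
    · intro l hl y hy
      have hl1 : 1 < l := (le_max_right _ _).trans_lt hl
      refine le_trans ?_ ((hM l ((le_max_left _ _).trans hl.le)).le.trans (hmin ((hmem y).2 hy)))
      unfold spherical
      refine Real.rpow_le_rpow (by positivity) ?_ hm0.le
      rw [div_le_div_iff₀ (by positivity) (by positivity)]
      nlinarith [sq_nonneg ‖y‖]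
    intro L hL hgt
    have hL1 : 1 < L := hlam.trans_le hL
    have hL0 : 0 < L := one_pos.trans hL1
    have hPL : ∀ y : 𝔼, ‖y‖ ≤ 1 → spherical L y ≤ u y := by
      intro y hy
      have ht : Tendsto (fun l => spherical l y) (𝓝[>] L) (𝓝 (spherical L y)) :=
        ((continuousAt_spherical hL0 hn y).comp (f := fun l : ℝ => (l, y)) (x := L)
          (Continuous.prodMk_left y).continuousAt).mono_left nhdsWithin_le_nhds
      refine le_of_tendsto ht ?_
      filter_upwards [self_mem_nhdsWithin] with l hl
      exact hgt l hl y hy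
    set β : ℝ := (2 * L / (L ^ 2 + 1)) ^ m with hβ
    have hβ1 : β < 1 := by
      refine Real.rpow_lt_one (by positivity) ?_ hm0
      rw [div_lt_one (by positivity)]
      nlinarith
    have hβ0 : 0 ≤ β := by positivity
    have hs := contDiff_spherical (n := n) hL0
    have hw := hu.sub hs
    have hstrict : ∀ y : 𝔼, ‖y‖ ≤ 1 → spherical L y < u y := by
      intro y hy
      rcases hy.eq_or_lt with hy | hy
      · rw [spherical_of_norm_eq_one hy, h1 y (by simpa using hy)]
        exact hβ1
      have hbi : ∀ z : 𝔼, laplacian (laplacian fun y => u y - spherical L y) z =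
          laplacian (laplacian u) z - laplacian (laplacian (spherical L)) z := by
        intro z
        rw [show laplacian (fun y => u y - spherical L y) =
          fun y => laplacian u y - laplacian (spherical L) y from funext (laplacian_sub hu hs),
          laplacian_sub (contDiff_laplacian hu) (contDiff_laplacian hs)]
      have := le_of_bilaplacian_nonneg (a := 1 - β)
        (b := -m - -(((n : ℝ) - 4) / (L ^ 2 + 1) * β)) hn hw
        (fun z hz => by
          rw [h1 z (by simpa using hz), spherical_of_norm_eq_one hz])
        (fun z hz => by
          rw [fderiv_fun_sub (hu.differentiable (by simp) z) (hs.differentiable (by simp) z),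
            _root_.sub_apply, h2 z (by simpa using hz), fderiv_spherical_of_norm_eq_one hL0 hz])
        (fun z hz => by
          rw [hbi, heq z (by simpa using hz), bilaplacian_spherical hn hL0, ← mul_sub]
          exact mul_nonneg hQ (sub_nonneg.2
            (Real.rpow_le_rpow (spherical_pos hL0 z).le (hPL z hz.le) hp))) hy
      have hb : ((n : ℝ) - 4) / (L ^ 2 + 1) * β ≤ m := by
        have : ((n : ℝ) - 4) / (L ^ 2 + 1) ≤ m := by
          rw [hm]
          exact div_le_div_of_nonneg_left (by linarith) two_pos (by nlinarith)
        nlinarith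
      have hy2 : 0 ≤ 1 - ‖y‖ ^ 2 := by nlinarith [norm_nonneg y]
      nlinarith [mul_nonneg (sub_nonneg.2 hb) hy2]
    have hev : ∀ᶠ l in 𝓝 L, ∀ y ∈ closedBall (0 : 𝔼) 1, spherical l y ≤ u y := by
      refine (isCompact_closedBall (0 : 𝔼) 1).eventually_forall_of_forall_eventually
        fun y hy => ?_
      have hc : ContinuousAt (fun z : ℝ × 𝔼 => u z.2) (L, y) :=
        (hu.continuous.comp continuous_snd).continuousAt
      filter_upwards [(continuousAt_spherical hL0 hn y).eventually_lt hc
        (hstrict y ((hmem y).1 hy))] with z hz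
      exact hz.le
    filter_upwards [hev] with l hl y hy
    exact hl y ((hmem y).2 hy)
  have ht : Tendsto (fun l => spherical l x) (𝓝[>] 1) (𝓝 (spherical 1 x)) :=
    ((continuousAt_spherical one_pos hn x).comp (f := fun l : ℝ => (l, x)) (x := 1)
      (Continuous.prodMk_left x).continuousAt).mono_left nhdsWithin_le_nhds
  refine le_of_tendsto ht ?_
  filter_upwards [self_mem_nhdsWithin] with l hl
  exact main l hl x hx

/-- The Laplacian of a radial function. -/
lemma laplacian_radial {f : 𝔼 → ℝ} (hf : ContDiff ℝ ∞ f) {e : 𝔼}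
    (hrad : ∀ x, ‖x‖ < 1 → f x = f (‖x‖ • e)) {x : 𝔼} (hx0 : 0 < ‖x‖) (hx : ‖x‖ < 1) :
    laplacian f x = deriv (deriv fun r : ℝ => f (r • e)) ‖x‖ +
      ((n : ℝ) - 1) / ‖x‖ * deriv (fun r : ℝ => f (r • e)) ‖x‖ := by
  set φ : ℝ → ℝ := fun r => f (r • e) with hφ
  have hφc : ContDiff ℝ ∞ φ := hf.comp (contDiff_id.smul contDiff_const)
  have hφ' : ContDiff ℝ ∞ (deriv φ) := (contDiff_infty_iff_deriv.1 hφc).2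
  have hq : ∀ y : 𝔼, quad 0 0 1 y = ‖y‖ ^ 2 := fun y => by
    rw [quad, inner_zero_left]
    ring
  have hqx : 0 < quad 0 0 1 x := by
    rw [hq]
    positivity
  have hcongr : f =ᶠ[𝓝 x] fun y => (fun z => φ (√z)) (quad 0 0 1 y) := by
    filter_upwards [continuous_norm.continuousAt.eventually_lt_const hx] with y hy
    simp only [hφ]
    rw [hq, Real.sqrt_sq (norm_nonneg y), hrad y hy]
  have hsx : √(quad 0 0 1 x) = ‖x‖ := by rw [hq, Real.sqrt_sq hx0.le]
  have hd1 : ∀ᶠ z in 𝓝 (quad 0 0 1 x), HasDerivAt (fun z => φ (√z))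
      (deriv φ (√z) * (1 / (2 * √z))) z := by
    filter_upwards [lt_mem_nhds hqx] with z hz
    exact ((hφc.differentiable (by simp) _).hasDerivAt).comp z (Real.hasDerivAt_sqrt hz.ne')
  have hd2 : HasDerivAt (fun z => deriv φ (√z) * (1 / (2 * √z)))
      (deriv (deriv φ) ‖x‖ / (4 * ‖x‖ ^ 2) - deriv φ ‖x‖ / (4 * ‖x‖ ^ 3)) (quad 0 0 1 x) := by
    have h1 := Real.hasDerivAt_sqrt hqx.ne'
    have h2 := ((hφ'.differentiable (by simp) _).hasDerivAt).comp _ h1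
    have h3 := (hasDerivAt_const (quad 0 0 1 x) (1 : ℝ)).div (h1.const_mul 2)
      (by rw [hsx]; positivity)
    refine (h2.mul h3).congr_deriv ?_
    simp only [Function.comp_apply, Pi.div_apply, hsx]
    field_simp
    ring
  have hsum : ∑ i, pd i (quad 0 0 1) x ^ 2 = 4 * ‖x‖ ^ 2 := by
    simp_rw [pd_quad, EuclideanSpace.norm_sq_eq, Finset.mul_sum]
    refine Finset.sum_congr rfl fun i _ => ?_
    simp [mul_pow]
    norm_num
  rw [laplacian_congr hcongr, laplacian_comp (contDiff_quad _ _ _) hd1 hd2, hsum, laplacian_quad,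
    hsx]
  field_simp
  ring

/-- The radial profiles `φ` of a solution and `ψ` of its Laplacian. -/
structure RadialSol (n : ℕ) (Q : ℝ) (φ ψ : ℝ → ℝ) : Prop where
  contDiff_fst : ContDiff ℝ ∞ φ
  contDiff_snd : ContDiff ℝ ∞ ψ
  pos : ∀ r ∈ Icc (0 : ℝ) 1, 0 < φ r
  ode_fst : ∀ r ∈ Ioo (0 : ℝ) 1, r * deriv (deriv φ) r + ((n : ℝ) - 1) * deriv φ r = r * ψ r
  ode_snd : ∀ r ∈ Ioo (0 : ℝ) 1, r * deriv (deriv ψ) r + ((n : ℝ) - 1) * deriv ψ r =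
    r * (Q * φ r ^ (((n : ℝ) + 4) / ((n : ℝ) - 4)))
  fst_one : φ 1 = 1
  deriv_fst_one : deriv φ 1 = -(((n : ℝ) - 4) / 2)

theorem IsSol.radialSol (hn : 5 ≤ n) {Q : ℝ} (hQ : 0 ≤ Q) {u : 𝔼 → ℝ} (h : IsSol n Q u) {e : 𝔼}
    (he : ‖e‖ = 1) :
    RadialSol n Q (fun r => u (r • e)) (fun r => laplacian u (r • e)) := by
  have hrad : ∀ x : 𝔼, ‖x‖ < 1 → u x = u (‖x‖ • e) := fun x hx =>
    IsSol.radial hn hQ h hx.le (by rw [norm_smul, he, norm_norm, mul_one])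
  obtain ⟨hu, hpos, heq, h1, h2⟩ := h
  have hline : ContDiff ℝ ∞ fun r : ℝ => r • e := contDiff_id.smul contDiff_const
  have hnorm : ∀ r : ℝ, 0 ≤ r → ‖r • e‖ = r := fun r hr => by
    rw [norm_smul, he, mul_one, Real.norm_eq_abs, abs_of_nonneg hr]
  have hode : ∀ f : 𝔼 → ℝ, ContDiff ℝ ∞ f → (∀ x : 𝔼, ‖x‖ < 1 → f x = f (‖x‖ • e)) →
      ∀ r ∈ Ioo (0 : ℝ) 1, r * deriv (deriv fun r : ℝ => f (r • e)) r +
        ((n : ℝ) - 1) * deriv (fun r : ℝ => f (r • e)) r = r * laplacian f (r • e) := by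
    intro f hf hfr r hr
    have hr' := hnorm r hr.1.le
    rw [laplacian_radial hf hfr (by rw [hr']; exact hr.1) (by rw [hr']; exact hr.2), hr']
    have := hr.1.ne'
    field_simp
  have hlap : ∀ x : 𝔼, ‖x‖ < 1 → laplacian u x = laplacian u (‖x‖ • e) := by
    intro x hx
    rcases (norm_nonneg x).eq_or_lt with h0 | h0
    · rw [← h0, zero_smul, norm_eq_zero.1 h0.symm]
    · have hx' := hnorm ‖x‖ h0.le
      rw [laplacian_radial hu hrad h0 hx, laplacian_radial hu hrad (by rwa [hx']) (by rwa [hx']),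
        hx']
  refine ⟨hu.comp hline, (contDiff_laplacian hu).comp hline, fun r hr => ?_, hode u hu hrad,
    fun r hr => ?_, ?_, ?_⟩
  · exact hpos _ (by simpa [hnorm r hr.1] using hr.2)
  · rw [hode _ (contDiff_laplacian hu) hlap r hr, heq _ (by simpa [hnorm r hr.1.le] using hr.2)]
  · simpa using h1 e (by simpa using he)
  · have hd : HasDerivAt (fun r : ℝ => r • e) e 1 := by
      simpa using (hasDerivAt_id (1 : ℝ)).smul_const e
    have hue : HasFDerivAt u (fderiv ℝ u e) ((1 : ℝ) • e) := by
      rw [one_smul]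
      exact (hu.differentiable (by simp) e).hasFDerivAt
    have := (hue.comp_hasDerivAt (1 : ℝ) hd).deriv
    rw [h2 e (by simpa using he)] at this
    exact this

lemma hasDerivAt_pow_mul {f : ℝ → ℝ} {f' : ℝ} {r : ℝ} (k : ℕ) (hf : HasDerivAt f f' r) :
    HasDerivAt (fun r => r ^ (k + 1) * f r) (r ^ k * (r * f' + (k + 1) * f r)) r := by
  refine ((hasDerivAt_pow (k + 1) r).mul hf).congr_deriv ?_
  push_cast
  ring

lemma hasDerivAt_of_contDiff {f : ℝ → ℝ} (hf : ContDiff ℝ ∞ f) (r : ℝ) :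
    HasDerivAt f (deriv f r) r :=
  (hf.differentiable (by simp) r).hasDerivAt

lemma contDiff_deriv {f : ℝ → ℝ} (hf : ContDiff ℝ ∞ f) : ContDiff ℝ ∞ (deriv f) :=
  (contDiff_infty_iff_deriv.1 hf).2

/-- The Pohozaev identity determines `Δu` on the boundary up to two values. -/
lemma RadialSol.pohozaev (hn : 5 ≤ n) {Q : ℝ} {φ ψ : ℝ → ℝ} (h : RadialSol n Q φ ψ) :
    ψ 1 ^ 2 + n * (((n : ℝ) - 4) / 2) * ψ 1 + 2 * Q * (((n : ℝ) - 4) / 2) / n = 0 := by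
  have hn' : (5 : ℝ) ≤ n := by exact_mod_cast hn
  obtain ⟨k, rfl⟩ : ∃ k, n = k + 2 := ⟨n - 2, by omega⟩
  set N : ℝ := ((k + 2 : ℕ) : ℝ) with hN
  have hNk : N = k + 2 := by rw [hN]; push_cast; ring
  set m : ℝ := (N - 4) / 2 with hm
  have hm0 : m ≠ 0 := by rw [hm]; linarith
  set p : ℝ := (N + 4) / (N - 4) with hp
  have hp1 : p + 1 = N / m := by
    rw [hp, hm]
    have : N - 4 ≠ 0 := by linarith
    field_simp
    ring
  have hp0 : 0 ≤ p := div_nonneg (by linarith) (by linarith)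
  have hφ := hasDerivAt_of_contDiff h.contDiff_fst
  have hφ' := hasDerivAt_of_contDiff (contDiff_deriv h.contDiff_fst)
  have hψ := hasDerivAt_of_contDiff h.contDiff_snd
  have hψ' := hasDerivAt_of_contDiff (contDiff_deriv h.contDiff_snd)
  set E : ℝ → ℝ := fun r =>
    r ^ (k + 1 + 1) * (deriv φ r * deriv ψ r - ψ r ^ 2 / 2 - Q * m / N * φ r ^ (p + 1)) +
      r ^ (k + 1) * (m * (φ r * deriv ψ r) + N / 2 * (deriv φ r * ψ r)) with hE
  have hEc : ContinuousOn E (Icc 0 1) := by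
    have c1 := h.contDiff_fst.continuous
    have c2 := (contDiff_deriv h.contDiff_fst).continuous
    have c3 := h.contDiff_snd.continuous
    have c4 := (contDiff_deriv h.contDiff_snd).continuous
    have c5 : Continuous fun r => φ r ^ (p + 1) := c1.rpow_const fun r => Or.inr (by linarith)
    rw [hE]
    fun_prop
  have hEd : ∀ r ∈ Ioo (0 : ℝ) 1, HasDerivAt E 0 r := by
    intro r hr
    have hpos := h.pos r ⟨hr.1.le, hr.2.le⟩
    have hpow : HasDerivAt (fun r => φ r ^ (p + 1)) (deriv φ r * (p + 1) * φ r ^ p) r := by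
      refine ((hφ r).rpow_const (p := p + 1) (Or.inl hpos.ne')).congr_deriv ?_
      rw [add_sub_cancel_right]
    have d1 := hasDerivAt_pow_mul (k + 1) ((((hφ' r).mul (hψ' r)).sub
      (((hψ r).pow 2).div_const 2)).sub (hpow.const_mul (Q * m / N)))
    have d2 := hasDerivAt_pow_mul k ((((hφ r).mul (hψ' r)).const_mul m).add
      (((hφ' r).mul (hψ r)).const_mul (N / 2)))
    refine (d1.add d2).congr_deriv ?_
    have e1 := h.ode_fst r hr
    have e2 := h.ode_snd r hr
    rw [← hN, ← hp] at e2
    rw [← hN] at e1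
    have hpp : φ r ^ (p + 1) = φ r ^ p * φ r := by rw [Real.rpow_add hpos, Real.rpow_one]
    have hc : Q * m / N * (p + 1) = Q := by
      rw [hp1]
      field_simp
    have hc' : N * (Q * m / N) = Q * m := by field_simp
    simp only [Pi.mul_apply, Pi.sub_apply, Pi.add_apply, Pi.pow_apply]
    rw [hpp]
    set c := Q * m / N
    set A := deriv (deriv φ) r
    set B := deriv (deriv ψ) r
    set F := φ r ^ p
    have hkN : (k : ℝ) = N - 2 := by linarith
    push_cast
    rw [hkN]
    have hmN : N = 2 * m + 4 := by rw [hm]; ring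
    linear_combination r ^ k * ((r * deriv ψ r + N / 2 * ψ r) * e1 +
      (r * deriv φ r + m * φ r) * e2 - r ^ 2 * deriv φ r * F * hc - r * φ r * F * hc')
      + r ^ (k + 1) * deriv φ r * deriv ψ r * (-(1 / 2)) * hmN
  have hE01 : E 1 = E 0 := by
    obtain ⟨c, hc, hc'⟩ := exists_hasDerivAt_eq_slope E (fun _ => 0) one_pos hEc hEd
    simp only [sub_zero, div_one] at hc'
    linarith
  have hE0 : E 0 = 0 := by simp [hE]
  rw [hE0] at hE01
  simp only [hE, h.fst_one, h.deriv_fst_one, one_pow, Real.one_rpow] at hE01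
  rw [← hN, ← hm] at hE01
  have : 2 * Q * m / N = 2 * (Q * m / N) := by ring
  rw [this]
  linarith

section uniqueness

variable {Q : ℝ} {φ₁ ψ₁ φ₂ ψ₂ : ℝ → ℝ}

lemma deriv_sub_of_contDiff {f g : ℝ → ℝ} (hf : ContDiff ℝ ∞ f) (hg : ContDiff ℝ ∞ g) :
    deriv (fun r => f r - g r) = fun r => deriv f r - deriv g r :=
  funext fun r => ((hasDerivAt_of_contDiff hf r).sub (hasDerivAt_of_contDiff hg r)).deriv

lemma monotoneOn_pow_mul_deriv {k : ℕ} {f : ℝ → ℝ} (hf : ContDiff ℝ ∞ f) {a : ℝ} (ha : 0 ≤ a)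
    (h : ∀ r ∈ Ioo a 1, 0 ≤ r * deriv (deriv f) r + (k + 1) * deriv f r) :
    MonotoneOn (fun r => r ^ (k + 1) * deriv f r) (Icc a 1) := by
  have hd := fun r => hasDerivAt_pow_mul k (hasDerivAt_of_contDiff (contDiff_deriv hf) r)
  refine monotoneOn_of_deriv_nonneg (convex_Icc a 1)
    (fun r _ => (hd r).continuousAt.continuousWithinAt)
    (fun r _ => (hd r).differentiableAt.differentiableWithinAt) fun r hr => ?_
  rw [interior_Icc] at hr
  rw [(hd r).deriv]
  have : 0 ≤ r := ha.trans hr.1.le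
  exact mul_nonneg (by positivity) (h r hr)

/-- A function with vanishing Cauchy data at `1` is positive to the left of `1` as long as its
radial Laplacian, vanishing at `1`, is decreasing. -/
lemma pos_of_radial_laplacian_decreasing {k : ℕ} {w z : ℝ → ℝ} (hw : ContDiff ℝ ∞ w)
    (hz : ContDiff ℝ ∞ z)
    (hode : ∀ r ∈ Ioo (0 : ℝ) 1, r * deriv (deriv w) r + (k + 1) * deriv w r = r * z r)
    (hw1 : w 1 = 0) (hw1' : deriv w 1 = 0) (hz1 : z 1 = 0) {a : ℝ} (ha : 0 < a)
    (h : ∀ r ∈ Ioo a 1, deriv z r < 0) {r : ℝ} (hr : r ∈ Ico a 1) : 0 < w r := by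
  have ha1 : a < 1 := hr.1.trans_lt hr.2
  have h1mem : (1 : ℝ) ∈ Icc a 1 := ⟨ha1.le, le_rfl⟩
  have hzanti : StrictAntiOn z (Icc a 1) :=
    strictAntiOn_of_deriv_neg (convex_Icc a 1) hz.continuous.continuousOn
      (by rw [interior_Icc]; exact h)
  have hzpos : ∀ s ∈ Ico a 1, 0 < z s := fun s hs => by
    rw [← hz1]
    exact hzanti ⟨hs.1, hs.2.le⟩ h1mem hs.2
  have hd := fun r => hasDerivAt_pow_mul k (hasDerivAt_of_contDiff (contDiff_deriv hw) r)
  have hvmono : StrictMonoOn (fun r => r ^ (k + 1) * deriv w r) (Icc a 1) := by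
    refine strictMonoOn_of_deriv_pos (convex_Icc a 1)
      (fun r _ => (hd r).continuousAt.continuousWithinAt) fun s hs => ?_
    rw [interior_Icc] at hs
    have hs0 : 0 < s := ha.trans hs.1
    rw [(hd s).deriv, hode s ⟨hs0, hs.2⟩]
    have := hzpos s ⟨hs.1.le, hs.2⟩
    positivity
  have hw' : ∀ s ∈ Ioo a 1, deriv w s < 0 := by
    intro s hs
    have := hvmono ⟨hs.1.le, hs.2.le⟩ h1mem hs.2
    simp only [hw1', mul_zero] at this
    have hs0 : 0 < s := ha.trans hs.1
    exact neg_of_mul_neg_right this (by positivity)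
  rw [← hw1]
  exact strictAntiOn_of_deriv_neg (convex_Icc a 1) hw.continuous.continuousOn
    (by rw [interior_Icc]; exact hw') ⟨hr.1, hr.2.le⟩ h1mem hr.2

lemma RadialSol.ode_sub_fst (h₁ : RadialSol n Q φ₁ ψ₁) (h₂ : RadialSol n Q φ₂ ψ₂) {r : ℝ}
    (hr : r ∈ Ioo (0 : ℝ) 1) :
    r * deriv (deriv fun r => φ₁ r - φ₂ r) r + ((n : ℝ) - 1) * deriv (fun r => φ₁ r - φ₂ r) r =
      r * (ψ₁ r - ψ₂ r) := by
  rw [deriv_sub_of_contDiff h₁.contDiff_fst h₂.contDiff_fst,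
    deriv_sub_of_contDiff (contDiff_deriv h₁.contDiff_fst) (contDiff_deriv h₂.contDiff_fst)]
  linear_combination h₁.ode_fst r hr - h₂.ode_fst r hr

lemma RadialSol.ode_sub_snd (h₁ : RadialSol n Q φ₁ ψ₁) (h₂ : RadialSol n Q φ₂ ψ₂) {r : ℝ}
    (hr : r ∈ Ioo (0 : ℝ) 1) :
    r * deriv (deriv fun r => ψ₁ r - ψ₂ r) r + ((n : ℝ) - 1) * deriv (fun r => ψ₁ r - ψ₂ r) r =
      r * (Q * (φ₁ r ^ (((n : ℝ) + 4) / ((n : ℝ) - 4)) -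
        φ₂ r ^ (((n : ℝ) + 4) / ((n : ℝ) - 4)))) := by
  rw [deriv_sub_of_contDiff h₁.contDiff_snd h₂.contDiff_snd,
    deriv_sub_of_contDiff (contDiff_deriv h₁.contDiff_snd) (contDiff_deriv h₂.contDiff_snd)]
  linear_combination h₁.ode_snd r hr - h₂.ode_snd r hr

/-- Two radial solutions with the same `Δu` on the boundary have ordered third derivatives
there. -/
lemma RadialSol.deriv_snd_one_le (hn : 5 ≤ n) (hQ : 0 ≤ Q) (h₁ : RadialSol n Q φ₁ ψ₁)
    (h₂ : RadialSol n Q φ₂ ψ₂) (h : ψ₁ 1 = ψ₂ 1) : deriv ψ₂ 1 ≤ deriv ψ₁ 1 := by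
  by_contra! hlt
  have hn' : (5 : ℝ) ≤ n := by exact_mod_cast hn
  have hp : 0 ≤ ((n : ℝ) + 4) / ((n : ℝ) - 4) := div_nonneg (by linarith) (by linarith)
  obtain ⟨k, rfl⟩ : ∃ k, n = k + 2 := ⟨n - 2, by omega⟩
  have hk : ((k + 2 : ℕ) : ℝ) - 1 = k + 1 := by push_cast; ring
  set w : ℝ → ℝ := fun r => φ₁ r - φ₂ r with hw
  set z : ℝ → ℝ := fun r => ψ₁ r - ψ₂ r with hz
  have hwc : ContDiff ℝ ∞ w := h₁.contDiff_fst.sub h₂.contDiff_fst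
  have hzc : ContDiff ℝ ∞ z := h₁.contDiff_snd.sub h₂.contDiff_snd
  have hode : ∀ r ∈ Ioo (0 : ℝ) 1, r * deriv (deriv w) r + (k + 1) * deriv w r = r * z r :=
    fun r hr => by rw [← hk]; exact h₁.ode_sub_fst h₂ hr
  have hw1 : w 1 = 0 := by simp [hw, h₁.fst_one, h₂.fst_one]
  have hw1' : deriv w 1 = 0 := by
    rw [hw, deriv_sub_of_contDiff h₁.contDiff_fst h₂.contDiff_fst]
    simp [h₁.deriv_fst_one, h₂.deriv_fst_one]
  have hz1 : z 1 = 0 := by simp [hz, h]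
  have hz1' : deriv z 1 < 0 := by
    rw [hz, deriv_sub_of_contDiff h₁.contDiff_snd h₂.contDiff_snd]
    exact sub_neg.2 hlt
  have hchain := fun a (ha : 0 < a) => pos_of_radial_laplacian_decreasing hwc hzc hode hw1 hw1'
    hz1 (a := a) ha
  have hmono : ∀ a : ℝ, 0 ≤ a → (∀ r ∈ Ioo a 1, 0 < w r) →
      MonotoneOn (fun r => r ^ (k + 1) * deriv z r) (Icc a 1) := by
    intro a ha hpos
    refine monotoneOn_pow_mul_deriv hzc ha fun r hr => ?_
    have hr0 : 0 < r := ha.trans_lt hr.1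
    rw [← hk, h₁.ode_sub_snd h₂ ⟨hr0, hr.2⟩]
    have hle : φ₂ r ≤ φ₁ r := (sub_pos.1 (hpos r hr)).le
    have := Real.rpow_le_rpow (h₂.pos r ⟨hr0.le, hr.2.le⟩).le hle hp
    exact mul_nonneg hr0.le (mul_nonneg hQ (sub_nonneg.2 this))
  have hwpos : ∀ l : ℝ, 0 < l → l < 1 → 0 < w l := by
    intro l₀ hl₀
    refine of_forall_gt_of_eventually (P := fun l => l < 1 → 0 < w l) (M := 1)
      (fun l hl hl' => absurd hl' hl.not_gt) fun L hL hgt => ?_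
    have hL0 : 0 < L := hl₀.trans_le hL
    rcases lt_trichotomy L 1 with hL1 | hL1 | hL1
    · have hm := hmono L hL0.le fun r hr => hgt r hr.1 hr.2
      have hz' : ∀ r ∈ Ioo L 1, deriv z r < 0 := by
        intro r hr
        have hle := hm ⟨hr.1.le, hr.2.le⟩ ⟨hL1.le, le_rfl⟩ hr.2.le
        simp only [one_pow, one_mul] at hle
        exact neg_of_mul_neg_right (hle.trans_lt hz1') (pow_pos (hL0.trans hr.1) _).le
      have hwL := hchain L hL0 hz' ⟨le_rfl, hL1⟩
      filter_upwards [hwc.continuous.continuousAt.eventually_const_lt hwL] with l hl _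
      exact hl
    · subst hL1
      obtain ⟨ε, hε, hball⟩ := Metric.eventually_nhds_iff_ball.1
        ((contDiff_deriv hzc).continuous.continuousAt.eventually_lt_const hz1')
      have hlt : max (1 - ε) (1 / 2) < 1 := max_lt (by linarith) (by norm_num)
      filter_upwards [lt_mem_nhds hlt] with l hl hl1
      refine hchain (max (1 - ε) (1 / 2)) (lt_max_of_lt_right (by norm_num)) (fun r hr => ?_)
        ⟨hl.le, hl1⟩
      refine hball r ?_
      rw [Real.ball_eq_Ioo]
      exact ⟨(le_max_left _ _).trans_lt hr.1, by linarith [hr.2]⟩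
    · filter_upwards [lt_mem_nhds hL1] with l hl hl'
      exact absurd hl' hl.not_gt
  have := hmono 0 le_rfl (fun r hr => hwpos r hr.1 hr.2) ⟨le_rfl, zero_le_one⟩
    ⟨zero_le_one, le_rfl⟩ zero_le_one
  simp only [one_pow, one_mul, zero_pow (Nat.succ_ne_zero k), zero_mul] at this
  linarith

lemma exists_rpow_sub_bound {p : ℝ} (hp : 1 ≤ p) (M : ℝ) :
    ∃ C : ℝ, 0 ≤ C ∧ ∀ x ∈ Icc (0 : ℝ) M, ∀ y ∈ Icc (0 : ℝ) M, |x ^ p - y ^ p| ≤ C * |x - y| := by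
  have hc : ContDiff ℝ (1 : ℕ) fun x : ℝ => x ^ p := Real.contDiff_rpow_const_of_le (by simpa)
  obtain ⟨K, hK⟩ := hc.contDiffOn.exists_lipschitzOnWith (by simp) (convex_Icc 0 M) isCompact_Icc
  exact ⟨K, K.2, fun x hx y hy => by simpa [Real.dist_eq] using hK.dist_le_mul x hx y hy⟩

/-- Uniqueness for the Cauchy problem with data at `1`. -/
lemma RadialSol.eq_of_deriv_eq (hn : 5 ≤ n) (hQ : 0 ≤ Q) (h₁ : RadialSol n Q φ₁ ψ₁)
    (h₂ : RadialSol n Q φ₂ ψ₂) (h : ψ₁ 1 = ψ₂ 1) (h' : deriv ψ₁ 1 = deriv ψ₂ 1) {r : ℝ}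
    (hr0 : 0 < r) (hr1 : r ≤ 1) : φ₁ r = φ₂ r := by
  have hn' : (5 : ℝ) ≤ n := by exact_mod_cast hn
  have hp : 1 ≤ ((n : ℝ) + 4) / ((n : ℝ) - 4) := by
    rw [le_div_iff₀ (by linarith)]
    linarith
  obtain ⟨M₁, hM₁⟩ := (isCompact_Icc (a := (0 : ℝ)) (b := 1)).bddAbove_image
    h₁.contDiff_fst.continuous.continuousOn
  obtain ⟨M₂, hM₂⟩ := (isCompact_Icc (a := (0 : ℝ)) (b := 1)).bddAbove_image
    h₂.contDiff_fst.continuous.continuousOn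
  obtain ⟨C, hC0, hC⟩ := exists_rpow_sub_bound hp (max M₁ M₂)
  set w : ℝ → ℝ := fun r => φ₁ r - φ₂ r with hw
  set z : ℝ → ℝ := fun r => ψ₁ r - ψ₂ r with hz
  have hwc : ContDiff ℝ ∞ w := h₁.contDiff_fst.sub h₂.contDiff_fst
  have hzc : ContDiff ℝ ∞ z := h₁.contDiff_snd.sub h₂.contDiff_snd
  have hw1 : w 1 = 0 := by simp [hw, h₁.fst_one, h₂.fst_one]
  have hw1' : deriv w 1 = 0 := by
    rw [hw, deriv_sub_of_contDiff h₁.contDiff_fst h₂.contDiff_fst]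
    simp [h₁.deriv_fst_one, h₂.deriv_fst_one]
  have hz1 : z 1 = 0 := by simp [hz, h]
  have hz1' : deriv z 1 = 0 := by
    rw [hz, deriv_sub_of_contDiff h₁.contDiff_snd h₂.contDiff_snd]
    simp [h']
  set K : ℝ := 3 + 2 * ((n - 1) / r) + Q * C with hK
  have hdE : ∀ s, HasDerivAt
      (fun s => (w s ^ 2 + deriv w s ^ 2 + z s ^ 2 + deriv z s ^ 2) * Real.exp (K * s))
      ((2 * w s * deriv w s + 2 * deriv w s * deriv (deriv w) s + 2 * z s * deriv z s +
        2 * deriv z s * deriv (deriv z) s +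
        K * (w s ^ 2 + deriv w s ^ 2 + z s ^ 2 + deriv z s ^ 2)) * Real.exp (K * s)) s := by
    intro s
    have d1 := hasDerivAt_of_contDiff hwc s
    have d2 := hasDerivAt_of_contDiff (contDiff_deriv hwc) s
    have d3 := hasDerivAt_of_contDiff hzc s
    have d4 := hasDerivAt_of_contDiff (contDiff_deriv hzc) s
    have d5 : HasDerivAt (fun s => Real.exp (K * s)) (Real.exp (K * s) * K) s := by
      simpa using ((hasDerivAt_id s).const_mul K).exp
    refine (((((d1.pow 2).add (d2.pow 2)).add (d3.pow 2)).add (d4.pow 2)).mul d5).congr_deriv ?_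
    simp only [Pi.add_apply, Pi.pow_apply]
    push_cast
    ring
  have hmono : MonotoneOn
      (fun s => (w s ^ 2 + deriv w s ^ 2 + z s ^ 2 + deriv z s ^ 2) * Real.exp (K * s))
      (Icc r 1) := by
    refine monotoneOn_of_deriv_nonneg (convex_Icc r 1)
      (fun s _ => (hdE s).continuousAt.continuousWithinAt)
      (fun s _ => (hdE s).differentiableAt.differentiableWithinAt) fun s hs => ?_
    rw [interior_Icc] at hs
    rw [(hdE s).deriv]
    refine mul_nonneg ?_ (Real.exp_pos _).le
    have hs0 : 0 < s := hr0.trans hs.1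
    have hsI : s ∈ Icc (0 : ℝ) 1 := ⟨hs0.le, hs.2.le⟩
    have e1 := h₁.ode_sub_fst h₂ ⟨hs0, hs.2⟩
    have e2 := h₁.ode_sub_snd h₂ ⟨hs0, hs.2⟩
    rw [← hw] at e1
    rw [← hz] at e2
    set D := φ₁ s ^ (((n : ℝ) + 4) / ((n : ℝ) - 4)) - φ₂ s ^ (((n : ℝ) + 4) / ((n : ℝ) - 4))
    have hD : |D| ≤ C * |w s| := hC _
      ⟨(h₁.pos s hsI).le, (hM₁ (mem_image_of_mem _ hsI)).trans (le_max_left _ _)⟩ _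
      ⟨(h₂.pos s hsI).le, (hM₂ (mem_image_of_mem _ hsI)).trans (le_max_right _ _)⟩
    have e1' : deriv (deriv w) s = z s - (n - 1) / s * deriv w s := by
      field_simp
      linear_combination e1
    have e2' : deriv (deriv z) s = Q * D - (n - 1) / s * deriv z s := by
      field_simp
      linear_combination e2
    have hfrac : (n - 1) / s ≤ (n - 1) / r :=
      div_le_div_of_nonneg_left (by linarith) hr0 hs.1.le
    have hDz : -(C * (w s ^ 2 + deriv z s ^ 2)) ≤ 2 * deriv z s * D := by
      have a1 : |2 * deriv z s * D| ≤ C * (w s ^ 2 + deriv z s ^ 2) := by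
        rw [abs_mul, abs_mul, abs_two]
        have a2 := mul_le_mul_of_nonneg_left hD (abs_nonneg (deriv z s))
        have a3 : 2 * |w s| * |deriv z s| ≤ w s ^ 2 + deriv z s ^ 2 := by
          rw [← sq_abs (w s), ← sq_abs (deriv z s)]
          exact two_mul_le_add_sq _ _
        nlinarith
      exact (abs_le.1 a1).1
    rw [e1', e2', hK]
    have q1 := mul_le_mul_of_nonneg_right hfrac (sq_nonneg (deriv w s))
    have q2 := mul_le_mul_of_nonneg_right hfrac (sq_nonneg (deriv z s))
    have q3 := mul_le_mul_of_nonneg_left hDz hQ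
    have q4 : 0 ≤ (n - 1) / r * w s ^ 2 :=
      mul_nonneg (div_nonneg (by linarith) hr0.le) (sq_nonneg _)
    have q5 : 0 ≤ (n - 1) / r * z s ^ 2 :=
      mul_nonneg (div_nonneg (by linarith) hr0.le) (sq_nonneg _)
    have q6 : 0 ≤ Q * C * (deriv w s ^ 2 + z s ^ 2) := by positivity
    generalize ((n : ℝ) - 1) / s = α at *
    generalize ((n : ℝ) - 1) / r = β at *
    linarith [sq_nonneg (w s + deriv w s), sq_nonneg (deriv w s + z s),
      sq_nonneg (z s + deriv z s), sq_nonneg (w s), sq_nonneg (z s), sq_nonneg (deriv w s),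
      sq_nonneg (deriv z s)]
  have hle := hmono ⟨le_rfl, hr1⟩ ⟨hr1, le_rfl⟩ hr1
  simp only [hw1, hw1', hz1, hz1'] at hle
  norm_num at hle
  have hN : w r ^ 2 + deriv w r ^ 2 + z r ^ 2 + deriv z r ^ 2 ≤ 0 :=
    nonpos_of_mul_nonpos_left hle (Real.exp_pos _)
  have hw0 : w r ^ 2 = 0 := le_antisymm
    (by linarith [sq_nonneg (deriv w r), sq_nonneg (z r), sq_nonneg (deriv z r)]) (sq_nonneg _)
  exact sub_eq_zero.1 (pow_eq_zero_iff two_ne_zero |>.1 hw0)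

/-- A radial solution is determined by the value of `Δu` on the boundary. -/
lemma RadialSol.eq_of_snd_eq (hn : 5 ≤ n) (hQ : 0 ≤ Q) (h₁ : RadialSol n Q φ₁ ψ₁)
    (h₂ : RadialSol n Q φ₂ ψ₂) (h : ψ₁ 1 = ψ₂ 1) {r : ℝ} (hr : r ∈ Icc (0 : ℝ) 1) :
    φ₁ r = φ₂ r := by
  have hd : deriv ψ₁ 1 = deriv ψ₂ 1 :=
    le_antisymm (h₂.deriv_snd_one_le hn hQ h₁ h.symm) (h₁.deriv_snd_one_le hn hQ h₂ h)
  have hpos : ∀ s : ℝ, 0 < s → s ≤ 1 → φ₁ s = φ₂ s := fun s hs hs' =>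
    h₁.eq_of_deriv_eq hn hQ h₂ h hd hs hs'
  rcases hr.1.eq_or_lt with h0 | h0
  · rw [← h0]
    have t1 := (h₁.contDiff_fst.continuous.tendsto 0).mono_left
      (nhdsWithin_le_nhds (s := Ioi (0 : ℝ)))
    have t2 := (h₂.contDiff_fst.continuous.tendsto 0).mono_left
      (nhdsWithin_le_nhds (s := Ioi (0 : ℝ)))
    refine tendsto_nhds_unique_of_eventuallyEq t1 t2 ?_
    filter_upwards [Ioo_mem_nhdsGT (zero_lt_one' ℝ)] with s hs
    exact hpos s hs.1 hs.2.le
  · exact hpos r h0 hr.2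

end uniqueness

/-- A solution is determined by the boundary value of its Laplacian at one point. -/
theorem IsSol.eq_of_laplacian_eq (hn : 5 ≤ n) {Q : ℝ} (hQ : 0 ≤ Q) {u₁ u₂ : 𝔼 → ℝ}
    (h₁ : IsSol n Q u₁) (h₂ : IsSol n Q u₂) {e : 𝔼} (he : ‖e‖ = 1)
    (h : laplacian u₁ e = laplacian u₂ e) {x : 𝔼} (hx : ‖x‖ ≤ 1) : u₁ x = u₂ x := by
  have hn1 : ‖x‖ = ‖‖x‖ • e‖ := by rw [norm_smul, he, norm_norm, mul_one]
  rw [IsSol.radial hn hQ h₁ hx hn1, IsSol.radial hn hQ h₂ hx hn1]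
  exact (IsSol.radialSol hn hQ h₁ he).eq_of_snd_eq hn hQ (IsSol.radialSol hn hQ h₂ he)
    (by simpa using h) ⟨norm_nonneg x, hx⟩

/-- The boundary values of the Laplacians of three solutions are not all distinct. -/
lemma IsSol.laplacian_eq_or (hn : 5 ≤ n) {Q : ℝ} (hQ : 0 ≤ Q) {u₁ u₂ u₃ : 𝔼 → ℝ}
    (h₁ : IsSol n Q u₁) (h₂ : IsSol n Q u₂) (h₃ : IsSol n Q u₃) {e : 𝔼} (he : ‖e‖ = 1) :
    laplacian u₁ e = laplacian u₂ e ∨ laplacian u₁ e = laplacian u₃ e ∨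
      laplacian u₂ e = laplacian u₃ e := by
  have p₁ := (IsSol.radialSol hn hQ h₁ he).pohozaev hn
  have p₂ := (IsSol.radialSol hn hQ h₂ he).pohozaev hn
  have p₃ := (IsSol.radialSol hn hQ h₃ he).pohozaev hn
  simp only [one_smul] at p₁ p₂ p₃
  by_contra! hne
  obtain ⟨h12, h13, h23⟩ := hne
  have e1 : laplacian u₁ e + laplacian u₂ e + n * (((n : ℝ) - 4) / 2) = 0 :=
    mul_left_cancel₀ (sub_ne_zero.2 h12) (by linear_combination p₁ - p₂)
  have e2 : laplacian u₁ e + laplacian u₃ e + n * (((n : ℝ) - 4) / 2) = 0 :=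
    mul_left_cancel₀ (sub_ne_zero.2 h13) (by linear_combination p₁ - p₃)
  exact h23 (by linarith)

end Biharmonic

/-- Proposition 3.2 of the paper: there are at most two solutions, and
`u_s(x) = (2/(1+|x|²))^{(n-4)/2}` is the minimal solution. -/
theorem stmt_14 (n : ℕ) (hn : 5 ≤ n) (Q : ℝ)
    (hQ : Q = ((n : ℝ) - 4) * ((n : ℝ) - 2) * n * ((n : ℝ) + 2) / 16) :
    (∀ u₁ u₂ u₃ : EuclideanSpace ℝ (Fin n) → ℝ,
      IsSol n Q u₁ → IsSol n Q u₂ → IsSol n Q u₃ →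
      (∀ x ∈ closedBall (0 : EuclideanSpace ℝ (Fin n)) 1, u₁ x = u₂ x) ∨
      (∀ x ∈ closedBall (0 : EuclideanSpace ℝ (Fin n)) 1, u₁ x = u₃ x) ∨
      (∀ x ∈ closedBall (0 : EuclideanSpace ℝ (Fin n)) 1, u₂ x = u₃ x)) ∧
    IsSol n Q (fun x => (2 / (1 + ‖x‖ ^ 2)) ^ (((n : ℝ) - 4) / 2)) ∧
    (∀ u : EuclideanSpace ℝ (Fin n) → ℝ, IsSol n Q u →
      ∀ x ∈ ball (0 : EuclideanSpace ℝ (Fin n)) 1,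
        u x ≥ (2 / (1 + ‖x‖ ^ 2)) ^ (((n : ℝ) - 4) / 2)) := by
  have hn5 : (5 : ℝ) ≤ n := by exact_mod_cast hn
  have hQ0 : 0 ≤ Q := by
    rw [hQ]
    exact div_nonneg (mul_nonneg (mul_nonneg (mul_nonneg (by linarith) (by linarith))
      (by linarith)) (by linarith)) (by norm_num)
  have hs : (fun x : EuclideanSpace ℝ (Fin n) => (2 / (1 + ‖x‖ ^ 2)) ^ (((n : ℝ) - 4) / 2)) =
      Biharmonic.spherical 1 := by
    funext x
    simp [Biharmonic.spherical]
  refine ⟨fun u₁ u₂ u₃ h₁ h₂ h₃ => ?_, ?_, fun u hu x hx => ?_⟩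
  · have he : ‖EuclideanSpace.single (⟨0, by omega⟩ : Fin n) (1 : ℝ)‖ = 1 := by simp
    rcases Biharmonic.IsSol.laplacian_eq_or hn hQ0 h₁ h₂ h₃ he with h | h | h
    · exact Or.inl fun x hx => Biharmonic.IsSol.eq_of_laplacian_eq hn hQ0 h₁ h₂ he h
        (mem_closedBall_zero_iff.1 hx)
    · exact Or.inr (Or.inl fun x hx => Biharmonic.IsSol.eq_of_laplacian_eq hn hQ0 h₁ h₃ he h
        (mem_closedBall_zero_iff.1 hx))
    · exact Or.inr (Or.inr fun x hx => Biharmonic.IsSol.eq_of_laplacian_eq hn hQ0 h₂ h₃ he h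
        (mem_closedBall_zero_iff.1 hx))
  · rw [hs, hQ]
    exact Biharmonic.isSol_spherical hn
  · rw [hQ] at hu
    rw [ge_iff_le, congrFun hs x]
    exact Biharmonic.IsSol.spherical_le hn hu (mem_ball_zero_iff.1 hx).le
end

section
/- Let n ≥ 5 be an integer. For λ ∈ (0, n³(n−4)/16), there are at most two smooth positive radial solutions of Δ²u = λ·u^{(n+4)/(n−4)} on the open unit ball B₁ ⊂ ℝⁿ, smooth up to the boundary, with u = 1 and ∂_ν u = −(n−4)/2 on ∂B₁; and for λ = n³(n−4)/16, there is at most one such solution. -/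
open Metric Real

/-- `u` is a smooth positive radial solution of `Δ²u = λ u^{(n+4)/(n-4)}` on the
unit ball with `u = 1` and `∂_ν u = -(n-4)/2` on the unit sphere. -/
def IsRadialSolP (n : ℕ) (lam : ℝ) (u : EuclideanSpace ℝ (Fin n) → ℝ) : Prop :=
  ContDiff ℝ (⊤ : ℕ∞) u ∧
  (∀ x ∈ closedBall (0 : EuclideanSpace ℝ (Fin n)) 1, 0 < u x) ∧
  (∃ φ : ℝ → ℝ, ContDiff ℝ (⊤ : ℕ∞) φ ∧ ∀ x, u x = φ ‖x‖) ∧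
  (∀ x ∈ ball (0 : EuclideanSpace ℝ (Fin n)) 1,
    laplacian (laplacian u) x = lam * u x ^ (((n : ℝ) + 4) / ((n : ℝ) - 4))) ∧
  (∀ x ∈ sphere (0 : EuclideanSpace ℝ (Fin n)) 1, u x = 1) ∧
  (∀ x ∈ sphere (0 : EuclideanSpace ℝ (Fin n)) 1,
    fderiv ℝ u x x = -(((n : ℝ) - 4) / 2))

section RadialLaplacian

variable {n : ℕ} {u : EuclideanSpace ℝ (Fin n) → ℝ} {φ : ℝ → ℝ}

lemma laplacian_eq_sum_fderiv (hu : ContDiff ℝ (⊤ : ℕ∞) u) (x : EuclideanSpace ℝ (Fin n)) :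
    laplacian u x = ∑ i : Fin n,
      fderiv ℝ (fun y => fderiv ℝ u y (EuclideanSpace.single i 1)) x
        (EuclideanSpace.single i 1) := by
  have hd : Differentiable ℝ (fderiv ℝ u) :=
    (hu.fderiv_right (m := 1) (by norm_cast)).differentiable one_ne_zero
  refine Finset.sum_congr rfl fun i _ => ?_
  rw [iteratedFDeriv_two_apply, fderiv_clm_apply (hd x) (by fun_prop)]
  simp

lemma contDiff_laplacian (hu : ContDiff ℝ (⊤ : ℕ∞) u) : ContDiff ℝ (⊤ : ℕ∞) (laplacian u) := by
  have h1 : ContDiff ℝ (⊤ : ℕ∞) (fderiv ℝ u) := hu.fderiv_right (by norm_cast)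
  rw [funext (laplacian_eq_sum_fderiv hu)]
  refine ContDiff.sum fun i _ => ?_
  have h2 : ContDiff ℝ (⊤ : ℕ∞) (fun y => fderiv ℝ u y (EuclideanSpace.single i 1)) :=
    h1.clm_apply contDiff_const
  exact (h2.fderiv_right (by norm_cast)).clm_apply contDiff_const

lemma hasDerivAt_norm_line (x e : EuclideanSpace ℝ (Fin n)) (hx : x ≠ 0) :
    HasDerivAt (fun t : ℝ => ‖x + t • e‖) (inner ℝ x e / ‖x‖) 0 := by
  have h1 : HasDerivAt (fun t : ℝ => x + t • e) e 0 := by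
    simpa using ((hasDerivAt_id (0 : ℝ)).smul_const e).const_add x
  have h2 := h1.norm_sq.sqrt (by simpa using hx)
  have hx' : ‖x‖ ≠ 0 := norm_ne_zero_iff.mpr hx
  convert h2 using 1
  · ext t
    rw [Real.sqrt_sq (norm_nonneg _)]
  · simp only [zero_smul, add_zero, Real.sqrt_sq (norm_nonneg _)]
    field_simp

lemma fderiv_apply_of_radial {g : EuclideanSpace ℝ (Fin n) → ℝ} {G : ℝ → ℝ} {G' : ℝ}
    {x : EuclideanSpace ℝ (Fin n)} (hx : x ≠ 0) (hg : DifferentiableAt ℝ g x)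
    (hG : HasDerivAt G G' ‖x‖) (h : ∀ y, y ≠ 0 → g y = G ‖y‖)
    (e : EuclideanSpace ℝ (Fin n)) :
    fderiv ℝ g x e = G' * (inner ℝ x e / ‖x‖) := by
  have h1 : HasDerivAt (fun t : ℝ => x + t • e) e 0 := by
    simpa using ((hasDerivAt_id (0 : ℝ)).smul_const e).const_add x
  have h2 : HasDerivAt (fun t : ℝ => g (x + t • e)) (fderiv ℝ g x e) 0 :=
    HasFDerivAt.comp_hasDerivAt (0 : ℝ) (by simpa using hg.hasFDerivAt) h1
  have h3 : HasDerivAt (fun t : ℝ => G ‖x + t • e‖) (G' * (inner ℝ x e / ‖x‖)) 0 :=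
    HasDerivAt.comp (0 : ℝ) (by simpa using hG) (hasDerivAt_norm_line x e hx)
  refine h2.unique (h3.congr_of_eventuallyEq ?_)
  have h4 : ∀ᶠ t : ℝ in nhds 0, x + t • e ≠ 0 :=
    h1.continuousAt.eventually_ne (by simpa using hx)
  filter_upwards [h4] with t ht using h _ ht

lemma laplacian_radial (hu : ContDiff ℝ (⊤ : ℕ∞) u) (hφ : ContDiff ℝ (⊤ : ℕ∞) φ)
    (h : ∀ x, u x = φ ‖x‖) {x : EuclideanSpace ℝ (Fin n)} (hx : x ≠ 0) :
    laplacian u x = deriv (deriv φ) ‖x‖ + (n - 1) / ‖x‖ * deriv φ ‖x‖ := by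
  have hd : ∀ r, HasDerivAt φ (deriv φ r) r := fun r =>
    (hφ.differentiable (by simp) r).hasDerivAt
  have hφ' : ContDiff ℝ (⊤ : ℕ∞) (deriv φ) := (contDiff_infty_iff_deriv.mp hφ).2
  have hd' : ∀ r, HasDerivAt (deriv φ) (deriv (deriv φ) r) r := fun r =>
    (hφ'.differentiable (by simp) r).hasDerivAt
  have hr : ‖x‖ ≠ 0 := norm_ne_zero_iff.mpr hx
  have hG : HasDerivAt (fun r => deriv φ r / r)
      ((deriv (deriv φ) ‖x‖ * ‖x‖ - deriv φ ‖x‖ * 1) / ‖x‖ ^ 2) ‖x‖ :=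
    (hd' _).div (hasDerivAt_id _) hr
  have hfirst : ∀ y : EuclideanSpace ℝ (Fin n), y ≠ 0 → ∀ i,
      fderiv ℝ u y (EuclideanSpace.single i 1) = (deriv φ ‖y‖ / ‖y‖) * y i := by
    intro y hy i
    rw [fderiv_apply_of_radial hy (hu.differentiable (by simp) y) (hd _)
      (fun z _ => h z)]
    simp [EuclideanSpace.inner_single_right]
    ring
  have hnd : DifferentiableAt ℝ (fun y : EuclideanSpace ℝ (Fin n) => deriv φ ‖y‖ / ‖y‖) x := by
    have hN : DifferentiableAt ℝ (fun y : EuclideanSpace ℝ (Fin n) => ‖y‖) x :=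
      differentiableAt_id.norm ℝ hx
    exact hG.differentiableAt.comp x hN
  have hsecond : ∀ i, fderiv ℝ (fun y => fderiv ℝ u y (EuclideanSpace.single i 1)) x
        (EuclideanSpace.single i 1) =
      (deriv (deriv φ) ‖x‖ * ‖x‖ - deriv φ ‖x‖) / ‖x‖ ^ 3 * (x i) ^ 2 + deriv φ ‖x‖ / ‖x‖ := by
    intro i
    have hev : (fun y => fderiv ℝ u y (EuclideanSpace.single i 1)) =ᶠ[nhds x]
        fun y => (deriv φ ‖y‖ / ‖y‖) * EuclideanSpace.proj (𝕜 := ℝ) i y := by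
      filter_upwards [continuousAt_id.eventually_ne hx] with y hy using hfirst y hy i
    rw [hev.fderiv_eq, fderiv_fun_mul hnd (by fun_prop)]
    have := fderiv_apply_of_radial hx hnd hG (fun _ _ => rfl)
      (EuclideanSpace.single i 1)
    simp only [add_apply, smul_apply, this,
      ContinuousLinearMap.fderiv]
    simp [EuclideanSpace.inner_single_right]
    field_simp
    ring
  rw [laplacian_eq_sum_fderiv hu, Finset.sum_congr rfl fun i _ => hsecond i,
    Finset.sum_add_distrib, ← Finset.mul_sum, ← EuclideanSpace.real_norm_sq_eq]
  simp
  field_simp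
  ring

lemma exists_profile_laplacian (i : Fin n) (hu : ContDiff ℝ (⊤ : ℕ∞) u)
    (hφ : ContDiff ℝ (⊤ : ℕ∞) φ) (h : ∀ x, u x = φ ‖x‖) :
    ∃ ψ : ℝ → ℝ, ContDiff ℝ (⊤ : ℕ∞) ψ ∧ (∀ x, laplacian u x = ψ ‖x‖) := by
  refine ⟨fun t => laplacian u (t • EuclideanSpace.single i 1), ?_, fun x => ?_⟩
  · exact (contDiff_laplacian hu).comp (contDiff_id.smul contDiff_const)
  · rcases eq_or_ne x 0 with rfl | hx
    · simp
    · have hx' : ‖x‖ • (EuclideanSpace.single i 1 : EuclideanSpace ℝ (Fin n)) ≠ 0 := by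
        simpa using hx
      simp only [laplacian_radial hu hφ h hx, laplacian_radial hu hφ h hx', norm_smul]
      simp

end RadialLaplacian

/-- The radial system satisfied by the profiles `φ` of a solution and `ψ` of its Laplacian. -/
structure IsProfile (n : ℕ) (lam : ℝ) (φ ψ : ℝ → ℝ) : Prop where
  smooth : ContDiff ℝ (⊤ : ℕ∞) φ
  smooth_laplacian : ContDiff ℝ (⊤ : ℕ∞) ψ
  pos : ∀ r ∈ Set.Icc (0 : ℝ) 1, 0 < φ r
  eq_laplacian : ∀ r ∈ Set.Ioo (0 : ℝ) 1,
    r * deriv (deriv φ) r + (n - 1) * deriv φ r = r * ψ r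
  eq_bilaplacian : ∀ r ∈ Set.Ioo (0 : ℝ) 1,
    r * deriv (deriv ψ) r + (n - 1) * deriv ψ r =
      r * (lam * φ r ^ (((n : ℝ) + 4) / ((n : ℝ) - 4)))
  boundary : φ 1 = 1
  boundary_deriv : deriv φ 1 = -(((n : ℝ) - 4) / 2)

lemma IsRadialSolP.exists_isProfile {n : ℕ} (hn : 5 ≤ n) {lam : ℝ}
    {u : EuclideanSpace ℝ (Fin n) → ℝ} (hu : IsRadialSolP n lam u) :
    ∃ φ ψ, IsProfile n lam φ ψ ∧ ∀ x, u x = φ ‖x‖ := by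
  obtain ⟨hsm, hpos, ⟨φ, hφ, h⟩, heq, hb, hb'⟩ := hu
  let i : Fin n := ⟨0, by omega⟩
  obtain ⟨ψ, hψ, hψu⟩ := exists_profile_laplacian i hsm hφ h
  have hray : ∀ r : ℝ, 0 ≤ r →
      ‖r • (EuclideanSpace.single i 1 : EuclideanSpace ℝ (Fin n))‖ = r := by
    intro r hr
    simp [norm_smul, abs_of_nonneg hr]
  have hne : ∀ r : ℝ, 0 < r →
      r • (EuclideanSpace.single i 1 : EuclideanSpace ℝ (Fin n)) ≠ 0 := by
    intro r hr
    simpa using hr.ne'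
  refine ⟨φ, ψ, ⟨hφ, hψ, ?_, ?_, ?_, ?_, ?_⟩, h⟩
  · intro r hr
    have := hpos (r • EuclideanSpace.single i 1) (by
      rw [mem_closedBall_zero_iff, hray r hr.1]; exact hr.2)
    rwa [h, hray r hr.1] at this
  · intro r hr
    have := laplacian_radial hsm hφ h (hne r hr.1)
    rw [hψu, hray r hr.1.le] at this
    have hr0 := hr.1.ne'
    rw [this]
    field_simp
  · intro r hr
    have h1 := laplacian_radial (contDiff_laplacian hsm) hψ hψu (hne r hr.1)
    have h2 := heq (r • EuclideanSpace.single i 1) (by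
      rw [mem_ball_zero_iff, hray r hr.1.le]; exact hr.2)
    rw [h2, h, hray r hr.1.le] at h1
    have hr0 := hr.1.ne'
    rw [h1]
    field_simp
  · have := hb (EuclideanSpace.single i 1) (by simp)
    rw [h] at this
    simpa using this
  · have h0 : (EuclideanSpace.single i 1 : EuclideanSpace ℝ (Fin n)) ≠ 0 := by simp
    have h1 := hb' (EuclideanSpace.single i 1) (by simp)
    rw [fderiv_apply_of_radial h0 (hsm.differentiable (by simp) _)
      (hφ.differentiable (by simp) _).hasDerivAt (fun y _ => h y)] at h1
    simpa using h1

section RadialSystem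

lemma hasDerivAt_of_contDiff {f : ℝ → ℝ} (hf : ContDiff ℝ (⊤ : ℕ∞) f) (r : ℝ) :
    HasDerivAt f (deriv f r) r :=
  (hf.differentiable (by simp) r).hasDerivAt

lemma hasDerivAt_deriv_of_contDiff {f : ℝ → ℝ} (hf : ContDiff ℝ (⊤ : ℕ∞) f) (r : ℝ) :
    HasDerivAt (deriv f) (deriv (deriv f) r) r :=
  hasDerivAt_of_contDiff (contDiff_infty_iff_deriv.mp hf).2 r

/-- The Pohozaev identity for radial solutions, evaluated on the boundary. -/
lemma IsProfile.pohozaev {n : ℕ} (hn : 5 ≤ n) {lam : ℝ} {φ ψ : ℝ → ℝ}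
    (h : IsProfile n lam φ ψ) :
    ψ 1 ^ 2 + n * (n - 4) / 2 * ψ 1 + lam * (n - 4) / n = 0 := by
  have hn' : (5 : ℝ) ≤ n := by exact_mod_cast hn
  obtain ⟨m, rfl⟩ : ∃ m, n = m + 2 := ⟨n - 2, by omega⟩
  set p : ℝ := (((m + 2 : ℕ) : ℝ) + 4) / (((m + 2 : ℕ) : ℝ) - 4) with hp
  set N : ℝ := ((m + 2 : ℕ) : ℝ) with hN
  have hp1 : p + 1 = 2 * N / (N - 4) := by
    rw [hp]; field_simp [show N - 4 ≠ 0 by linarith]; ring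
  set E : ℝ → ℝ := fun r => r ^ (m + 2) * (deriv φ r * deriv ψ r - ψ r ^ 2 / 2
      - lam * (N - 4) / (2 * N) * φ r ^ (p + 1))
    + r ^ (m + 1) * ((N - 4) / 2 * (φ r * deriv ψ r) + N / 2 * (deriv φ r * ψ r)) with hE
  have hcφ := h.smooth.continuous
  have hcψ := h.smooth_laplacian.continuous
  have hcφ' : Continuous (deriv φ) := (contDiff_infty_iff_deriv.mp h.smooth).2.continuous
  have hcψ' : Continuous (deriv ψ) :=
    (contDiff_infty_iff_deriv.mp h.smooth_laplacian).2.continuous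
  have hp0 : 0 ≤ p + 1 := by
    rw [hp1]; exact div_nonneg (by linarith) (by linarith)
  have hcE : Continuous E := by
    have := hcφ.rpow_const (p := p + 1) (fun _ => Or.inr hp0)
    fun_prop
  have hder : ∀ r ∈ Set.Ioo (0 : ℝ) 1, HasDerivAt E 0 r := by
    intro r hr
    have hφr := hasDerivAt_of_contDiff h.smooth r
    have hψr := hasDerivAt_of_contDiff h.smooth_laplacian r
    have hφr' := hasDerivAt_deriv_of_contDiff h.smooth r
    have hψr' := hasDerivAt_deriv_of_contDiff h.smooth_laplacian r
    have hpos := h.pos r ⟨hr.1.le, hr.2.le⟩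
    have hpow := hφr.rpow_const (p := p + 1) (Or.inl hpos.ne')
    have hA := (hasDerivAt_pow (m + 2) r).mul
      (((hφr'.mul hψr').sub ((hψr.pow 2).div_const 2)).sub
        (hpow.const_mul (lam * (N - 4) / (2 * N))))
    have hB := (hasDerivAt_pow (m + 1) r).mul
      (((hφr.mul hψr').const_mul ((N - 4) / 2)).add ((hφr'.mul hψr).const_mul (N / 2)))
    refine (hA.add hB).congr_deriv ?_
    have e1 := h.eq_laplacian r hr
    have e2 := h.eq_bilaplacian r hr
    rw [← hN] at e1 e2
    rw [← hp] at e2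
    simp only [Pi.mul_apply, Pi.sub_apply, Pi.add_apply, Pi.pow_apply, add_sub_cancel_right,
      Real.rpow_add_one hpos.ne']
    have hmN : (m : ℝ) = N - 2 := by rw [hN]; push_cast; ring
    have hr0 := hr.1.ne'
    have e1' : deriv (deriv φ) r = ψ r - (N - 1) * deriv φ r / r := by
      field_simp; linarith
    have e2' : deriv (deriv ψ) r = lam * φ r ^ p - (N - 1) * deriv ψ r / r := by
      field_simp; linarith
    rw [e1', e2', hp1]
    have h4 : N - 4 ≠ 0 := by linarith
    have h5 : N ≠ 0 := by linarith
    push_cast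
    rw [hmN]
    field_simp
    ring
  have hconst : E 1 = E 0 := by
    obtain ⟨c, hc, hc'⟩ := exists_hasDerivAt_eq_slope E (fun _ => 0) zero_lt_one
      hcE.continuousOn hder
    simp at hc'
    linarith
  have h0 : E 0 = 0 := by simp [hE]
  rw [h0] at hconst
  simp only [hE, one_pow, h.boundary, h.boundary_deriv, Real.one_rpow, ← hN] at hconst
  have h5 : N ≠ 0 := by linarith
  field_simp at hconst ⊢
  linarith

variable {k : ℕ} {v w f : ℝ → ℝ}

/-- Linearised radial system: a positive normal derivative of `w` propagates to the origin. -/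
lemma deriv_nonpos_of_system (hv : ContDiff ℝ (⊤ : ℕ∞) v) (hw : ContDiff ℝ (⊤ : ℕ∞) w)
    (e1 : ∀ r ∈ Set.Ioo (0 : ℝ) 1, r * deriv (deriv v) r + (k + 1) * deriv v r = r * w r)
    (e2 : ∀ r ∈ Set.Ioo (0 : ℝ) 1, r * deriv (deriv w) r + (k + 1) * deriv w r = r * f r)
    (hf : ∀ r ∈ Set.Ioo (0 : ℝ) 1, v r ≤ 0 → f r ≤ 0)
    (hv1 : v 1 = 0) (hv1' : deriv v 1 = 0) (hw1 : w 1 = 0) : deriv w 1 ≤ 0 := by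
  by_contra! hpos
  have hcw' : Continuous (deriv w) := (contDiff_infty_iff_deriv.mp hw).2.continuous
  have hcv' : Continuous (deriv v) := (contDiff_infty_iff_deriv.mp hv).2.continuous
  have hflux : ∀ {g h : ℝ → ℝ}, ContDiff ℝ (⊤ : ℕ∞) g →
      (∀ r ∈ Set.Ioo (0 : ℝ) 1, r * deriv (deriv g) r + (k + 1) * deriv g r = r * h r) →
      ∀ r ∈ Set.Ioo (0 : ℝ) 1, HasDerivAt (fun s => s ^ (k + 1) * deriv g s)
        (r ^ (k + 1) * h r) r := by
    intro g h hg he r hr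
    refine ((hasDerivAt_pow (k + 1) r).mul (hasDerivAt_deriv_of_contDiff hg r)).congr_deriv ?_
    have := he r hr
    push_cast
    rw [pow_succ]
    linear_combination r ^ k * this
  set Z : Set ℝ := Set.Icc 0 1 ∩ {r | r ^ (k + 1) * deriv w r ≤ 0} with hZ
  have hZc : IsCompact Z := isCompact_Icc.inter_right
    (isClosed_le (by fun_prop) continuous_const)
  obtain ⟨s, ⟨hs, hs'⟩, hmax⟩ := hZc.exists_isGreatest ⟨0, by simp [hZ]⟩
  simp only [Set.mem_ofPred_eq] at hs'
  have hs1 : s < 1 := by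
    refine lt_of_le_of_ne hs.2 ?_
    rintro rfl
    simp at hs'
    linarith
  have hsub : ∀ r ∈ Set.Ioo s 1, r ∈ Set.Ioo (0 : ℝ) 1 := fun r hr =>
    ⟨hs.1.trans_lt hr.1, hr.2⟩
  have hw'pos : ∀ r ∈ Set.Ioo s 1, 0 ≤ deriv w r := by
    intro r hr
    by_contra! hneg
    have hr0 := hsub r hr
    have : r ∈ Z := ⟨⟨hr0.1.le, hr0.2.le⟩,
      mul_nonpos_of_nonneg_of_nonpos (pow_nonneg hr0.1.le _) hneg.le⟩
    exact absurd (hmax this) (not_le.mpr hr.1)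
  have hwneg : ∀ r ∈ Set.Icc s 1, w r ≤ 0 := by
    have hmono : MonotoneOn w (Set.Icc s 1) :=
      monotoneOn_of_deriv_nonneg (convex_Icc _ _) hw.continuous.continuousOn
        (hw.differentiable (by simp)).differentiableOn (by simpa using hw'pos)
    intro r hr
    exact hw1 ▸ hmono hr ⟨hs1.le, le_rfl⟩ hr.2
  have hv'pos : ∀ r ∈ Set.Ioo s 1, 0 ≤ deriv v r := by
    have hanti : AntitoneOn (fun r => r ^ (k + 1) * deriv v r) (Set.Icc s 1) := by
      refine antitoneOn_of_hasDerivWithinAt_nonpos (convex_Icc _ _) (by fun_prop)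
        (f' := fun r => r ^ (k + 1) * w r) ?_ ?_
      · intro r hr
        rw [interior_Icc] at hr
        exact (hflux hv e1 r (hsub r hr)).hasDerivWithinAt
      · intro r hr
        rw [interior_Icc] at hr
        exact mul_nonpos_of_nonneg_of_nonpos (pow_nonneg (hsub r hr).1.le _)
          (hwneg r ⟨hr.1.le, hr.2.le⟩)
    intro r hr
    have := hanti ⟨hr.1.le, hr.2.le⟩ ⟨hs1.le, le_rfl⟩ hr.2.le
    simp only [hv1', mul_zero] at this
    exact nonneg_of_mul_nonneg_right this (pow_pos (hsub r hr).1 _)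
  have hvneg : ∀ r ∈ Set.Icc s 1, v r ≤ 0 := by
    have hmono : MonotoneOn v (Set.Icc s 1) :=
      monotoneOn_of_deriv_nonneg (convex_Icc _ _) hv.continuous.continuousOn
        (hv.differentiable (by simp)).differentiableOn (by simpa using hv'pos)
    intro r hr
    exact hv1 ▸ hmono hr ⟨hs1.le, le_rfl⟩ hr.2
  have hanti : AntitoneOn (fun r => r ^ (k + 1) * deriv w r) (Set.Icc s 1) := by
    refine antitoneOn_of_hasDerivWithinAt_nonpos (convex_Icc _ _) (by fun_prop)
      (f' := fun r => r ^ (k + 1) * f r) ?_ ?_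
    · intro r hr
      rw [interior_Icc] at hr
      exact (hflux hw e2 r (hsub r hr)).hasDerivWithinAt
    · intro r hr
      rw [interior_Icc] at hr
      exact mul_nonpos_of_nonneg_of_nonpos (pow_nonneg (hsub r hr).1.le _)
        (hf r (hsub r hr) (hvneg r ⟨hr.1.le, hr.2.le⟩))
  have := hanti ⟨le_rfl, hs1.le⟩ ⟨hs1.le, le_rfl⟩ hs1.le
  simp only [one_pow, one_mul] at this
  linarith

/-- Uniqueness for the radial system with vanishing Cauchy data at `r = 1`. -/
lemma eq_zero_of_system_of_cauchy {C : ℝ}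
    (hv : ContDiff ℝ (⊤ : ℕ∞) v) (hw : ContDiff ℝ (⊤ : ℕ∞) w)
    (e1 : ∀ r ∈ Set.Ioo (0 : ℝ) 1, r * deriv (deriv v) r + (k + 1) * deriv v r = r * w r)
    (e2 : ∀ r ∈ Set.Ioo (0 : ℝ) 1, r * deriv (deriv w) r + (k + 1) * deriv w r = r * f r)
    (hf : ∀ r ∈ Set.Ioo (0 : ℝ) 1, |f r| ≤ C * |v r|)
    (hv1 : v 1 = 0) (hv1' : deriv v 1 = 0) (hw1 : w 1 = 0) (hw1' : deriv w 1 = 0) :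
    ∀ r ∈ Set.Ioo (0 : ℝ) 1, v r = 0 := by
  intro ε hε
  have hε0 := hε.1
  have hcw' : Continuous (deriv w) := (contDiff_infty_iff_deriv.mp hw).2.continuous
  have hcv' : Continuous (deriv v) := (contDiff_infty_iff_deriv.mp hv).2.continuous
  have hcv := hv.continuous
  have hcw := hw.continuous
  set K : ℝ := 2 + 2 * ((k + 1) / ε) + |C| with hK
  set N : ℝ → ℝ := fun r => v r ^ 2 + deriv v r ^ 2 + w r ^ 2 + deriv w r ^ 2 with hN
  have hmono : MonotoneOn (fun r => N r * exp (K * r)) (Set.Icc ε 1) := by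
    refine monotoneOn_of_hasDerivWithinAt_nonneg (convex_Icc _ _) (by fun_prop)
      (f' := fun r => (2 * v r * deriv v r + 2 * deriv v r * deriv (deriv v) r
        + 2 * w r * deriv w r + 2 * deriv w r * deriv (deriv w) r + K * N r) * exp (K * r)) ?_ ?_
    · intro r _
      have h1 := hasDerivAt_of_contDiff hv r
      have h2 := hasDerivAt_deriv_of_contDiff hv r
      have h3 := hasDerivAt_of_contDiff hw r
      have h4 := hasDerivAt_deriv_of_contDiff hw r
      have h5 := ((((h1.pow 2).add (h2.pow 2)).add (h3.pow 2)).add (h4.pow 2)).mul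
        (((hasDerivAt_id r).const_mul K).exp)
      refine (h5.congr_deriv ?_).hasDerivWithinAt
      simp [hN]
      ring
    · intro r hr
      rw [interior_Icc] at hr
      have hr0 : 0 < r := hε0.trans hr.1
      have hr1 : r ∈ Set.Ioo (0 : ℝ) 1 := ⟨hr0, hr.2⟩
      refine mul_nonneg ?_ (exp_pos _).le
      have d1 : deriv (deriv v) r = w r - (k + 1) / r * deriv v r := by
        have := e1 r hr1
        field_simp
        linarith
      have d2 : deriv (deriv w) r = f r - (k + 1) / r * deriv w r := by
        have := e2 r hr1
        field_simp
        linarith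
      have hq : ((k : ℝ) + 1) / r ≤ (k + 1) / ε := by gcongr; exact hr.1.le
      have hq0 : 0 ≤ ((k : ℝ) + 1) / ε := by positivity
      have hfb : |f r| ≤ |C| * |v r| :=
        (hf r hr1).trans (mul_le_mul_of_nonneg_right (le_abs_self C) (abs_nonneg _))
      have hfw : -(|C| * (v r ^ 2 + deriv w r ^ 2)) ≤ 2 * (deriv w r * f r) := by
        have a1 : |deriv w r * f r| ≤ |deriv w r| * (|C| * |v r|) := by
          rw [abs_mul]; gcongr
        have a2 : |C| * (2 * |v r| * |deriv w r|) ≤ |C| * (|v r| ^ 2 + |deriv w r| ^ 2) := by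
          gcongr; exact two_mul_le_add_sq _ _
        rw [sq_abs, sq_abs] at a2
        have a3 := neg_abs_le (deriv w r * f r)
        linarith
      rw [d1, d2, hK]
      set q := ((k : ℝ) + 1) / r
      set Q := ((k : ℝ) + 1) / ε
      simp only [hN]
      have b1 : q * deriv v r ^ 2 ≤ Q * deriv v r ^ 2 := by gcongr
      have b2 : q * deriv w r ^ 2 ≤ Q * deriv w r ^ 2 := by gcongr
      have b3 : 0 ≤ Q * v r ^ 2 := by positivity
      have b4 : 0 ≤ Q * w r ^ 2 := by positivity
      have b5 : 0 ≤ |C| * deriv v r ^ 2 := by positivity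
      have b6 : 0 ≤ |C| * w r ^ 2 := by positivity
      nlinarith [sq_nonneg (v r + deriv v r), sq_nonneg (deriv v r + w r),
        sq_nonneg (w r + deriv w r), sq_nonneg (v r), sq_nonneg (deriv w r)]
  have hle := hmono ⟨le_rfl, hε.2.le⟩ ⟨hε.2.le, le_rfl⟩ hε.2.le
  have hN1 : N 1 = 0 := by simp [hN, hv1, hv1', hw1, hw1']
  simp only [hN1, zero_mul] at hle
  have hNle : N ε ≤ 0 := nonpos_of_mul_nonpos_left hle (exp_pos _)
  simp only [hN] at hNle
  have : v ε ^ 2 = 0 := by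
    nlinarith [sq_nonneg (v ε), sq_nonneg (deriv v ε), sq_nonneg (w ε), sq_nonneg (deriv w ε)]
  exact pow_eq_zero_iff two_ne_zero |>.mp this

end RadialSystem

lemma exists_rpow_lipschitz {p : ℝ} (hp : 1 ≤ p) (M : ℝ) :
    ∃ C, ∀ a ∈ Set.Icc 0 M, ∀ b ∈ Set.Icc 0 M, |a ^ p - b ^ p| ≤ C * |a - b| := by
  refine ⟨p * M ^ (p - 1), fun a ha b hb => ?_⟩
  refine Convex.norm_image_sub_le_of_norm_hasDerivWithin_le (f := fun x : ℝ => x ^ p)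
    (f' := fun x => p * x ^ (p - 1)) (s := Set.Icc 0 M)
    (fun x _ => (Real.hasDerivAt_rpow_const (Or.inr hp)).hasDerivWithinAt) (fun x hx => ?_)
    (convex_Icc _ _) hb ha
  rw [Real.norm_of_nonneg (mul_nonneg (by linarith) (Real.rpow_nonneg hx.1 _))]
  exact mul_le_mul_of_nonneg_left (Real.rpow_le_rpow hx.1 hx.2 (by linarith)) (by linarith)

/-- Radial solutions are determined by `u`, `∂_ν u` and `Δu` on the unit sphere. -/
lemma IsProfile.eqOn {n : ℕ} (hn : 5 ≤ n) {lam : ℝ} (hlam : 0 < lam) {φ₁ ψ₁ φ₂ ψ₂ : ℝ → ℝ}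
    (h₁ : IsProfile n lam φ₁ ψ₁) (h₂ : IsProfile n lam φ₂ ψ₂) (hψ : ψ₁ 1 = ψ₂ 1) :
    Set.EqOn φ₁ φ₂ (Set.Icc 0 1) := by
  have hn' : (5 : ℝ) ≤ n := by exact_mod_cast hn
  obtain ⟨k, rfl⟩ : ∃ k, n = k + 2 := ⟨n - 2, by omega⟩
  set p : ℝ := (((k + 2 : ℕ) : ℝ) + 4) / (((k + 2 : ℕ) : ℝ) - 4) with hp
  have hp1 : 1 ≤ p := by rw [hp, one_le_div (by linarith)]; linarith
  have hk : (((k + 2 : ℕ) : ℝ) - 1) = k + 1 := by push_cast; ring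
  have hsub : ∀ {f g : ℝ → ℝ}, ContDiff ℝ (⊤ : ℕ∞) f → ContDiff ℝ (⊤ : ℕ∞) g →
      deriv (fun r => f r - g r) = fun r => deriv f r - deriv g r := fun hf hg => funext fun r =>
    deriv_fun_sub (hf.differentiable (by simp) r) (hg.differentiable (by simp) r)
  have hderiv : ∀ {f : ℝ → ℝ}, ContDiff ℝ (⊤ : ℕ∞) f → ContDiff ℝ (⊤ : ℕ∞) (deriv f) :=
    fun hf => (contDiff_infty_iff_deriv.mp hf).2
  have key : ∀ {φ ψ χ ω : ℝ → ℝ}, IsProfile (k + 2) lam φ ψ → IsProfile (k + 2) lam χ ω →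
      (∀ r ∈ Set.Ioo (0 : ℝ) 1, r * deriv (deriv fun r => φ r - χ r) r +
        (k + 1) * deriv (fun r => φ r - χ r) r = r * (ψ r - ω r)) ∧
      (∀ r ∈ Set.Ioo (0 : ℝ) 1, r * deriv (deriv fun r => ψ r - ω r) r +
        (k + 1) * deriv (fun r => ψ r - ω r) r = r * (lam * (φ r ^ p - χ r ^ p))) ∧
      deriv (fun r => φ r - χ r) 1 = 0 := by
    intro φ ψ χ ω a b
    rw [hsub a.smooth b.smooth, hsub a.smooth_laplacian b.smooth_laplacian,
      hsub (hderiv a.smooth) (hderiv b.smooth),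
      hsub (hderiv a.smooth_laplacian) (hderiv b.smooth_laplacian)]
    refine ⟨fun r hr => ?_, fun r hr => ?_, ?_⟩
    · have ea := a.eq_laplacian r hr
      have eb := b.eq_laplacian r hr
      rw [hk] at ea eb
      linear_combination ea - eb
    · have ea := a.eq_bilaplacian r hr
      have eb := b.eq_bilaplacian r hr
      rw [hk] at ea eb
      linear_combination ea - eb
    · simp [a.boundary_deriv, b.boundary_deriv]
  have hle : ∀ {φ ψ χ ω : ℝ → ℝ}, IsProfile (k + 2) lam φ ψ → IsProfile (k + 2) lam χ ω →
      ψ 1 = ω 1 → deriv ψ 1 ≤ deriv ω 1 := by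
    intro φ ψ χ ω a b hab
    obtain ⟨e1, e2, hb⟩ := key a b
    have := deriv_nonpos_of_system (a.smooth.sub b.smooth)
      (a.smooth_laplacian.sub b.smooth_laplacian) e1 e2 (fun r hr hneg => ?_)
      (by simp [a.boundary, b.boundary]) hb (by simp [hab])
    · rw [hsub a.smooth_laplacian b.smooth_laplacian] at this
      linarith
    · have hr' : r ∈ Set.Icc (0 : ℝ) 1 := ⟨hr.1.le, hr.2.le⟩
      have := Real.rpow_le_rpow (a.pos r hr').le (sub_nonpos.mp hneg) (by linarith : 0 ≤ p)
      exact mul_nonpos_of_nonneg_of_nonpos hlam.le (sub_nonpos.mpr this)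
  have hψ' : deriv ψ₁ 1 = deriv ψ₂ 1 := le_antisymm (hle h₁ h₂ hψ) (hle h₂ h₁ hψ.symm)
  obtain ⟨M₁, hM₁⟩ := isCompact_Icc.bddAbove_image
    (h₁.smooth.continuous.continuousOn (s := Set.Icc (0 : ℝ) 1))
  obtain ⟨M₂, hM₂⟩ := isCompact_Icc.bddAbove_image
    (h₂.smooth.continuous.continuousOn (s := Set.Icc (0 : ℝ) 1))
  obtain ⟨C, hC⟩ := exists_rpow_lipschitz hp1 (max M₁ M₂)
  obtain ⟨e1, e2, hb⟩ := key h₁ h₂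
  have hopen := eq_zero_of_system_of_cauchy (C := lam * C) (h₁.smooth.sub h₂.smooth)
    (h₁.smooth_laplacian.sub h₂.smooth_laplacian) e1 e2 (fun r hr => ?_)
    (by simp [h₁.boundary, h₂.boundary]) hb (by simp [hψ])
    (by rw [hsub h₁.smooth_laplacian h₂.smooth_laplacian]; simp [hψ'])
  · have heq : Set.EqOn φ₁ φ₂ (Set.Ioo 0 1) := fun r hr => sub_eq_zero.mp (hopen r hr)
    have := heq.closure h₁.smooth.continuous h₂.smooth.continuous
    rwa [closure_Ioo zero_ne_one] at this
  · have hr' : r ∈ Set.Icc (0 : ℝ) 1 := ⟨hr.1.le, hr.2.le⟩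
    rw [abs_mul, abs_of_pos hlam, mul_assoc]
    exact mul_le_mul_of_nonneg_left (hC _
      ⟨(h₁.pos r hr').le, (hM₁ (Set.mem_image_of_mem _ hr')).trans (le_max_left _ _)⟩ _
      ⟨(h₂.pos r hr').le, (hM₂ (Set.mem_image_of_mem _ hr')).trans (le_max_right _ _)⟩) hlam.le

/-- From Section 3 of the paper: for `0 < λ < n³(n-4)/16` the problem `(P_λ)` has
at most two radial solutions, and for `λ = n³(n-4)/16` at most one. -/
theorem stmt_16 (n : ℕ) (hn : 5 ≤ n) :
    (∀ lam : ℝ, 0 < lam → lam < (n : ℝ) ^ 3 * ((n : ℝ) - 4) / 16 →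
      ∀ u₁ u₂ u₃ : EuclideanSpace ℝ (Fin n) → ℝ,
        IsRadialSolP n lam u₁ → IsRadialSolP n lam u₂ → IsRadialSolP n lam u₃ →
        (∀ x ∈ closedBall (0 : EuclideanSpace ℝ (Fin n)) 1, u₁ x = u₂ x) ∨
        (∀ x ∈ closedBall (0 : EuclideanSpace ℝ (Fin n)) 1, u₁ x = u₃ x) ∨
        (∀ x ∈ closedBall (0 : EuclideanSpace ℝ (Fin n)) 1, u₂ x = u₃ x)) ∧
    (∀ u₁ u₂ : EuclideanSpace ℝ (Fin n) → ℝ,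
      IsRadialSolP n ((n : ℝ) ^ 3 * ((n : ℝ) - 4) / 16) u₁ →
      IsRadialSolP n ((n : ℝ) ^ 3 * ((n : ℝ) - 4) / 16) u₂ →
      ∀ x ∈ closedBall (0 : EuclideanSpace ℝ (Fin n)) 1, u₁ x = u₂ x) := by
  have hn' : (5 : ℝ) ≤ n := by exact_mod_cast hn
  have htransfer : ∀ {lam : ℝ} {φ₁ ψ₁ φ₂ ψ₂ : ℝ → ℝ} {u₁ u₂ : EuclideanSpace ℝ (Fin n) → ℝ},
      0 < lam → IsProfile n lam φ₁ ψ₁ → IsProfile n lam φ₂ ψ₂ → (∀ x, u₁ x = φ₁ ‖x‖) →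
      (∀ x, u₂ x = φ₂ ‖x‖) → ψ₁ 1 = ψ₂ 1 →
      ∀ x ∈ closedBall (0 : EuclideanSpace ℝ (Fin n)) 1, u₁ x = u₂ x := by
    intro lam φ₁ ψ₁ φ₂ ψ₂ u₁ u₂ hlam h₁ h₂ hu₁ hu₂ hψ x hx
    rw [hu₁, hu₂]
    exact h₁.eqOn hn hlam h₂ hψ ⟨norm_nonneg x, mem_closedBall_zero_iff.mp hx⟩
  constructor
  · intro lam hlam _ u₁ u₂ u₃ hs₁ hs₂ hs₃
    obtain ⟨φ₁, ψ₁, h₁, hu₁⟩ := hs₁.exists_isProfile hn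
    obtain ⟨φ₂, ψ₂, h₂, hu₂⟩ := hs₂.exists_isProfile hn
    obtain ⟨φ₃, ψ₃, h₃, hu₃⟩ := hs₃.exists_isProfile hn
    have p₁ := h₁.pohozaev hn
    have p₂ := h₂.pohozaev hn
    have p₃ := h₃.pohozaev hn
    by_cases h12 : ψ₁ 1 = ψ₂ 1
    · exact Or.inl (htransfer hlam h₁ h₂ hu₁ hu₂ h12)
    by_cases h13 : ψ₁ 1 = ψ₃ 1
    · exact Or.inr (Or.inl (htransfer hlam h₁ h₃ hu₁ hu₃ h13))
    refine Or.inr (Or.inr (htransfer hlam h₂ h₃ hu₂ hu₃ ?_))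
    have s12 : ψ₁ 1 + ψ₂ 1 + n * (n - 4) / 2 = 0 :=
      mul_left_cancel₀ (sub_ne_zero.mpr h12) (by linear_combination p₁ - p₂)
    have s13 : ψ₁ 1 + ψ₃ 1 + n * (n - 4) / 2 = 0 :=
      mul_left_cancel₀ (sub_ne_zero.mpr h13) (by linear_combination p₁ - p₃)
    linarith
  · intro u₁ u₂ hs₁ hs₂
    obtain ⟨φ₁, ψ₁, h₁, hu₁⟩ := hs₁.exists_isProfile hn
    obtain ⟨φ₂, ψ₂, h₂, hu₂⟩ := hs₂.exists_isProfile hn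
    have hlam : 0 < (n : ℝ) ^ 3 * ((n : ℝ) - 4) / 16 := by
      have : 0 < (n : ℝ) - 4 := by linarith
      positivity
    have hroot : ∀ {φ ψ : ℝ → ℝ}, IsProfile n ((n : ℝ) ^ 3 * ((n : ℝ) - 4) / 16) φ ψ →
        ψ 1 = -(n * (n - 4) / 4) := by
      intro φ ψ h
      have hq := h.pohozaev hn
      have hn0 : (n : ℝ) ≠ 0 := by linarith
      have hsq : (ψ 1 + n * (n - 4) / 4) ^ 2 = 0 := by
        rw [← hq]
        field_simp
        ring
      linarith [pow_eq_zero_iff two_ne_zero |>.mp hsq]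
    exact htransfer hlam h₁ h₂ hu₁ hu₂ ((hroot h₁).trans (hroot h₂).symm)
end
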